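/- arXiv:2510.14527 — 3 statements merged into one kernel-verified Lean document; each statement's English description precedes it below -/
import Mathlib

section
/- Let ε > 0 and let H, K : (−ε, ε) → ℝ be real analytic functions with K(0) < 0. Then 4·H(t)² = −t²·K(t) for all |t| < ε if and only if H(0) = 0 and there exists a sign σ ∈ {+1, −1} such that for every m = 1, 2, …, one has H⁽ᵐ⁾ = σ·( −m·K⁽ᵐ⁻¹⁾ − (4/(m+1))·Σ_{r=2}^{m−1} C(m+1, r)·H⁽ʳ⁾·H⁽ᵐ⁻ʳ⁺¹⁾ ) / ( 2^{2−δ_{m1}}·√(−K⁽⁰⁾) ), where H⁽ⁱ⁾ and K⁽ⁱ⁾ denote the i-th derivatives of H and K at t = 0, and the same sign σ applies for all m. -/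
open Set Filter
open scoped BigOperators Topology

noncomputable section

/-- Partial derivative in the first variable. -/
def pdx (f : ℝ × ℝ → ℝ) (p : ℝ × ℝ) : ℝ := deriv (fun s : ℝ => f (s, p.2)) p.1

/-- Partial derivative in the second variable. -/
def pdy (f : ℝ × ℝ → ℝ) (p : ℝ × ℝ) : ℝ := deriv (fun s : ℝ => f (p.1, s)) p.2

/-- Second partial derivatives. -/
def fxx (f : ℝ × ℝ → ℝ) : ℝ × ℝ → ℝ := pdx (pdx f)
def fxy (f : ℝ × ℝ → ℝ) : ℝ × ℝ → ℝ := pdy (pdx f)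
def fyy (f : ℝ × ℝ → ℝ) : ℝ × ℝ → ℝ := pdy (pdy f)

/-- An analytic Jordan curve: image of a periodic injective real analytic map with
nowhere vanishing derivative. -/
def IsAnalyticJordanCurve {E : Type*} [NormedAddCommGroup E] [NormedSpace ℝ E]
    (Γ : Set E) : Prop :=
  ∃ (γ : ℝ → E) (T : ℝ), 0 < T ∧
    AnalyticOnNhd ℝ γ univ ∧
    (∀ s, γ (s + T) = γ s) ∧
    InjOn γ (Ico 0 T) ∧
    (∀ s, deriv γ s ≠ 0) ∧
    Γ = range γ

/-- A Jordan domain with analytic boundary. -/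
def IsAnalyticJordanDomain (Ω : Set (ℝ × ℝ)) : Prop :=
  IsOpen Ω ∧ Bornology.IsBounded Ω ∧ IsConnected Ω ∧ IsAnalyticJordanCurve (frontier Ω)

/-- `f` is real analytic in the closed set `s` : it agrees on `s` with a function
analytic on an open neighborhood of `s`. -/
def AnalyticOnClosed {E : Type*} [NormedAddCommGroup E] [NormedSpace ℝ E]
    (f : E → ℝ) (s : Set E) : Prop :=
  ∃ (U : Set E) (g : E → ℝ), IsOpen U ∧ s ⊆ U ∧ AnalyticOnNhd ℝ g U ∧ EqOn f g s

/-- The isotropic CRPC equation with parameter `t` at a point. -/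
def IsotropicCRPCAt (t : ℝ) (f : ℝ × ℝ → ℝ) (p : ℝ × ℝ) : Prop :=
  fxx f p + fyy f p = t * Real.sqrt ((fxy f p) ^ 2 - fxx f p * fyy f p)

/-- The Euclidean CRPC equation with parameter `t` at a point. -/
def EuclideanCRPCAt (t : ℝ) (f : ℝ × ℝ → ℝ) (p : ℝ × ℝ) : Prop :=
  (1 + (pdy f p) ^ 2) * fxx f p - 2 * pdx f p * pdy f p * fxy f p
      + (1 + (pdx f p) ^ 2) * fyy f p
    = t * Real.sqrt ((1 + (pdx f p) ^ 2 + (pdy f p) ^ 2)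
        * ((fxy f p) ^ 2 - fxx f p * fyy f p))

/-- Hölder condition with exponent 1/2 on a set. -/
def HolderHalfOn (g : ℝ × ℝ → ℝ) (s : Set (ℝ × ℝ)) : Prop :=
  ∃ C : ℝ, ∀ u ∈ s, ∀ v ∈ s, |g u - g v| ≤ C * ‖u - v‖ ^ ((1 : ℝ) / 2)

def C0norm (g : ℝ × ℝ → ℝ) (s : Set (ℝ × ℝ)) : ℝ := sSup ((fun p => |g p|) '' s)

def holderSemi (g : ℝ × ℝ → ℝ) (s : Set (ℝ × ℝ)) : ℝ :=
  sSup {r : ℝ | ∃ u ∈ s, ∃ v ∈ s, u ≠ v ∧ r = |g u - g v| / ‖u - v‖ ^ ((1 : ℝ) / 2)}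

/-- The `C^{1/2}` Hölder norm. -/
def ChalfNorm (g : ℝ × ℝ → ℝ) (s : Set (ℝ × ℝ)) : ℝ := C0norm g s + holderSemi g s

/-- The `C²` norm. -/
def C2norm (f : ℝ × ℝ → ℝ) (s : Set (ℝ × ℝ)) : ℝ :=
  C0norm f s + max (C0norm (pdx f) s) (C0norm (pdy f) s)
    + max (C0norm (fxx f) s) (max (C0norm (fxy f) s) (C0norm (fyy f) s))

/-- The `C^{2+1/2}` Hölder norm. -/
def C2halfNorm (f : ℝ × ℝ → ℝ) (s : Set (ℝ × ℝ)) : ℝ :=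
  C2norm f s + max (holderSemi (fxx f) s) (max (holderSemi (fxy f) s) (holderSemi (fyy f) s))

/-- Membership in the class `C^{1/2}` on `Ω̄`. -/
def IsCHalf (g : ℝ × ℝ → ℝ) (Ω : Set (ℝ × ℝ)) : Prop :=
  ContinuousOn g (closure Ω) ∧ HolderHalfOn g Ω

/-- Membership in the class `C^{2+1/2}` on `Ω̄`. -/
def IsC2Half (f : ℝ × ℝ → ℝ) (Ω : Set (ℝ × ℝ)) : Prop :=
  ContDiffOn ℝ 2 f Ω ∧
  ContinuousOn f (closure Ω) ∧ ContinuousOn (pdx f) (closure Ω) ∧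
  ContinuousOn (pdy f) (closure Ω) ∧ ContinuousOn (fxx f) (closure Ω) ∧
  ContinuousOn (fxy f) (closure Ω) ∧ ContinuousOn (fyy f) (closure Ω) ∧
  HolderHalfOn (fxx f) Ω ∧ HolderHalfOn (fxy f) Ω ∧ HolderHalfOn (fyy f) Ω

/-- `C^∞` up to the boundary. -/
def IsCInftyClosed (f : ℝ × ℝ → ℝ) (Ω : Set (ℝ × ℝ)) : Prop :=
  ContDiffOn ℝ (⊤ : ℕ∞) f Ω ∧ ∀ i j : ℕ, ContinuousOn (pdx^[i] (pdy^[j] f)) (closure Ω)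

/-- Right-hand side of the recursive Poisson equation (isotropic case). -/
def poissonRHS (f : ℕ → ℝ × ℝ → ℝ) (m : ℕ) (p : ℝ × ℝ) : ℝ :=
  ((m : ℝ) * ∑ r ∈ Finset.range m, ((m - 1).choose r : ℝ) *
      (fxy (f r) p * fxy (f (m - r - 1)) p - fxx (f r) p * fyy (f (m - r - 1)) p)
    - (1 / ((m : ℝ) + 1)) * ∑ r ∈ Finset.Icc 2 (m - 1), ((m + 1).choose r : ℝ) *
      (fxx (f r) p + fyy (f r) p) * (fxx (f (m - r + 1)) p + fyy (f (m - r + 1)) p))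
  / ((2 : ℝ) ^ (1 - (if m = 1 then 1 else 0) : ℕ) *
      Real.sqrt ((fxy (f 0) p) ^ 2 - fxx (f 0) p * fyy (f 0) p))

/-- `C²`-convergence on `Ω` at parameter `t` of the series with terms `f m · t^m/m!`
to the function `F`. -/
def C2ConvergesTo (f : ℕ → ℝ × ℝ → ℝ) (Ω : Set (ℝ × ℝ)) (t : ℝ) (F : ℝ × ℝ → ℝ) : Prop :=
  TendstoUniformlyOn
    (fun n p => ∑ m ∈ Finset.range n, f m p * t ^ m / (m.factorial : ℝ)) F atTop Ω ∧
  TendstoUniformlyOn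
    (fun n p => ∑ m ∈ Finset.range n, pdx (f m) p * t ^ m / (m.factorial : ℝ)) (pdx F) atTop Ω ∧
  TendstoUniformlyOn
    (fun n p => ∑ m ∈ Finset.range n, pdy (f m) p * t ^ m / (m.factorial : ℝ)) (pdy F) atTop Ω ∧
  TendstoUniformlyOn
    (fun n p => ∑ m ∈ Finset.range n, fxx (f m) p * t ^ m / (m.factorial : ℝ)) (fxx F) atTop Ω ∧
  TendstoUniformlyOn
    (fun n p => ∑ m ∈ Finset.range n, fxy (f m) p * t ^ m / (m.factorial : ℝ)) (fxy F) atTop Ω ∧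
  TendstoUniformlyOn
    (fun n p => ∑ m ∈ Finset.range n, fyy (f m) p * t ^ m / (m.factorial : ℝ)) (fyy F) atTop Ω


/-- Algebraic core. -/
theorem aux_alg (h k : ℕ → ℝ) (hk : k 0 < 0) :
    (∀ n : ℕ, 4 * ∑ i ∈ Finset.range (n + 1), (n.choose i : ℝ) * h i * h (n - i)
        + (n : ℝ) * ((n : ℝ) - 1) * k (n - 2) = 0) ↔
    (h 0 = 0 ∧ ∃ σ : ℝ, (σ = 1 ∨ σ = -1) ∧ ∀ m : ℕ, 1 ≤ m →
      h m =
        σ * ((-(m : ℝ) * k (m - 1)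
            - 4 / ((m : ℝ) + 1) * ∑ r ∈ Finset.Icc 2 (m - 1), ((m + 1).choose r : ℝ) *
                h r * h (m - r + 1))
          / ((2 : ℝ) ^ (2 - (if m = 1 then 1 else 0) : ℕ) * Real.sqrt (-k 0)))) := by
  obtain ⟨s, hs, hsk⟩ : ∃ s : ℝ, 0 < s ∧ s = Real.sqrt (-k 0) :=
    ⟨_, Real.sqrt_pos.mpr (by linarith), rfl⟩
  have hs2 : s ^ 2 = -k 0 := by rw [hsk]; exact Real.sq_sqrt (by linarith)
  rw [← hsk]
  have key : h 0 = 0 → ∀ p : ℕ,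
      ∑ i ∈ Finset.range (p + 3 + 1), ((p + 3).choose i : ℝ) * h i * h (p + 3 - i)
      = ∑ r ∈ Finset.Icc 2 (p + 2 - 1), ((p + 2 + 1).choose r : ℝ) * h r * h (p + 2 - r + 1)
        + 2 * ((p : ℝ) + 3) * h 1 * h (p + 2) := by
    intro h0 p
    have e1 : Finset.Icc 2 (p + 2 - 1) = Finset.Ico 2 (p + 2) := by
      ext x; simp only [Finset.mem_Icc, Finset.mem_Ico]; omega
    rw [e1, Finset.sum_Ico_eq_sum_range, Finset.sum_range_succ, Finset.sum_range_succ,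
      Finset.sum_range_succ', Finset.sum_range_succ']
    have e2 : (p + 3).choose (p + 2) = p + 3 := Nat.choose_succ_self_right (p + 2)
    have e3 : p + 3 - (p + 2) = 1 := by omega
    have e4 : p + 3 - (0 + 1) = p + 2 := by omega
    rw [e2, e3, e4]
    have e5 : ∑ i ∈ Finset.range p, ((p + 3).choose (i + 1 + 1) : ℝ) * h (i + 1 + 1) * h (p + 3 - (i + 1 + 1))
       = ∑ i ∈ Finset.range (p + 2 - 2), ((p + 2 + 1).choose (2 + i) : ℝ) * h (2 + i) * h (p + 2 - (2 + i) + 1) := by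
      apply Finset.sum_congr rfl
      intro i hi
      have := Finset.mem_range.mp hi
      rw [show p + 3 - (i + 1 + 1) = p + 2 - (2 + i) + 1 by omega, show i + 1 + 1 = 2 + i by omega]
    rw [e5]
    simp [h0]
    ring
  have core : h 0 = 0 → ∀ σ : ℝ, (σ = 1 ∨ σ = -1) → h 1 = σ * s / 2 → ∀ p : ℕ,
    ((4 * ∑ i ∈ Finset.range (p + 3 + 1), ((p + 3).choose i : ℝ) * h i * h (p + 3 - i)
        + ((p + 3 : ℕ) : ℝ) * (((p + 3 : ℕ) : ℝ) - 1) * k (p + 3 - 2) = 0) ↔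
      h (p + 2) =
        σ * ((-((p + 2 : ℕ) : ℝ) * k (p + 2 - 1)
            - 4 / (((p + 2 : ℕ) : ℝ) + 1) * ∑ r ∈ Finset.Icc 2 (p + 2 - 1), ((p + 2 + 1).choose r : ℝ) *
                h r * h (p + 2 - r + 1))
          / ((2 : ℝ) ^ (2 - (if p + 2 = 1 then 1 else 0) : ℕ) * s))) := by
    intro h0 σ hσ h1 p
    rw [key h0 p, h1]
    generalize (∑ r ∈ Finset.Icc 2 (p + 2 - 1), ((p + 2 + 1).choose r : ℝ) * h r * h (p + 2 - r + 1)) = S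
    rw [if_neg (by omega), show p + 3 - 2 = p + 1 by omega, show p + 2 - 1 = p + 1 by omega]
    push_cast
    have hp : (p : ℝ) + 3 ≠ 0 := by positivity
    have hp' : (p : ℝ) + 2 + 1 ≠ 0 := by positivity
    generalize h (p + 2) = x
    generalize k (p + 1) = y
    have hσ2 : σ ^ 2 = 1 := by rcases hσ with rfl | rfl <;> norm_num
    have hσ0 : σ ≠ 0 := by rcases hσ with rfl | rfl <;> norm_num
    have : σ * ((-((p : ℝ) + 2) * y - 4 / ((p : ℝ) + 2 + 1) * S) / (2 ^ (2 - 0) * s))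
       = x - σ * (4 * (S + 2 * (↑p + 3) * (σ * s / 2) * x) + (↑p + 3) * (↑p + 3 - 1) * y) / (4 * s * (p + 3)) := by
      rw [show (p : ℝ) + 2 + 1 = p + 3 by ring]
      field_simp
      linear_combination (16 * s * ((p : ℝ) + 3) * x) * hσ2
    rw [this]
    constructor
    · intro h; rw [h]; simp
    · intro h
      have h2 : σ * (4 * (S + 2 * (↑p + 3) * (σ * s / 2) * x) + (↑p + 3) * (↑p + 3 - 1) * y) / (4 * s * (p + 3)) = 0 := by linarith
      rw [div_eq_zero_iff] at h2
      rcases h2 with h2 | h2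
      · exact (mul_eq_zero.mp h2).resolve_left hσ0
      · exact absurd h2 (by positivity)
  constructor
  · intro hall
    have h0 : h 0 = 0 := by
      have := hall 0
      simp at this
      exact this
    have h2 := hall 2
    simp [Finset.sum_range_succ, h0] at h2
    have h1s : (h 1 - s / 2) * (h 1 + s / 2) = 0 := by
      linear_combination (1 / 8) * h2 - (1 / 4) * hs2
    obtain ⟨σ, hσ, h1⟩ : ∃ σ : ℝ, (σ = 1 ∨ σ = -1) ∧ h 1 = σ * s / 2 := by
      rcases mul_eq_zero.mp h1s with h | h
      · exact ⟨1, Or.inl rfl, by linarith⟩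
      · exact ⟨-1, Or.inr rfl, by linarith⟩
    refine ⟨h0, σ, hσ, ?_⟩
    intro m hm
    obtain rfl | ⟨p, rfl⟩ : m = 1 ∨ ∃ p, m = p + 2 := by
      rcases Nat.lt_or_ge m 2 with h | h
      · left; omega
      · right; exact ⟨m - 2, by omega⟩
    · simp
      rw [h1, ← hs2]; field_simp
    · exact (core h0 σ hσ h1 p).mp (hall (p + 3))
  · rintro ⟨h0, σ, hσ, hall⟩
    have hσ2 : σ ^ 2 = 1 := by rcases hσ with rfl | rfl <;> norm_num
    have h1 : h 1 = σ * s / 2 := by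
      have := hall 1 le_rfl
      simp at this
      rw [this, ← hs2]; field_simp
    intro n
    match n with
    | 0 => simp [h0]
    | 1 => simp [Finset.sum_range_succ, h0]
    | 2 =>
      simp [Finset.sum_range_succ, h0, h1]
      linear_combination 2 * s ^ 2 * hσ2 + 2 * hs2
    | p + 3 => exact (core h0 σ hσ h1 p).mpr (hall (p + 2) (by omega))

theorem aux_deriv_mul_sq (K : ℝ → ℝ) (hK : AnalyticAt ℝ K 0) (n : ℕ) :
    iteratedDeriv n (fun t : ℝ => t ^ 2 * K t) 0 = (n : ℝ) * ((n : ℝ) - 1) * iteratedDeriv (n - 2) K 0 := by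
  rw [iteratedDeriv_fun_mul (by fun_prop) hK.contDiffAt]
  rw [Finset.sum_eq_single 2]
  · simp [Nat.cast_choose_two, Nat.descFactorial]
  · intro b _ hb
    rw [iteratedDeriv_pow]
    rcases Nat.lt_or_gt_of_ne hb with h | h
    · have : 2 - b ≠ 0 := by omega
      simp [this]
    · simp [Nat.descFactorial_of_lt h]
  · intro h
    have : n < 2 := by simpa using h
    simp [Nat.choose_eq_zero_of_lt this]

theorem aux_zero (G : ℝ → ℝ) (ε : ℝ) (hε : 0 < ε) (hG : AnalyticOnNhd ℝ G (Ioo (-ε) ε)) :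
    (∀ t : ℝ, |t| < ε → G t = 0) ↔ ∀ n, iteratedDeriv n G 0 = 0 := by
  have h0 : (0 : ℝ) ∈ Ioo (-ε) ε := ⟨by linarith, hε⟩
  constructor
  · intro h n
    have : G =ᶠ[𝓝 0] fun _ => (0 : ℝ) := by
      filter_upwards [isOpen_Ioo.mem_nhds h0] with t ht
      exact h t (abs_lt.mpr ht)
    rw [this.iteratedDeriv_eq n]
    simp [iteratedDeriv_const]
  · intro h t ht
    have hs := (hG 0 h0).hasFPowerSeriesAt
    have hz : FormalMultilinearSeries.ofScalars ℝ (fun n ↦ iteratedDeriv n G 0 / n.factorial) = 0 := by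
      ext n
      simp [h]
    rw [hz] at hs
    exact hG.eqOn_zero_of_preconnected_of_eventuallyEq_zero isPreconnected_Ioo h0
      hs.eventually_eq_zero (abs_lt.mp ht)

/-- Recursion for the Taylor coefficients of `H` from `4H² = -t²K`. -/
theorem stmt_4 (ε : ℝ) (hε : 0 < ε) (H K : ℝ → ℝ)
    (hH : AnalyticOnNhd ℝ H (Ioo (-ε) ε)) (hK : AnalyticOnNhd ℝ K (Ioo (-ε) ε))
    (hK0 : K 0 < 0) :
    (∀ t : ℝ, |t| < ε → 4 * H t ^ 2 = -t ^ 2 * K t) ↔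
    (H 0 = 0 ∧ ∃ σ : ℝ, (σ = 1 ∨ σ = -1) ∧ ∀ m : ℕ, 1 ≤ m →
      iteratedDeriv m H 0 =
        σ * ((-(m : ℝ) * iteratedDeriv (m - 1) K 0
            - 4 / ((m : ℝ) + 1) * ∑ r ∈ Finset.Icc 2 (m - 1), ((m + 1).choose r : ℝ) *
                iteratedDeriv r H 0 * iteratedDeriv (m - r + 1) H 0)
          / ((2 : ℝ) ^ (2 - (if m = 1 then 1 else 0) : ℕ) * Real.sqrt (-K 0)))) := by
  have h0 : (0 : ℝ) ∈ Ioo (-ε) ε := ⟨by linarith, hε⟩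
  have A := aux_alg (fun i => iteratedDeriv i H 0) (fun i => iteratedDeriv i K 0)
    (by simpa using hK0)
  simp only [iteratedDeriv_zero] at A
  rw [← A]
  have hG : AnalyticOnNhd ℝ (fun t => 4 * (H t * H t) + t ^ 2 * K t) (Ioo (-ε) ε) := by
    intro x hx
    have a := hH x hx
    have b := hK x hx
    fun_prop
  have B := aux_zero _ ε hε hG
  have hHa := hH 0 h0
  have hKa := hK 0 h0
  have C : ∀ n, iteratedDeriv n (fun t => 4 * (H t * H t) + t ^ 2 * K t) 0 =
      4 * ∑ i ∈ Finset.range (n + 1), (n.choose i : ℝ) * iteratedDeriv i H 0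
        * iteratedDeriv (n - i) H 0
        + (n : ℝ) * ((n : ℝ) - 1) * iteratedDeriv (n - 2) K 0 := by
    intro n
    have a1 : AnalyticAt ℝ (fun t => 4 * (H t * H t)) 0 := by fun_prop
    have a2 : AnalyticAt ℝ (fun t => t ^ 2 * K t) 0 := by fun_prop
    rw [iteratedDeriv_fun_add a1.contDiffAt a2.contDiffAt, aux_deriv_mul_sq K hKa n,
      iteratedDeriv_const_mul_field, iteratedDeriv_fun_mul hHa.contDiffAt hHa.contDiffAt]
  simp only [C] at B
  rw [← B]
  refine forall_congr' fun t => imp_congr_right fun _ => ?_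
  constructor <;> intro h <;> linarith

end
end

section
/- Let M, N > 0 and define a sequence of real numbers recursively by a⁽⁰⁾ = M and, for m ≥ 1, a⁽ᵐ⁾ = N·m·Σ_{r=0}^{m−1} C(m−1, r)·a⁽ʳ⁾·a⁽ᵐ⁻ʳ⁻¹⁾ + (N/(m+1))·Σ_{r=2}^{m−1} C(m+1, r)·a⁽ʳ⁾·a⁽ᵐ⁻ʳ⁺¹⁾. Then the power series Σ_{m≥0} a⁽ᵐ⁾·tᵐ/m! has positive radius of convergence, and in a neighborhood of t = 0 its sum equals a(t) = [ M + t·(M²N + 1/(2N)) − t·√( 1/(4N²) − t·(2M³N + M/N) − t²·M⁴N² ) ] / (t² + 1). -/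
open Set Filter
open scoped BigOperators Topology

noncomputable section

open PowerSeries in
/-- `g` represents `f` near zero. -/
def RepPS (g : PowerSeries ℝ) (f : ℝ → ℝ) : Prop :=
  ∀ᶠ z in 𝓝 (0 : ℝ), HasSum (fun n => PowerSeries.coeff n g * z ^ n) (f z)

theorem RepPS.add {g h : PowerSeries ℝ} {f k : ℝ → ℝ} (h1 : RepPS g f) (h2 : RepPS h k) :
    RepPS (g + h) (fun z => f z + k z) := by
  filter_upwards [h1, h2] with z a b
  simpa [add_mul] using a.add b

theorem RepPS.sub {g h : PowerSeries ℝ} {f k : ℝ → ℝ} (h1 : RepPS g f) (h2 : RepPS h k) :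
    RepPS (g - h) (fun z => f z - k z) := by
  filter_upwards [h1, h2] with z a b
  simpa [sub_mul] using a.sub b

theorem RepPS.mul {g h : PowerSeries ℝ} {f k : ℝ → ℝ} (h1 : RepPS g f) (h2 : RepPS h k) :
    RepPS (g * h) (fun z => f z * k z) := by
  filter_upwards [h1, h2] with z a b
  have ha := a.summable.norm
  have hb := b.summable.norm
  have hs := (summable_norm_sum_mul_antidiagonal_of_summable_norm ha hb).of_norm
  have ht := tsum_mul_tsum_eq_tsum_sum_antidiagonal_of_summable_norm ha hb
  rw [a.tsum_eq, b.tsum_eq] at ht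
  have := hs.hasSum
  rw [← ht] at this
  suffices hfun : (fun n => PowerSeries.coeff n (g * h) * z ^ n) = fun n =>
      ∑ kl ∈ Finset.HasAntidiagonal.antidiagonal n,
        (PowerSeries.coeff kl.1) g * z ^ kl.1 * ((PowerSeries.coeff kl.2) h * z ^ kl.2) by
    rw [hfun]
    exact this
  funext n
  rw [PowerSeries.coeff_mul, Finset.sum_mul]
  refine Finset.sum_congr rfl fun p hp => ?_
  rw [← Finset.HasAntidiagonal.mem_antidiagonal.1 hp, pow_add]
  ring

theorem RepPS.C (c : ℝ) : RepPS (PowerSeries.C c) (fun _ => c) := by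
  refine Eventually.of_forall fun z => ?_
  convert hasSum_single (f := fun n => PowerSeries.coeff n (PowerSeries.C c) * z ^ n) 0 ?_ using 1
  · simp
  · intro n hn
    simp [PowerSeries.coeff_C, hn]

theorem RepPS.X : RepPS PowerSeries.X (fun z => z) := by
  refine Eventually.of_forall fun z => ?_
  convert hasSum_single (f := fun n => PowerSeries.coeff n (PowerSeries.X : PowerSeries ℝ) * z ^ n)
    1 ?_ using 1
  · simp
  · intro n hn
    simp [PowerSeries.coeff_X, hn]

theorem RepPS.eq_zero {g : PowerSeries ℝ} {f : ℝ → ℝ} (h : RepPS g f)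
    (hf : ∀ᶠ z in 𝓝 (0 : ℝ), f z = 0) : g = 0 := by
  have : HasFPowerSeriesAt (0 : ℝ → ℝ)
      (FormalMultilinearSeries.ofScalars ℝ (fun n => PowerSeries.coeff n g)) 0 := by
    rw [hasFPowerSeriesAt_iff]
    filter_upwards [h, hf] with z a b
    rw [b] at a
    simpa [mul_comm, FormalMultilinearSeries.coeff_ofScalars] using a
  have h0 := this.eq_zero
  ext n
  have := congrArg (fun p => FormalMultilinearSeries.coeff p n) h0
  simp only [FormalMultilinearSeries.coeff_ofScalars] at this
  rw [this]
  rfl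

theorem RepPS.of_analytic {f : ℝ → ℝ} (h : AnalyticAt ℝ f 0) : ∃ g, RepPS g f := by
  obtain ⟨p, hp⟩ := h
  refine ⟨PowerSeries.mk fun n => p.coeff n, ?_⟩
  rw [hasFPowerSeriesAt_iff] at hp
  filter_upwards [hp] with z a
  simpa [mul_comm] using a

theorem RepPS.coeff_zero {g : PowerSeries ℝ} {f : ℝ → ℝ} (h : RepPS g f) :
    PowerSeries.coeff 0 g = f 0 := by
  have h0 : HasSum (fun n => PowerSeries.coeff n g * (0:ℝ) ^ n) (f 0) := h.self_of_nhds
  have h1 := hasSum_single (f := fun n => PowerSeries.coeff n g * (0:ℝ) ^ n) 0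
    (by intro n hn; simp [hn])
  simpa using h1.unique h0

theorem formal_eq (M N : ℝ) (b : ℕ → ℝ) (h0 : b 0 = M) (h1 : b 1 = N * M ^ 2)
    (hb : ∀ k, b (k + 1) = N * ∑ r ∈ Finset.range (k + 1), b r * b (k - r)
      + N * ∑ r ∈ Finset.Icc 2 k, b r * b (k + 2 - r)) :
    PowerSeries.X * (PowerSeries.mk b - PowerSeries.C M)
      = PowerSeries.C N * (PowerSeries.X * (PowerSeries.X * (PowerSeries.mk b * PowerSeries.mk b)))
      + PowerSeries.C N * (PowerSeries.mk b - PowerSeries.C M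
          - PowerSeries.C N * PowerSeries.C M ^ 2 * PowerSeries.X) ^ 2 := by
  have hd : PowerSeries.mk b - PowerSeries.C M
          - PowerSeries.C N * PowerSeries.C M ^ 2 * PowerSeries.X
      = PowerSeries.mk (fun n => if n < 2 then 0 else b n) := by
    ext n
    rw [← map_pow, ← map_mul, map_sub, map_sub, PowerSeries.coeff_C_mul, PowerSeries.coeff_mk,
      PowerSeries.coeff_mk, PowerSeries.coeff_C, PowerSeries.coeff_X]
    rcases n with _ | _ | n
    · simp [h0]
    · simp [h1]
    · simp
  rw [hd, sq]
  ext n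
  rcases n with _ | _ | k
  · simp
  · simp [PowerSeries.coeff_mul,
      Finset.Nat.sum_antidiagonal_eq_sum_range_succ_mk, Finset.sum_range_succ, h0]
  · rw [map_add, PowerSeries.coeff_C_mul, PowerSeries.coeff_C_mul, PowerSeries.coeff_succ_X_mul,
      PowerSeries.coeff_succ_X_mul, PowerSeries.coeff_succ_X_mul, PowerSeries.coeff_mul,
      PowerSeries.coeff_mul, Finset.Nat.sum_antidiagonal_eq_sum_range_succ_mk,
      Finset.Nat.sum_antidiagonal_eq_sum_range_succ_mk]
    simp only [PowerSeries.coeff_mk, map_sub, PowerSeries.coeff_C]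
    have : k + 1 ≠ 0 := by omega
    simp only [this, if_false, sub_zero, hb k]
    congr 2
    refine (Finset.sum_subset_zero_on_sdiff ?_ ?_ ?_)
    · intro r hr
      simp at hr ⊢
      omega
    · intro r hr
      simp only [Finset.mem_sdiff, Finset.mem_range, Finset.mem_Icc] at hr
      by_cases hr2 : r < 2
      · simp [hr2]
      · rw [if_pos (show k + 1 + 1 - r < 2 by omega), mul_zero]
    · intro r hr
      simp only [Finset.mem_Icc] at hr
      rw [if_neg (by omega), if_neg (by omega)]

/-- The majorant sequence has a convergent exponential generating
series with an explicit closed-form sum. -/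
theorem stmt_8 (M N : ℝ) (hM : 0 < M) (hN : 0 < N) (a : ℕ → ℝ) (ha0 : a 0 = M)
    (ha : ∀ m : ℕ, 1 ≤ m → a m =
      N * (m : ℝ) * ∑ r ∈ Finset.range m, ((m - 1).choose r : ℝ) * a r * a (m - r - 1)
      + N / ((m : ℝ) + 1) * ∑ r ∈ Finset.Icc 2 (m - 1), ((m + 1).choose r : ℝ) *
          a r * a (m - r + 1)) :
    ∃ ρ > (0 : ℝ), ∀ t : ℝ, |t| < ρ →
      Summable (fun m : ℕ => a m * t ^ m / (m.factorial : ℝ)) ∧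
      ∑' m : ℕ, a m * t ^ m / (m.factorial : ℝ) =
        (M + t * (M ^ 2 * N + 1 / (2 * N))
          - t * Real.sqrt (1 / (4 * N ^ 2) - t * (2 * M ^ 3 * N + M / N)
              - t ^ 2 * M ^ 4 * N ^ 2))
        / (t ^ 2 + 1) := by
  set b : ℕ → ℝ := fun m => a m / (m.factorial : ℝ) with hbdef
  have hab : ∀ m, a m = b m * (m.factorial : ℝ) := fun m => by
    have : (m.factorial : ℝ) ≠ 0 := by positivity
    simp only [hbdef]; field_simp
  have hb0 : b 0 = M := by simp [hbdef, ha0]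
  have hb : ∀ k, b (k + 1) = N * ∑ r ∈ Finset.range (k + 1), b r * b (k - r)
      + N * ∑ r ∈ Finset.Icc 2 k, b r * b (k + 2 - r) := by
    intro k
    have h := ha (k + 1) (by omega)
    have e1 : ∑ r ∈ Finset.range (k + 1), ((k + 1 - 1).choose r : ℝ) * a r * a (k + 1 - r - 1)
        = (k.factorial : ℝ) * ∑ r ∈ Finset.range (k + 1), b r * b (k - r) := by
      rw [Finset.mul_sum]
      refine Finset.sum_congr rfl fun r hr => ?_
      have hr' : r ≤ k := by simp at hr; omega
      rw [show k + 1 - 1 = k by omega, show k + 1 - r - 1 = k - r by omega, hab r, hab (k - r),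
        ← Nat.choose_mul_factorial_mul_factorial hr']
      push_cast
      ring
    have e2 : ∑ r ∈ Finset.Icc 2 (k + 1 - 1), ((k + 1 + 1).choose r : ℝ) * a r * a (k + 1 - r + 1)
        = ((k + 2).factorial : ℝ) * ∑ r ∈ Finset.Icc 2 k, b r * b (k + 2 - r) := by
      rw [Finset.mul_sum, show k + 1 - 1 = k by omega]
      refine Finset.sum_congr rfl fun r hr => ?_
      have hr' : r ≤ k := (Finset.mem_Icc.1 hr).2
      rw [show k + 1 - r + 1 = k + 2 - r by omega, hab r, hab (k + 2 - r),
        ← Nat.choose_mul_factorial_mul_factorial (show r ≤ k + 2 by omega)]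
      push_cast
      ring
    rw [e1, e2, hab, Nat.factorial_succ (k + 1), Nat.factorial_succ k] at h
    have hk : (k.factorial : ℝ) ≠ 0 := by positivity
    have hk1 : (k : ℝ) + 1 ≠ 0 := by positivity
    have hk2 : (k : ℝ) + 1 + 1 ≠ 0 := by positivity
    push_cast at h
    have h2 : ((k : ℝ) + 1) * k.factorial ≠ 0 := mul_ne_zero hk1 hk
    apply mul_right_cancel₀ h2
    rw [h]
    field_simp
  have hb1 : b 1 = N * M ^ 2 := by
    have := hb 0
    simp [hb0] at this
    rw [this]; ring
  have hE := formal_eq M N b hb0 hb1 hb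
  set B := PowerSeries.mk b with hB
  -- the discriminant
  set D : ℝ → ℝ := fun t => 1 / (4 * N ^ 2) - t * (2 * M ^ 3 * N + M / N)
              - t ^ 2 * M ^ 4 * N ^ 2 with hD
  have hD0 : 0 < D 0 := by simp only [hD]; simp; positivity
  have hDan : AnalyticAt ℝ D 0 := by simp only [hD]; fun_prop
  have hSan : AnalyticAt ℝ (fun t => Real.sqrt (D t)) 0 := by
    have h := (Real.contDiffAt_sqrt (n := ⊤) hD0.ne').analyticAt
    exact AnalyticAt.comp h hDan
  obtain ⟨S, hS⟩ := RepPS.of_analytic hSan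
  have hFan : AnalyticAt ℝ (fun t => (M + t * (M ^ 2 * N + 1 / (2 * N))
          - t * Real.sqrt (D t)) / (t ^ 2 + 1)) 0 := by
    apply AnalyticAt.div
    · exact AnalyticAt.sub (by fun_prop) (analyticAt_id.mul hSan)
    · fun_prop
    · simp
  obtain ⟨G, hG⟩ := RepPS.of_analytic hFan
  set n := PowerSeries.C N
  set m := PowerSeries.C M
  set j := PowerSeries.C (1 / (2 * N))
  have hnj : 2 * n * j = 1 := by
    have : (2 : PowerSeries ℝ) = PowerSeries.C 2 := (map_ofNat PowerSeries.C 2).symm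
    rw [this, ← map_mul, ← map_mul, ← map_one PowerSeries.C]
    congr 1
    field_simp
  have hX := RepPS.X
  have c := RepPS.C
  have hGS : (PowerSeries.X * PowerSeries.X + PowerSeries.C 1) * G
      - (m + PowerSeries.X * (m * m * n + j) - PowerSeries.X * S) = 0 := by
    refine RepPS.eq_zero ((((hX.mul hX).add (c 1)).mul hG).sub
      (((c M).add (hX.mul ((((c M).mul (c M)).mul (c N)).add (c (1 / (2 * N)))))).sub
        (hX.mul hS))) ?_
    refine Eventually.of_forall fun z => ?_
    have : z ^ 2 + 1 ≠ 0 := by positivity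
    field_simp
    ring
  have hSS : S * S - (j * j - PowerSeries.X * (2 * m * m * m * n + 2 * m * j)
      - PowerSeries.X * PowerSeries.X * (m * m * m * m * n * n)) = 0 := by
    have e2 : (2 : PowerSeries ℝ) = PowerSeries.C 2 := (map_ofNat PowerSeries.C 2).symm
    rw [e2]
    refine RepPS.eq_zero ((hS.mul hS).sub ((((c _).mul (c _)).sub (hX.mul
      (((((c 2).mul (c M)).mul (c M)).mul (c M)).mul (c N) |>.add (((c 2).mul (c M)).mul (c _)))))
      |>.sub ((hX.mul hX).mul
        (((((c M).mul (c M)).mul (c M)).mul (c M)).mul (c N) |>.mul (c N))))) ?_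
    have hpos : ∀ᶠ z in 𝓝 (0:ℝ), 0 < D z := hDan.continuousAt.eventually (lt_mem_nhds hD0)
    filter_upwards [hpos] with z hz
    rw [Real.mul_self_sqrt hz.le]
    simp only [hD]
    field_simp
    ring
  have hS0 : PowerSeries.coeff 0 S = 1 / (2 * N) := by
    rw [hS.coeff_zero]
    simp only [hD]
    rw [show 1 / (4 * N ^ 2) - 0 * (2 * M ^ 3 * N + M / N) - 0 ^ 2 * M ^ 4 * N ^ 2
      = (1 / (2 * N)) ^ 2 by field_simp; ring]
    exact Real.sqrt_sq (by positivity)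
  have h1C : (PowerSeries.C (1:ℝ)) = 1 := map_one _
  rw [h1C] at hGS
  set X : PowerSeries ℝ := PowerSeries.X with hXdef
  have hprod : ((m + X * (m * m * n + j) - (X * X + 1) * B) - X * S)
      * ((m + X * (m * m * n + j) - (X * X + 1) * B) + X * S) = 0 := by
    linear_combination (-(X * X + 1) * 2 * j) * hE - X * X * hSS
      + (m * m * X * X - (X * X + 1) * (X * X * B * B + (B - m - n * m ^ 2 * X) ^ 2)) * hnj
  have hBG : B = G := by
    rcases mul_eq_zero.1 hprod with h | h
    · have hne : X * X + 1 ≠ 0 := by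
        intro h
        have := congrArg (PowerSeries.coeff 0) h
        simp [hXdef] at this
      apply mul_left_cancel₀ hne
      linear_combination -h - hGS
    · exfalso
      have h3 : m + (X * (m * m * n + j) - X * (X * B) - B + X * S) = 0 := by
        linear_combination h
      have := congrArg (PowerSeries.coeff 1) h3
      have hx : ∀ p : PowerSeries ℝ, PowerSeries.coeff 1 (X * p) = PowerSeries.coeff 0 p :=
        PowerSeries.coeff_succ_X_mul 0
      have hx0 : PowerSeries.coeff 0 (X * B) = 0 := by simp [hXdef]
      have hm1 : PowerSeries.coeff 1 m = 0 := by simp [m, PowerSeries.coeff_C]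
      have hm2 : PowerSeries.coeff 0 (m * m * n + j) = M * M * N + 1 / (2 * N) := by
        simp [m, n, j]
      have hB1 : PowerSeries.coeff 1 B = N * M ^ 2 := by rw [hB, PowerSeries.coeff_mk, hb1]
      rw [map_add, map_add, map_sub, map_sub, hx, hx, hx, hx0, hm1, hm2, hB1, hS0, map_zero] at this
      have hp : 0 < 1 / (2 * N) := by positivity
      linarith
  rw [← hBG] at hG
  obtain ⟨ρ, hρ, hh⟩ := Metric.eventually_nhds_iff.1 hG
  refine ⟨ρ, hρ, fun t ht => ?_⟩
  have hs := hh (y := t) (by simpa using ht)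
  have he : (fun n => PowerSeries.coeff n B * t ^ n)
      = fun m : ℕ => a m * t ^ m / (m.factorial : ℝ) := by
    ext k
    simp only [hB, PowerSeries.coeff_mk, hbdef]
    ring
  rw [he] at hs
  exact ⟨hs.summable, hs.tsum_eq⟩

end
end

section
/- Let Ω ⊂ ℝ² be a Jordan domain with analytic boundary, let f⁽⁰⁾ be a harmonic function in Ω that extends to a real analytic function in Ω̄ and whose Hessian matrix is nonzero at every point of Ω̄, let K⁽⁰⁾ = f⁽⁰⁾_xx·f⁽⁰⁾_yy − (f⁽⁰⁾_xy)², and let f⁽ᵐ⁾ (m ≥ 1) be the unique C^∞ functions vanishing on ∂Ω and satisfying the recursive Poisson equations f⁽ᵐ⁾_xx + f⁽ᵐ⁾_yy = [ m·Σ_{r=0}^{m−1} C(m−1, r)·( f⁽ʳ⁾_xy·f⁽ᵐ⁻ʳ⁻¹⁾_xy − f⁽ʳ⁾_xx·f⁽ᵐ⁻ʳ⁻¹⁾_yy ) − (1/(m+1))·Σ_{r=2}^{m−1} C(m+1, r)·( f⁽ʳ⁾_xx + f⁽ʳ⁾_yy )·( f⁽ᵐ⁻ʳ⁺¹⁾_xx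 + f⁽ᵐ⁻ʳ⁺¹⁾_yy ) ] / ( 2^{1−δ_{m1}}·√(−K⁽⁰⁾) ). Let C(Ω) > 0 be any constant such that ‖f⁽ᵐ⁾‖ ≤ C(Ω)·‖1/√(−K⁽⁰⁾)‖·( m·Σ_{r=0}^{m−1} C(m−1,r)·‖f⁽ʳ⁾‖·‖f⁽ᵐ⁻ʳ⁻¹⁾‖ + (1/(m+1))·Σ_{r=2}^{m−1} C(m+1,r)·‖f⁽ʳ⁾‖·‖f⁽ᵐ⁻ʳ⁺¹⁾‖ ) for all m ≥ 1, and let a⁽ᵐ⁾(M, N) be defined by a⁽⁰⁾ = M and a⁽ᵐ⁾ = N·m·Σ_{r=0}^{m−1} C(m−1,r)·a⁽ʳ⁾·a⁽ᵐ⁻ʳ⁻¹⁾ + (N/(m+1))·Σ_{r=2}^{m−1} C(m+1,r)·a⁽ʳ⁾·a⁽ᵐ⁻ʳ⁺¹⁾. Then ‖f⁽ᵐ⁾‖ ≤ a⁽ᵐ⁾( ‖f⁽⁰⁾‖, C(Ω)·‖1/√(−K⁽⁰⁾)‖ ) for every m ≥ 0; consequently, there exists ε > 0 such that the series Σ_{m≥0}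 f⁽ᵐ⁾·tᵐ/m! converges in the C^{2+1/2} norm for all |t| < ε and its sum satisfies the isotropic CRPC equation f_xx + f_yy = t·√(f_xy² − f_xx·f_yy) on Ω. -/
open Set Filter
open scoped BigOperators Topology

noncomputable section

/-- `f` solves the recursive system of Poisson equations: for each `m ≥ 1`, `f m` is a
`C^∞` function on `Ω̄` vanishing on `∂Ω` with `Δ (f m) = poissonRHS f m` on `Ω`. -/
def IsPoissonSeq (Ω : Set (ℝ × ℝ)) (f : ℕ → ℝ × ℝ → ℝ) : Prop :=
  ∀ m : ℕ, 1 ≤ m → IsCInftyClosed (f m) Ω ∧ (∀ p ∈ frontier Ω, f m p = 0) ∧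
    (∀ p ∈ Ω, fxx (f m) p + fyy (f m) p = poissonRHS f m p)


lemma conv_le_sq (c : ℕ → ℝ) (hc : ∀ i, 0 ≤ c i) (n : ℕ) :
    ∑ m ∈ Finset.range n, ∑ r ∈ Finset.range (m+1), c r * c (m - r)
      ≤ (∑ i ∈ Finset.range n, c i) ^ 2 := by
  rw [Finset.sum_range_diag_flip n (fun i j => c i * c j), sq, Finset.sum_mul_sum]
  refine Finset.sum_le_sum fun i hi => ?_
  refine Finset.sum_le_sum_of_subset_of_nonneg ?_ fun j _ _ => mul_nonneg (hc _) (hc _)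
  intro j hj
  simp only [Finset.mem_range] at *
  omega

lemma majorant_geom (N : ℝ) (hN : 0 ≤ N) (b : ℕ → ℝ) (hb : ∀ m, 0 ≤ b m)
    (hrec : ∀ m, 1 ≤ m → b m = N * (∑ r ∈ Finset.range m, b r * b (m - 1 - r)
      + ∑ r ∈ Finset.Icc 2 (m - 1), b r * b (m + 1 - r))) :
    ∃ K ρ : ℝ, 0 < K ∧ 0 < ρ ∧ ∀ m, b m ≤ K * ρ ^ m := by
  set σ : ℝ := 1 / (2 * N + 1) with hσ
  have hσ0 : 0 < σ := by positivity
  have hσN : N * σ ^ 2 ≤ σ / 2 := by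
    have : N * σ ≤ 1 / 2 := by
      rw [hσ, mul_one_div, div_le_div_iff₀ (by positivity) (by norm_num)]; linarith
    nlinarith
  have hτ : ∃ τ : ℝ, 0 < τ ∧ N * ((b 0 + b 1 * τ + τ * σ) ^ 2 - (b 0) ^ 2) ≤ σ / 2 := by
    have h1 : Tendsto (fun τ : ℝ => N * ((b 0 + b 1 * τ + τ * σ) ^ 2 - (b 0) ^ 2)) (𝓝[>] 0) (𝓝 0) := by
      have : Continuous (fun τ : ℝ => N * ((b 0 + b 1 * τ + τ * σ) ^ 2 - (b 0) ^ 2)) := by fun_prop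
      have h2 := this.tendsto 0
      simp at h2
      exact h2.mono_left nhdsWithin_le_nhds
    have h2 := h1.eventually (ge_mem_nhds (by positivity : 0 < σ/2))
    obtain ⟨τ, h3, h4⟩ := (h2.and self_mem_nhdsWithin).exists
    exact ⟨τ, h4, h3⟩
  obtain ⟨τ, hτ0, hτ⟩ := hτ
  set c : ℕ → ℝ := fun m => b (m+2) * τ ^ (m+1) with hc
  set d : ℕ → ℝ := fun m => b m * τ ^ m with hd
  have hc0 : ∀ i, 0 ≤ c i := fun i => mul_nonneg (hb _) (by positivity)
  have hd0 : ∀ i, 0 ≤ d i := fun i => mul_nonneg (hb _) (by positivity)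
  have hcrec : ∀ m, c m = N * (∑ r ∈ Finset.range (m+2), d r * d (m + 1 - r)
      + ∑ i ∈ Finset.range m, c i * c (m - 1 - i)) := by
    intro m
    simp only [hc, hd]
    rw [hrec (m+2) (by omega), mul_assoc, add_mul, Finset.sum_mul, Finset.sum_mul]
    congr 2
    · refine Finset.sum_congr rfl fun r hr => ?_
      simp only [Finset.mem_range] at hr
      have : m + 1 = r + (m + 1 - r) := by omega
      rw [show m + 2 - 1 - r = m + 1 - r by omega]
      nth_rewrite 2 [this]
      rw [pow_add]; ring
    · rw [show m + 2 - 1 = m + 1 by omega]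
      rw [show Finset.Icc 2 (m+1) = Finset.Ico 2 (m+2) by ext; simp; omega]
      rw [Finset.sum_Ico_eq_sum_range]
      refine Finset.sum_congr (by simp) fun r hr => ?_
      simp only [Finset.mem_range] at hr
      rw [show m + 2 + 1 - (2 + r) = m - 1 - r + 2 by omega, add_comm 2 r]
      have : m + 1 = (r + 1) + (m - 1 - r + 1) := by omega
      nth_rewrite 1 [this]
      rw [pow_add]; ring
  have hS : ∀ n, ∑ i ∈ Finset.range n, c i ≤ σ := by
    intro n
    induction n with
    | zero => simpa using hσ0.le
    | succ n ih =>
      have hS0 : 0 ≤ ∑ i ∈ Finset.range n, c i := Finset.sum_nonneg fun i _ => hc0 i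
      have e1 : ∑ i ∈ Finset.range (n+1), c i = N * (∑ m ∈ Finset.range (n+1), ∑ r ∈ Finset.range (m+2), d r * d (m + 1 - r)
          + ∑ m ∈ Finset.range (n+1), ∑ i ∈ Finset.range m, c i * c (m - 1 - i)) := by
        rw [← Finset.sum_add_distrib, Finset.mul_sum]
        exact Finset.sum_congr rfl fun m _ => hcrec m
      have e2 : ∑ m ∈ Finset.range (n+1), ∑ i ∈ Finset.range m, c i * c (m - 1 - i) ≤ σ ^ 2 := by
        rw [Finset.sum_range_succ']
        simp only [Finset.range_zero, Finset.sum_empty, add_zero, Nat.add_sub_cancel]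
        exact (conv_le_sq c hc0 n).trans (pow_le_pow_left₀ hS0 ih 2)
      have e3 : ∑ m ∈ Finset.range (n+1), ∑ r ∈ Finset.range (m+2), d r * d (m + 1 - r)
          ≤ (b 0 + b 1 * τ + τ * σ) ^ 2 - (b 0) ^ 2 := by
        have h := conv_le_sq d hd0 (n+2)
        rw [Finset.sum_range_succ'] at h
        simp only [zero_add, Finset.sum_range_one, Nat.sub_self] at h
        have h5 : ∑ i ∈ Finset.range (n+2), d i ≤ b 0 + b 1 * τ + τ * σ := by
          rw [Finset.sum_range_succ', Finset.sum_range_succ']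
          have : ∑ k ∈ Finset.range n, d (k + 1 + 1) = τ * ∑ k ∈ Finset.range n, c k := by
            rw [Finset.mul_sum]
            refine Finset.sum_congr rfl fun k _ => ?_
            simp only [hc, hd]; ring
          rw [this]
          simp only [hd]
          have := mul_le_mul_of_nonneg_left ih hτ0.le
          simp
          linarith
        have h6 := pow_le_pow_left₀ (Finset.sum_nonneg fun i _ => hd0 i) h5 2
        have h7 : d 0 * d 0 = b 0 ^ 2 := by simp [hd, sq]
        rw [h7] at h
        simp only [add_assoc, Nat.reduceAdd] at h h6 ⊢
        linarith
      rw [e1]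
      have := mul_le_mul_of_nonneg_left (add_le_add e3 e2) hN
      nlinarith
  refine ⟨b 0 + b 1 * τ + τ * σ, 1 / τ, ?_, by positivity, ?_⟩
  · have := hb 0; have := hb 1; positivity
  · intro m
    have h0 := hb 0
    have h1 := hb 1
    have h1' : 0 ≤ b 1 * τ := by positivity
    have h2' : 0 ≤ τ * σ := by positivity
    rw [one_div, inv_pow, ← div_eq_mul_inv, le_div_iff₀ (by positivity)]
    match m with
    | 0 => simp; linarith
    | 1 => simp; linarith
    | k+2 =>
      have h := hS (k+1)
      rw [Finset.sum_range_succ] at h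
      have : 0 ≤ ∑ i ∈ Finset.range k, c i := Finset.sum_nonneg fun i _ => hc0 i
      have h2 : c k ≤ σ := by linarith
      have h3 : b (k+2) * τ ^ (k+2) = τ * c k := by simp only [hc]; ring
      rw [h3]
      have := mul_le_mul_of_nonneg_left h2 hτ0.le
      linarith

lemma a_geom (N : ℝ) (hN : 0 ≤ N) (a : ℕ → ℝ) (ha0 : ∀ m, 0 ≤ a m)
    (ha : ∀ m : ℕ, 1 ≤ m → a m = N *
        ((m : ℝ) * ∑ r ∈ Finset.range m, ((m - 1).choose r : ℝ) * a r * a (m - r - 1)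
          + 1 / ((m : ℝ) + 1) * ∑ r ∈ Finset.Icc 2 (m - 1), ((m + 1).choose r : ℝ) *
              a r * a (m - r + 1))) :
    ∃ K ρ : ℝ, 0 < K ∧ 0 < ρ ∧ ∀ m, a m / (m.factorial : ℝ) ≤ K * ρ ^ m := by
  refine majorant_geom N hN (fun m => a m / (m.factorial : ℝ)) (fun m => div_nonneg (ha0 m) (by positivity)) ?_
  intro m hm
  rw [ha m hm, mul_div_assoc, add_div]
  congr 2
  · rw [Finset.mul_sum, Finset.sum_div]
    refine Finset.sum_congr rfl fun r hr => ?_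
    simp only [Finset.mem_range] at hr
    obtain ⟨k, rfl⟩ : ∃ k, m = r + k + 1 := ⟨m - r - 1, by omega⟩
    rw [show r + k + 1 - 1 = r + k by omega, show r + k + 1 - r - 1 = k by omega, show r + k - r = k by omega]
    rw [Nat.cast_add_choose, Nat.factorial_succ]
    push_cast
    field_simp
  · rw [Finset.mul_sum, Finset.sum_div]
    refine Finset.sum_congr rfl fun r hr => ?_
    simp only [Finset.mem_Icc] at hr
    obtain ⟨k, rfl⟩ : ∃ k, m = r + k := ⟨m - r, by omega⟩
    rw [show r + k - r + 1 = k + 1 by omega, show r + k + 1 - r = k + 1 by omega, add_assoc,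
      Nat.cast_add_choose,
      ← add_assoc, Nat.factorial_succ (r+k)]
    push_cast
    field_simp


lemma hasDerivAt_x {u : ℝ × ℝ → ℝ} {p : ℝ × ℝ} (h : DifferentiableAt ℝ u p) :
    HasDerivAt (fun s : ℝ => u (s, p.2)) (fderiv ℝ u p (1, 0)) p.1 := by
  have h1 : HasDerivAt (fun s : ℝ => (s, p.2)) ((1 : ℝ), (0 : ℝ)) p.1 :=
    (hasDerivAt_id p.1).prodMk (hasDerivAt_const _ _)
  exact HasFDerivAt.comp_hasDerivAt (f := fun s : ℝ => (s, p.2)) p.1 (l := u) h.hasFDerivAt h1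

lemma hasDerivAt_y {u : ℝ × ℝ → ℝ} {p : ℝ × ℝ} (h : DifferentiableAt ℝ u p) :
    HasDerivAt (fun s : ℝ => u (p.1, s)) (fderiv ℝ u p (0, 1)) p.2 := by
  have h1 : HasDerivAt (fun s : ℝ => (p.1, s)) ((0 : ℝ), (1 : ℝ)) p.2 :=
    (hasDerivAt_const _ _).prodMk (hasDerivAt_id p.2)
  exact HasFDerivAt.comp_hasDerivAt (f := fun s : ℝ => (p.1, s)) p.2 (l := u) h.hasFDerivAt h1

lemma pdx_eq {u : ℝ × ℝ → ℝ} {p : ℝ × ℝ} (h : DifferentiableAt ℝ u p) :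
    pdx u p = fderiv ℝ u p (1, 0) := (hasDerivAt_x h).deriv

lemma pdy_eq {u : ℝ × ℝ → ℝ} {p : ℝ × ℝ} (h : DifferentiableAt ℝ u p) :
    pdy u p = fderiv ℝ u p (0, 1) := (hasDerivAt_y h).deriv

lemma hasDerivAt_pdx {u : ℝ × ℝ → ℝ} {p : ℝ × ℝ} (h : DifferentiableAt ℝ u p) :
    HasDerivAt (fun s : ℝ => u (s, p.2)) (pdx u p) p.1 := by
  rw [pdx_eq h]; exact hasDerivAt_x h

lemma hasDerivAt_pdy {u : ℝ × ℝ → ℝ} {p : ℝ × ℝ} (h : DifferentiableAt ℝ u p) :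
    HasDerivAt (fun s : ℝ => u (p.1, s)) (pdy u p) p.2 := by
  rw [pdy_eq h]; exact hasDerivAt_y h

lemma ev_x {Ω : Set (ℝ × ℝ)} (hΩ : IsOpen Ω) {p : ℝ × ℝ} (hp : p ∈ Ω) :
    ∀ᶠ s in 𝓝 p.1, (s, p.2) ∈ Ω := by
  have : Continuous (fun s : ℝ => (s, p.2)) := by fun_prop
  exact this.continuousAt.eventually (hΩ.mem_nhds hp)

lemma ev_y {Ω : Set (ℝ × ℝ)} (hΩ : IsOpen Ω) {p : ℝ × ℝ} (hp : p ∈ Ω) :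
    ∀ᶠ s in 𝓝 p.2, (p.1, s) ∈ Ω := by
  have : Continuous (fun s : ℝ => (p.1, s)) := by fun_prop
  exact this.continuousAt.eventually (hΩ.mem_nhds hp)

lemma pdx_congr {u v : ℝ × ℝ → ℝ} {Ω : Set (ℝ × ℝ)} (hΩ : IsOpen Ω) (h : EqOn u v Ω) :
    EqOn (pdx u) (pdx v) Ω := by
  intro p hp
  refine Filter.EventuallyEq.deriv_eq ?_
  filter_upwards [ev_x hΩ hp] with s hs using h hs

lemma pdy_congr {u v : ℝ × ℝ → ℝ} {Ω : Set (ℝ × ℝ)} (hΩ : IsOpen Ω) (h : EqOn u v Ω) :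
    EqOn (pdy u) (pdy v) Ω := by
  intro p hp
  refine Filter.EventuallyEq.deriv_eq ?_
  filter_upwards [ev_y hΩ hp] with s hs using h hs

lemma smooth_diff {u : ℝ × ℝ → ℝ} {Ω : Set (ℝ × ℝ)} (hΩ : IsOpen Ω)
    (h : ContDiffOn ℝ (⊤ : ℕ∞) u Ω) {p : ℝ × ℝ} (hp : p ∈ Ω) : DifferentiableAt ℝ u p :=
  (h.contDiffAt (hΩ.mem_nhds hp)).differentiableAt (by simp)

lemma smooth_pdx {u : ℝ × ℝ → ℝ} {Ω : Set (ℝ × ℝ)} (hΩ : IsOpen Ω)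
    (h : ContDiffOn ℝ (⊤ : ℕ∞) u Ω) : ContDiffOn ℝ (⊤ : ℕ∞) (pdx u) Ω := by
  have h1 : ContDiffOn ℝ (⊤ : ℕ∞) (fderiv ℝ u) Ω := h.fderiv_of_isOpen hΩ (by simp)
  exact (h1.clm_apply (contDiffOn_const (c := ((1:ℝ),(0:ℝ))))).congr
    fun p hp => pdx_eq (smooth_diff hΩ h hp)

lemma smooth_pdy {u : ℝ × ℝ → ℝ} {Ω : Set (ℝ × ℝ)} (hΩ : IsOpen Ω)
    (h : ContDiffOn ℝ (⊤ : ℕ∞) u Ω) : ContDiffOn ℝ (⊤ : ℕ∞) (pdy u) Ω := by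
  have h1 : ContDiffOn ℝ (⊤ : ℕ∞) (fderiv ℝ u) Ω := h.fderiv_of_isOpen hΩ (by simp)
  exact (h1.clm_apply (contDiffOn_const (c := ((0:ℝ),(1:ℝ))))).congr
    fun p hp => pdy_eq (smooth_diff hΩ h hp)

lemma analytic_pdx {u : ℝ × ℝ → ℝ} {Ω : Set (ℝ × ℝ)} (hΩ : IsOpen Ω)
    (h : AnalyticOnNhd ℝ u Ω) : AnalyticOnNhd ℝ (pdx u) Ω := by
  have h1 := h.fderiv
  have h2 : AnalyticOnNhd ℝ (fun p => fderiv ℝ u p (1, 0)) Ω := fun p hp =>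
    (ContinuousLinearMap.analyticAt (ContinuousLinearMap.apply ℝ ℝ ((1:ℝ),(0:ℝ))) _).comp (h1 p hp)
  exact h2.congr hΩ fun p hp => (pdx_eq (h p hp).differentiableAt).symm

lemma analytic_pdy {u : ℝ × ℝ → ℝ} {Ω : Set (ℝ × ℝ)} (hΩ : IsOpen Ω)
    (h : AnalyticOnNhd ℝ u Ω) : AnalyticOnNhd ℝ (pdy u) Ω := by
  have h1 := h.fderiv
  have h2 : AnalyticOnNhd ℝ (fun p => fderiv ℝ u p (0, 1)) Ω := fun p hp =>
    (ContinuousLinearMap.analyticAt (ContinuousLinearMap.apply ℝ ℝ ((0:ℝ),(1:ℝ))) _).comp (h1 p hp)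
  exact h2.congr hΩ fun p hp => (pdy_eq (h p hp).differentiableAt).symm

lemma pd_symm {u : ℝ × ℝ → ℝ} {Ω : Set (ℝ × ℝ)} (hΩ : IsOpen Ω)
    (h : ContDiffOn ℝ (⊤ : ℕ∞) u Ω) : EqOn (pdy (pdx u)) (pdx (pdy u)) Ω := by
  intro p hp
  have hs := (h.contDiffAt (hΩ.mem_nhds hp)).isSymmSndFDerivAt
    (by simp only [minSmoothness_of_isRCLikeNormedField]; exact WithTop.coe_le_coe.2 (le_top : (2 : ℕ∞) ≤ ⊤))
  have h1 : ContDiffOn ℝ (⊤ : ℕ∞) (fderiv ℝ u) Ω := h.fderiv_of_isOpen hΩ (by simp)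
  have hd : DifferentiableAt ℝ (fderiv ℝ u) p :=
    (h1.contDiffAt (hΩ.mem_nhds hp)).differentiableAt (by simp)
  have e1 : pdy (pdx u) p = pdy (fun q => fderiv ℝ u q (1, 0)) p :=
    pdy_congr hΩ (fun q hq => pdx_eq (smooth_diff hΩ h hq)) hp
  have e2 : pdx (pdy u) p = pdx (fun q => fderiv ℝ u q (0, 1)) p :=
    pdx_congr hΩ (fun q hq => pdy_eq (smooth_diff hΩ h hq)) hp
  rw [e1, e2, pdy_eq (by fun_prop), pdx_eq (by fun_prop)]
  rw [fderiv_clm_apply hd (by fun_prop), fderiv_clm_apply hd (by fun_prop)]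
  simp
  exact hs _ _

/-- smooth in `Ω` with all derivatives extending continuously to the closure -/
def Nice (u : ℝ × ℝ → ℝ) (Ω : Set (ℝ × ℝ)) : Prop :=
  ContDiffOn ℝ (⊤ : ℕ∞) u Ω ∧ ∀ i j : ℕ, ∃ G : ℝ × ℝ → ℝ, ContinuousOn G (closure Ω) ∧
    EqOn (pdx^[i] (pdy^[j] u)) G Ω

lemma nice_of_closed {u : ℝ × ℝ → ℝ} {Ω : Set (ℝ × ℝ)} (h : IsCInftyClosed u Ω) : Nice u Ω :=
  ⟨h.1, fun i j => ⟨_, h.2 i j, fun _ _ => rfl⟩⟩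

lemma iter_congr {u v : ℝ × ℝ → ℝ} {Ω : Set (ℝ × ℝ)} (hΩ : IsOpen Ω) (h : EqOn u v Ω) (i j : ℕ) :
    EqOn (pdx^[i] (pdy^[j] u)) (pdx^[i] (pdy^[j] v)) Ω := by
  have h1 : EqOn (pdy^[j] u) (pdy^[j] v) Ω := by
    induction j with
    | zero => simpa using h
    | succ j ih => simpa only [Function.iterate_succ', Function.comp] using pdy_congr hΩ ih
  induction i with
  | zero => simpa using h1
  | succ i ih => simpa only [Function.iterate_succ', Function.comp] using pdx_congr hΩ ih

lemma iter_analytic {u : ℝ × ℝ → ℝ} {Ω : Set (ℝ × ℝ)} (hΩ : IsOpen Ω) (h : AnalyticOnNhd ℝ u Ω) (i j : ℕ) :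
    AnalyticOnNhd ℝ (pdx^[i] (pdy^[j] u)) Ω := by
  have h1 : AnalyticOnNhd ℝ (pdy^[j] u) Ω := by
    induction j with
    | zero => simpa using h
    | succ j ih => simpa only [Function.iterate_succ', Function.comp] using analytic_pdy hΩ ih
  induction i with
  | zero => simpa using h1
  | succ i ih => simpa only [Function.iterate_succ', Function.comp] using analytic_pdx hΩ ih

lemma nice_of_analytic {u : ℝ × ℝ → ℝ} {Ω : Set (ℝ × ℝ)} (hΩ : IsOpen Ω)
    (h : AnalyticOnClosed u (closure Ω)) : Nice u Ω := by
  obtain ⟨U, g, hU, hsub, hg, he⟩ := h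
  have he' : EqOn u g Ω := he.mono subset_closure
  refine ⟨?_, fun i j => ⟨pdx^[i] (pdy^[j] g), ?_, iter_congr hΩ he' i j⟩⟩
  · exact ((hg.contDiffOn_of_completeSpace (n := (⊤ : ℕ∞))).mono (subset_closure.trans hsub)).congr he'
  · exact (iter_analytic hU hg i j).continuousOn.mono hsub

lemma bdd_of_ext {u G : ℝ × ℝ → ℝ} {Ω : Set (ℝ × ℝ)} (hb : Bornology.IsBounded Ω)
    (hG : ContinuousOn G (closure Ω)) (h : EqOn u G Ω) : ∃ M, ∀ p ∈ Ω, |u p| ≤ M := by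
  obtain ⟨M, hM⟩ := hb.isCompact_closure.exists_bound_of_continuousOn hG
  exact ⟨M, fun p hp => by rw [h hp]; exact hM p (subset_closure hp)⟩


lemma precon_frontier {A Ω : Set (ℝ × ℝ)} (hA : IsPreconnected A) (h1 : (A ∩ Ω).Nonempty)
    (h2 : (A ∩ Ωᶜ).Nonempty) : (A ∩ frontier Ω).Nonempty := by
  by_contra hcon
  have hn : ∀ q ∈ A, q ∉ frontier Ω := fun q hq hf => hcon ⟨q, hq, hf⟩
  obtain ⟨a, ha, haΩ⟩ := h1
  obtain ⟨b, hb, hbΩ⟩ := h2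
  obtain ⟨c, _, hc, hc'⟩ := hA (interior Ω) (closure Ω)ᶜ isOpen_interior isClosed_closure.isOpen_compl
    (fun q hq => by
      by_contra h
      rw [mem_union, not_or, mem_compl_iff, not_not] at h
      exact hn q hq ⟨h.2, h.1⟩)
    ⟨a, ha, by
      by_contra h
      exact hn a ha ⟨subset_closure haΩ, h⟩⟩
    ⟨b, hb, fun h => hn b hb ⟨h, fun h' => hbΩ (interior_subset h')⟩⟩
  exact hc' (subset_closure (interior_subset hc))

lemma curve_local {Γ : Set (ℝ × ℝ)} (h : IsAnalyticJordanCurve Γ) {p : ℝ × ℝ} (hp : p ∈ Γ) :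
    ∃ V ∈ 𝓝 p, ∃ L : ℝ, 0 ≤ L ∧
      ((∀ q ∈ Γ ∩ V, ∀ q' ∈ Γ ∩ V, |q.2 - q'.2| ≤ L * |q.1 - q'.1|) ∨
       (∀ q ∈ Γ ∩ V, ∀ q' ∈ Γ ∩ V, |q.1 - q'.1| ≤ L * |q.2 - q'.2|)) := by
  obtain ⟨γ, T, hT, han, hper, hinj, hder, rfl⟩ := h
  obtain ⟨s₀, rfl⟩ := hp
  have hper' : Function.Periodic γ T := hper
  have hst : HasStrictDerivAt γ (deriv γ s₀) s₀ := (han s₀ (mem_univ _)).hasStrictDerivAt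
  -- localisation
  have hloc : ∀ δ > 0, ∃ V ∈ 𝓝 (γ s₀), ∀ q ∈ range γ ∩ V, ∃ s, |s - s₀| < δ ∧ γ s = q := by
    intro δ hδ
    have hK : IsCompact (γ '' (Icc (s₀ - T/2) (s₀ + T/2) \ Metric.ball s₀ δ)) := by
      refine (isCompact_Icc.diff Metric.isOpen_ball).image ?_
      exact continuousOn_univ.1 han.continuousOn
    refine ⟨_, hK.isClosed.isOpen_compl.mem_nhds ?_, ?_⟩
    · rintro ⟨s, ⟨hs, hsb⟩, he⟩
      have hm : ∀ x, γ (toIcoMod hT 0 x) = γ x := fun x => by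
        rw [toIcoMod]; exact hper'.sub_zsmul_eq _
      have h1 : toIcoMod hT 0 s = toIcoMod hT 0 s₀ := by
        apply hinj
        · simpa using toIcoMod_mem_Ico hT 0 s
        · simpa using toIcoMod_mem_Ico hT 0 s₀
        · rw [hm, hm, he]
      rw [toIcoMod, toIcoMod] at h1
      have h2 : s - s₀ = ((toIcoDiv hT 0 s - toIcoDiv hT 0 s₀ : ℤ) : ℝ) * T := by
        simp only [zsmul_eq_mul] at h1
        push_cast
        linarith
      set n : ℤ := toIcoDiv hT 0 s - toIcoDiv hT 0 s₀
      have h3 : |(n : ℝ)| * T ≤ T / 2 := by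
        rw [← abs_of_pos hT, ← abs_mul, ← h2, abs_of_pos hT, abs_le]
        constructor <;> linarith [hs.1, hs.2]
      have h4 : |(n : ℝ)| < 1 := by nlinarith
      have h5 : n = 0 := by
        rw [← Int.abs_lt_one_iff]; exact_mod_cast h4
      rw [h5] at h2
      apply hsb
      rw [Metric.mem_ball, Real.dist_eq, h2]
      simpa using hδ
    · rintro q ⟨⟨s, rfl⟩, hq⟩
      set s' := toIcoMod hT (s₀ - T/2) s with hs'
      have hm : γ s' = γ s := by rw [hs', toIcoMod]; exact hper'.sub_zsmul_eq _
      have hmem := toIcoMod_mem_Ico hT (s₀ - T/2) s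
      refine ⟨s', ?_, hm⟩
      by_contra hcon
      apply hq
      refine ⟨s', ⟨⟨hmem.1, by have := hmem.2; linarith⟩, ?_⟩, hm⟩
      rw [Metric.mem_ball, Real.dist_eq]; exact hcon
  have h1 : HasStrictDerivAt (fun s => (γ s).1) (deriv γ s₀).1 s₀ := by
    exact (ContinuousLinearMap.fst ℝ ℝ ℝ).hasStrictFDerivAt.comp_hasStrictDerivAt s₀ hst
  have h2 : HasStrictDerivAt (fun s => (γ s).2) (deriv γ s₀).2 s₀ := by
    exact (ContinuousLinearMap.snd ℝ ℝ ℝ).hasStrictFDerivAt.comp_hasStrictDerivAt s₀ hst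
  have key : ∀ (α β : ℝ → ℝ) (d e : ℝ), HasStrictDerivAt α d s₀ → HasStrictDerivAt β e s₀ → d ≠ 0 →
      ∃ δ > 0, ∀ s s', |s - s₀| < δ → |s' - s₀| < δ →
        |β s - β s'| ≤ (2 * (|e| + 1) / |d|) * |α s - α s'| := by
    intro α β d e hα hβ hd
    have hd' : 0 < |d| := abs_pos.2 hd
    have h3 := (hα.isLittleO.bound (half_pos hd')).and (hβ.isLittleO.bound one_pos)
    rw [Metric.eventually_nhds_iff] at h3
    obtain ⟨δ, hδ, h4⟩ := h3
    refine ⟨δ, hδ, fun s s' hs hs' => ?_⟩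
    have h5 := @h4 (s, s') (by simp [Prod.dist_eq, Real.dist_eq, hs, hs'])
    obtain ⟨h6, h7⟩ := h5
    simp only [ContinuousLinearMap.toSpanSingleton_apply, smul_eq_mul, Real.norm_eq_abs] at h6 h7
    have h8 : |s - s'| * |d| ≤ 2 * |α s - α s'| := by
      rw [← abs_mul]
      have := abs_sub_abs_le_abs_sub ((s - s') * d) (α s - α s')
      rw [abs_sub_comm ((s - s') * d)] at this
      rw [abs_mul] at this ⊢
      linarith
    have h9 : |β s - β s'| ≤ (|e| + 1) * |s - s'| := by
      have := abs_sub_abs_le_abs_sub (β s - β s') ((s - s') * e)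
      rw [abs_mul] at this
      linarith
    rw [div_mul_eq_mul_div, le_div_iff₀ hd']
    nlinarith [abs_nonneg e]
  by_cases hd : (deriv γ s₀).1 = 0
  · have hd2 : (deriv γ s₀).2 ≠ 0 := fun h => hder s₀ (Prod.ext hd h)
    obtain ⟨δ, hδ, hk⟩ := key _ _ _ _ h2 h1 hd2
    obtain ⟨V, hV, hV2⟩ := hloc δ hδ
    refine ⟨V, hV, 2 * (|(deriv γ s₀).1| + 1) / |(deriv γ s₀).2|, by positivity, Or.inr ?_⟩
    intro q hq q' hq'
    obtain ⟨s, hs, rfl⟩ := hV2 q hq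
    obtain ⟨s', hs', rfl⟩ := hV2 q' hq'
    exact hk s s' hs hs'
  · obtain ⟨δ, hδ, hk⟩ := key _ _ _ _ h1 h2 hd
    obtain ⟨V, hV, hV2⟩ := hloc δ hδ
    refine ⟨V, hV, 2 * (|(deriv γ s₀).2| + 1) / |(deriv γ s₀).1|, by positivity, Or.inl ?_⟩
    intro q hq q' hq'
    obtain ⟨s, hs, rfl⟩ := hV2 q hq
    obtain ⟨s', hs', rfl⟩ := hV2 q' hq'
    exact hk s s' hs hs'

/-- reflection -/
def Rf (p : ℝ × ℝ) : ℝ × ℝ := (p.1, -p.2)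

/-- near `p`, the set lies above a Lipschitz graph (and possibly below it too) -/
def GoodSide (Ω : Set (ℝ × ℝ)) (p : ℝ × ℝ) : Prop :=
  ∃ (L δ : ℝ) (φ : ℝ → ℝ), 0 ≤ L ∧ 0 < δ ∧ (∀ x y, |φ x - φ y| ≤ L * |x - y|) ∧ φ p.1 = p.2 ∧
    (∀ q : ℝ × ℝ, |q.1 - p.1| < δ → |q.2 - p.2| < (L + 1) * δ → φ q.1 < q.2 → q ∈ Ω) ∧
    ((∀ q : ℝ × ℝ, |q.1 - p.1| < δ → |q.2 - p.2| < (L + 1) * δ → q.2 < φ q.1 → q ∈ Ω) ∨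
     (∀ q : ℝ × ℝ, |q.1 - p.1| < δ → |q.2 - p.2| < (L + 1) * δ → q.2 < φ q.1 → q ∉ Ω))

lemma above_dichotomy {Ω : Set (ℝ × ℝ)} {p : ℝ × ℝ} {L δ : ℝ} {φ : ℝ → ℝ} (hL : 0 ≤ L)
    (hφ : ∀ x y, |φ x - φ y| ≤ L * |x - y|) (hp : φ p.1 = p.2)
    (hfr : ∀ q ∈ frontier Ω, |q.1 - p.1| < δ → |q.2 - p.2| < (L + 1) * δ → φ q.1 = q.2) :
    (∀ q : ℝ × ℝ, |q.1 - p.1| < δ → |q.2 - p.2| < (L + 1) * δ → φ q.1 < q.2 → q ∈ Ω) ∨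
    (∀ q : ℝ × ℝ, |q.1 - p.1| < δ → |q.2 - p.2| < (L + 1) * δ → φ q.1 < q.2 → q ∉ Ω) := by
  have hc : Continuous φ := by
    refine (LipschitzWith.of_dist_le_mul (K := ⟨L, hL⟩) fun x y => ?_).continuous
    rw [Real.dist_eq, Real.dist_eq]; exact hφ x y
  have hup : ∀ x, |x - p.1| < δ → |φ x - p.2| < (L + 1) * δ := by
    intro x hx
    have h1 := hφ x p.1
    rw [hp] at h1
    have := mul_le_mul_of_nonneg_left hx.le hL
    have := abs_nonneg (x - p.1)
    nlinarith
  set A : Set (ℝ × ℝ) := {q | |q.1 - p.1| < δ ∧ |q.2 - p.2| < (L + 1) * δ ∧ φ q.1 < q.2} with hA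
  have hconn : IsPreconnected A := by
    have : A = (fun z : ℝ × ℝ => (z.1, φ z.1 + z.2 * (p.2 + (L+1) * δ - φ z.1))) ''
        (Metric.ball p.1 δ ×ˢ Ioo (0:ℝ) 1) := by
      ext q
      simp only [hA, mem_ofPred_eq, mem_image, mem_prod, Metric.mem_ball, Real.dist_eq, mem_Ioo]
      constructor
      · rintro ⟨h1, h2, h3⟩
        have h4 := hup _ h1
        rw [abs_lt] at h2 h4
        have h5 : 0 < p.2 + (L+1) * δ - φ q.1 := by linarith
        refine ⟨(q.1, (q.2 - φ q.1) / (p.2 + (L+1) * δ - φ q.1)), ⟨h1, ?_, ?_⟩, ?_⟩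
        · exact div_pos (by linarith) h5
        · rw [div_lt_one h5]; linarith
        · ext
          · rfl
          · simp only; field_simp; ring
      · rintro ⟨z, ⟨h1, h2, h3⟩, rfl⟩
        have h4 := hup _ h1
        rw [abs_lt] at h4
        have h5 : 0 < p.2 + (L+1) * δ - φ z.1 := by linarith
        refine ⟨h1, ?_, ?_⟩
        · rw [abs_lt]; constructor <;> nlinarith
        · simp only; nlinarith
    rw [this]
    refine IsPreconnected.image ?_ _ (by fun_prop)
    refine IsPreconnected.prod ?_ isPreconnected_Ioo
    rw [Real.ball_eq_Ioo]; exact isPreconnected_Ioo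
  by_cases h1 : (A ∩ Ω).Nonempty
  · left
    intro q h2 h3 h4
    by_contra h5
    obtain ⟨z, hz, hzf⟩ := precon_frontier hconn h1 ⟨q, ⟨h2, h3, h4⟩, h5⟩
    have := hfr z hzf hz.1 hz.2.1
    exact hz.2.2.ne this
  · right
    intro q h2 h3 h4 h5
    exact h1 ⟨q, ⟨h2, h3, h4⟩, h5⟩

def RfH : (ℝ × ℝ) ≃ₜ (ℝ × ℝ) := (Homeomorph.refl ℝ).prodCongr (Homeomorph.neg ℝ)
lemma RfH_eq : (RfH : ℝ × ℝ → ℝ × ℝ) = Rf := by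
  ext p <;> simp [RfH, Rf]
lemma Rf_Rf (p : ℝ × ℝ) : Rf (Rf p) = p := by simp [Rf]

lemma goodside_of_graph {Ω : Set (ℝ × ℝ)} (hΩ : IsOpen Ω) {p : ℝ × ℝ} (hp : p ∈ frontier Ω)
    {V : Set (ℝ × ℝ)} (hV : V ∈ 𝓝 p) {L : ℝ} (hL : 0 ≤ L)
    (h : ∀ q ∈ frontier Ω ∩ V, ∀ q' ∈ frontier Ω ∩ V, |q.2 - q'.2| ≤ L * |q.1 - q'.1|) :
    GoodSide Ω p ∨ GoodSide (Rf ⁻¹' Ω) (Rf p) := by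
  have hpV : p ∈ frontier Ω ∩ V := ⟨hp, mem_of_mem_nhds hV⟩
  -- the graph function
  have hex : ∃ φ : ℝ → ℝ, (∀ x y, |φ x - φ y| ≤ L * |x - y|) ∧
      ∀ q ∈ frontier Ω ∩ V, φ q.1 = q.2 := by
    classical
    let ψ : ℝ → ℝ := fun x => if hx : ∃ q ∈ frontier Ω ∩ V, q.1 = x then hx.choose.2 else 0
    have hψ : ∀ q ∈ frontier Ω ∩ V, ψ q.1 = q.2 := by
      intro q hq
      have hx : ∃ q' ∈ frontier Ω ∩ V, q'.1 = q.1 := ⟨q, hq, rfl⟩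
      have e : ψ q.1 = hx.choose.2 := dif_pos hx
      have h1 := h _ hx.choose_spec.1 q hq
      rw [hx.choose_spec.2, sub_self, abs_zero, mul_zero] at h1
      rw [e]; exact sub_eq_zero.1 (abs_nonpos_iff.1 h1)
    have hl : LipschitzOnWith ⟨L, hL⟩ ψ (Prod.fst '' (frontier Ω ∩ V)) := by
      refine LipschitzOnWith.of_dist_le_mul ?_
      rintro _ ⟨q, hq, rfl⟩ _ ⟨q', hq', rfl⟩
      rw [hψ q hq, hψ q' hq', Real.dist_eq, Real.dist_eq]
      exact h q hq q' hq'
    obtain ⟨φ, hφ, he⟩ := hl.extend_real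
    refine ⟨φ, fun x y => ?_, fun q hq => ?_⟩
    · have := hφ.dist_le_mul x y
      rw [Real.dist_eq, Real.dist_eq] at this; exact this
    · rw [← he ⟨q, hq, rfl⟩, hψ q hq]
  obtain ⟨φ, hφ, hg⟩ := hex
  obtain ⟨r, hr, hrV⟩ := Metric.mem_nhds_iff.1 hV
  set δ := r / (L + 1) with hδ
  have hδ0 : 0 < δ := by positivity
  have hLδ : (L + 1) * δ = r := by rw [hδ]; field_simp
  have hδr : δ ≤ r := by rw [← hLδ]; nlinarith
  have hbox : ∀ q : ℝ × ℝ, |q.1 - p.1| < δ → |q.2 - p.2| < (L + 1) * δ → q ∈ V := by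
    intro q h1 h2
    apply hrV
    rw [Metric.mem_ball, Prod.dist_eq, Real.dist_eq, Real.dist_eq]
    exact max_lt (by linarith) (by linarith)
  have hfr : ∀ q ∈ frontier Ω, |q.1 - p.1| < δ → |q.2 - p.2| < (L + 1) * δ → φ q.1 = q.2 :=
    fun q hq h1 h2 => hg q ⟨hq, hbox q h1 h2⟩
  have hφp := hg p hpV
  have habove := above_dichotomy hL hφ hφp hfr
  have hbelow' := above_dichotomy (Ω := Rf ⁻¹' Ω) (p := Rf p) (δ := δ) (φ := fun x => - φ x) hL
    (by intro x y; rw [← abs_neg]; simpa [sub_eq_add_neg, add_comm] using hφ x y) (by simp [Rf, hφp])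
    (by
      intro q hq h1 h2
      rw [← RfH_eq, ← RfH.preimage_frontier, RfH_eq] at hq
      have h3 := hfr (Rf q) hq h1 (by
        rw [← abs_neg]; simpa [Rf, sub_eq_add_neg, add_comm] using h2)
      simp only [Rf] at h3
      linarith)
  have conv : ∀ q : ℝ × ℝ, |q.2 - p.2| < (L + 1) * δ → |(Rf q).2 - (Rf p).2| < (L + 1) * δ := by
    intro q hq; rw [← abs_neg]; simpa [Rf, sub_eq_add_neg, add_comm] using hq
  have conv' : ∀ q : ℝ × ℝ, |q.2 - (Rf p).2| < (L + 1) * δ → |(Rf q).2 - p.2| < (L + 1) * δ := by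
    intro q hq; rw [← abs_neg]; simpa [Rf, sub_eq_add_neg, add_comm] using hq
  have hbelow : (∀ q : ℝ × ℝ, |q.1 - p.1| < δ → |q.2 - p.2| < (L + 1) * δ → q.2 < φ q.1 → q ∈ Ω) ∨
     (∀ q : ℝ × ℝ, |q.1 - p.1| < δ → |q.2 - p.2| < (L + 1) * δ → q.2 < φ q.1 → q ∉ Ω) := by
    rcases hbelow' with h1 | h1
    · left
      intro q h2 h3 h4
      have := h1 (Rf q) h2 (conv q h3) (by simpa [Rf] using h4)
      rwa [mem_preimage, Rf_Rf] at this
    · right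
      intro q h2 h3 h4 h5
      refine h1 (Rf q) h2 (conv q h3) (by simpa [Rf] using h4) ?_
      rwa [mem_preimage, Rf_Rf]
  rcases habove with ha | ha
  · exact Or.inl ⟨L, δ, φ, hL, hδ0, hφ, hφp, ha, hbelow⟩
  · rcases hbelow' with hb' | hb'
    · refine Or.inr ⟨L, δ, fun x => - φ x, hL, hδ0, ?_, by simp [Rf, hφp], hb', Or.inr ?_⟩
      · intro x y; rw [← abs_neg]; simpa [sub_eq_add_neg, add_comm] using hφ x y
      · intro q h2 h3 h4
        exact ha (Rf q) h2 (conv' q h3) (by simp [Rf]; linarith)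
    · exfalso
      have hb : ∀ q : ℝ × ℝ, |q.1 - p.1| < δ → |q.2 - p.2| < (L + 1) * δ → q.2 < φ q.1 → q ∉ Ω := by
        intro q h2 h3 h4 h5
        refine hb' (Rf q) h2 (conv q h3) (by simpa [Rf] using h4) ?_
        rwa [mem_preimage, Rf_Rf]
      -- find a point of Ω in the box
      have ho : IsOpen (Metric.ball p.1 δ ×ˢ Metric.ball p.2 ((L + 1) * δ)) :=
        Metric.isOpen_ball.prod Metric.isOpen_ball
      have hN : Metric.ball p.1 δ ×ˢ Metric.ball p.2 ((L + 1) * δ) ∈ 𝓝 p :=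
        ho.mem_nhds ⟨Metric.mem_ball_self hδ0, Metric.mem_ball_self (by positivity)⟩
      obtain ⟨q, hq, hqΩ⟩ := mem_closure_iff_nhds.1 (frontier_subset_closure hp) _ hN
      have hev := ev_y (ho.inter hΩ) ⟨hq, hqΩ⟩
      have h6 : ∀ᶠ s in 𝓝 q.2, s = φ q.1 := by
        filter_upwards [hev] with s hs
        rcases lt_trichotomy s (φ q.1) with h | h | h
        · exact absurd hs.2 (hb _ hs.1.1 hs.1.2 h)
        · exact h
        · exact absurd hs.2 (ha _ hs.1.1 hs.1.2 h)
      have h7 : ∀ᶠ s in 𝓝[≠] q.2, s = φ q.1 := h6.filter_mono nhdsWithin_le_nhds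
      obtain ⟨s, h8, h9⟩ := (h7.and self_mem_nhdsWithin).exists
      exact h9 (h8.trans h6.self_of_nhds.symm)

lemma goodside_exists {Ω : Set (ℝ × ℝ)} (hΩ : IsAnalyticJordanDomain Ω) {p : ℝ × ℝ}
    (hp : p ∈ frontier Ω) :
    (GoodSide Ω p ∨ GoodSide (Rf ⁻¹' Ω) (Rf p)) ∨
    (GoodSide (Prod.swap ⁻¹' Ω) p.swap ∨ GoodSide (Rf ⁻¹' (Prod.swap ⁻¹' Ω)) (Rf p.swap)) := by
  obtain ⟨V, hV, L, hL, h | h⟩ := curve_local hΩ.2.2.2 hp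
  · exact Or.inl (goodside_of_graph hΩ.1 hp hV hL h)
  · right
    have e : frontier (Prod.swap ⁻¹' Ω) = Prod.swap ⁻¹' (frontier Ω) :=
      ((Homeomorph.prodComm ℝ ℝ).preimage_frontier Ω).symm
    refine goodside_of_graph (V := Prod.swap ⁻¹' V) (hΩ.1.preimage continuous_swap) ?_ ?_ hL ?_
    · rw [e]; simpa using hp
    · exact continuous_swap.continuousAt.preimage_mem_nhds (by simpa using hV)
    · rw [e]
      intro q hq q' hq'
      exact h q.swap hq q'.swap hq'


lemma seg_bound {g : ℝ → ℝ} {a b M : ℝ} (hab : a ≤ b) (hc : ContinuousOn g (Icc a b))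
    (hd : ∀ s ∈ Ioo a b, ∃ d, HasDerivAt g d s ∧ |d| ≤ M) : |g a - g b| ≤ M * (b - a) := by
  rcases hab.eq_or_lt with rfl | hlt
  · simp
  choose! g' hg' hM using hd
  obtain ⟨c, hc1, hc2⟩ := exists_hasDerivAt_eq_slope g g' hlt hc hg'
  have h1 := hM c hc1
  rw [hc2, abs_div, div_le_iff₀ (abs_pos.2 (by linarith)), abs_of_pos (by linarith : 0 < b - a)] at h1
  rwa [abs_sub_comm]

/-- bounded partial derivatives -/
def PB (G : ℝ × ℝ → ℝ) (Ω : Set (ℝ × ℝ)) (M : ℝ) : Prop :=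
  ∀ p ∈ Ω, (∃ d, HasDerivAt (fun s => G (s, p.2)) d p.1 ∧ |d| ≤ M) ∧
    (∃ d, HasDerivAt (fun s => G (p.1, s)) d p.2 ∧ |d| ≤ M)

lemma PB.horiz {G : ℝ × ℝ → ℝ} {Ω : Set (ℝ × ℝ)} {M : ℝ} (h : PB G Ω M) {a b y : ℝ}
    (hm : ∀ x ∈ uIcc a b, (x, y) ∈ Ω) : |G (a, y) - G (b, y)| ≤ M * |a - b| := by
  have key : ∀ a b : ℝ, a ≤ b → (∀ x ∈ Icc a b, (x, y) ∈ Ω) → |G (a, y) - G (b, y)| ≤ M * (b - a) := by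
    intro a b hab hm
    refine seg_bound (g := fun x => G (x, y)) hab ?_ ?_
    · intro x hx
      obtain ⟨d, hd, _⟩ := (h (x, y) (hm x hx)).1
      exact hd.continuousAt.continuousWithinAt
    · intro x hx
      exact (h (x, y) (hm x (Ioo_subset_Icc_self hx))).1
  rcases le_total a b with hab | hab
  · rw [uIcc_of_le hab] at hm
    rw [abs_sub_comm a b, abs_of_nonneg (sub_nonneg.2 hab)]
    exact key a b hab hm
  · rw [uIcc_of_ge hab] at hm
    rw [abs_sub_comm, abs_of_nonneg (sub_nonneg.2 hab)]
    exact key b a hab hm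

lemma up_bound {Ω : Set (ℝ × ℝ)} {p : ℝ × ℝ} {L δ M : ℝ} {φ : ℝ → ℝ} {G : ℝ × ℝ → ℝ}
    (hL : 0 ≤ L) (hδ : 0 < δ) (hM : 0 ≤ M)
    (hφ : ∀ x y, |φ x - φ y| ≤ L * |x - y|)
    (hA : ∀ q : ℝ × ℝ, |q.1 - p.1| < δ → |q.2 - p.2| < (L + 1) * δ → φ q.1 < q.2 → q ∈ Ω)
    (hB : (∀ q : ℝ × ℝ, |q.1 - p.1| < δ → |q.2 - p.2| < (L + 1) * δ → q.2 < φ q.1 → q ∈ Ω) ∨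
     (∀ q : ℝ × ℝ, |q.1 - p.1| < δ → |q.2 - p.2| < (L + 1) * δ → q.2 < φ q.1 → q ∉ Ω))
    (hG : ContinuousOn G (closure Ω)) (hPB : PB G Ω M)
    {u v : ℝ × ℝ} (hu : u ∈ Ω) (hv : v ∈ Ω) (hu1 : |u.1 - p.1| < δ / 4) (hu2 : |u.2 - p.2| < δ / 4)
    (hv1 : |v.1 - p.1| < δ / 4) (hv2 : |v.2 - p.2| < δ / 4) (hφv : φ v.1 ≤ v.2) :
    |G u - G v| ≤ M * (2 * L + 5) * ‖u - v‖ := by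
  rcases eq_or_ne u v with rfl | hne
  · simp
  set D := ‖u - v‖ with hD
  have hD0 : 0 < D := norm_pos_iff.2 (sub_ne_zero.2 hne)
  have hd1 : |u.1 - v.1| ≤ D := by rw [hD, ← Real.norm_eq_abs]; exact norm_fst_le (u - v)
  have hd2 : |u.2 - v.2| ≤ D := by rw [hD, ← Real.norm_eq_abs]; exact norm_snd_le (u - v)
  rw [abs_lt] at hu1 hu2 hv1 hv2
  have hD2 : D < δ / 2 := by
    rw [hD, Prod.norm_def]
    refine max_lt ?_ ?_
    · rw [Real.norm_eq_abs, abs_lt]; constructor <;> simp <;> linarith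
    · rw [Real.norm_eq_abs, abs_lt]; constructor <;> simp <;> linarith
  set H := max u.2 v.2 + L * |u.1 - v.1| + D with hH
  have hLd : 0 ≤ L * |u.1 - v.1| := by positivity
  have hLD : L * |u.1 - v.1| ≤ L * D := mul_le_mul_of_nonneg_left hd1 hL
  have hLD2 : L * D ≤ L * (δ / 2) := mul_le_mul_of_nonneg_left hD2.le hL
  have hmu : max u.2 v.2 ≤ u.2 + D := max_le (by linarith) (by linarith [(abs_le.1 hd2).1])
  have hmv : max u.2 v.2 ≤ v.2 + D := max_le (by linarith [(abs_le.1 hd2).2]) (by linarith)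
  have hmu' := le_max_left u.2 v.2
  have hmv' := le_max_right u.2 v.2
  have hφH : ∀ x ∈ uIcc u.1 v.1, φ x < H := by
    intro x hx
    have h1 := (abs_le.1 (hφ x v.1)).2
    have h2 : |x - v.1| ≤ |u.1 - v.1| := by
      have := abs_sub_left_of_mem_uIcc (uIcc_comm u.1 v.1 ▸ hx)
      exact this
    have := mul_le_mul_of_nonneg_left h2 hL
    linarith
  have hHb : H < p.2 + (L + 1) * δ := by
    have : max u.2 v.2 < p.2 + δ / 4 := max_lt (by linarith) (by linarith)
    nlinarith
  -- vertical
  have vert : ∀ w ∈ Ω, -(δ/4) < w.1 - p.1 → w.1 - p.1 < δ/4 → -(δ/4) < w.2 - p.2 → w.2 ≤ H →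
      φ w.1 < H → H - w.2 ≤ (L + 2) * D → |G w - G (w.1, H)| ≤ M * ((L + 2) * D) := by
    intro w hw h1 h1' h2 h3 h4 h5
    have box1 : |w.1 - p.1| < δ := by rw [abs_lt]; constructor <;> linarith
    have box2 : ∀ s, w.2 ≤ s → s ≤ H → |s - p.2| < (L + 1) * δ := by
      intro s hs hs'
      rw [abs_lt]; constructor
      · nlinarith
      · linarith
    have hcont : Continuous (fun s : ℝ => (w.1, s)) := by fun_prop
    have seg : ∀ a b, w.2 ≤ a → a ≤ b → b ≤ H → (∀ s ∈ Ioo a b, (w.1, s) ∈ Ω) →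
        |G (w.1, a) - G (w.1, b)| ≤ M * (b - a) := by
      intro a b ha hab hb hm
      rcases hab.eq_or_lt with rfl | hlt
      · simp
      refine seg_bound (g := fun s => G (w.1, s)) hab ?_ fun s hs => (hPB _ (hm s hs)).2
      refine hG.comp hcont.continuousOn ?_
      rw [← closure_Ioo hlt.ne]
      intro s hs
      exact map_mem_closure hcont hs hm
    have fin : |G (w.1, w.2) - G (w.1, H)| ≤ M * (H - w.2) := by
      rcases le_or_gt (φ w.1) w.2 with h6 | h6
      · refine seg _ _ le_rfl h3 le_rfl fun s hs => ?_
        exact hA _ box1 (box2 s hs.1.le hs.2.le) (by simpa using h6.trans_lt hs.1)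
      · have hB' := hB.resolve_right fun hB => hB w box1 (box2 w.2 le_rfl h3) h6 hw
        have e1 := seg w.2 (φ w.1) le_rfl h6.le h4.le fun s hs =>
          hB' _ box1 (box2 s hs.1.le (hs.2.le.trans h4.le)) hs.2
        have e2 := seg (φ w.1) H h6.le h4.le le_rfl fun s hs =>
          hA _ box1 (box2 s (h6.le.trans hs.1.le) hs.2.le) hs.1
        have := abs_sub_le (G (w.1, w.2)) (G (w.1, φ w.1)) (G (w.1, H))
        linarith
    exact fin.trans (mul_le_mul_of_nonneg_left h5 hM)
  have e1 := vert u hu hu1.1 hu1.2 hu2.1 (by linarith) (hφH _ left_mem_uIcc) (by linarith)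
  have e2 := vert v hv hv1.1 hv1.2 hv2.1 (by linarith) (hφH _ right_mem_uIcc) (by linarith)
  have e3 : |G (u.1, H) - G (v.1, H)| ≤ M * |u.1 - v.1| := by
    refine hPB.horiz fun x hx => ?_
    refine hA _ ?_ ?_ (hφH x hx)
    · rw [uIcc, mem_Icc] at hx
      have : p.1 - δ/4 < min u.1 v.1 := lt_min (by linarith) (by linarith)
      have : max u.1 v.1 < p.1 + δ/4 := max_lt (by linarith) (by linarith)
      simp only [abs_lt]; constructor <;> linarith [hx.1, hx.2]
    · simp only [abs_lt]; constructor
      · nlinarith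
      · linarith
  have e4 : M * |u.1 - v.1| ≤ M * D := mul_le_mul_of_nonneg_left hd1 hM
  have e5 := abs_sub_le (G u) (G (u.1, H)) (G v)
  have e6 := abs_sub_le (G (u.1, H)) (G (v.1, H)) (G v)
  rw [abs_sub_comm (G (v.1, H))] at e6
  nlinarith

def LocLip (G : ℝ × ℝ → ℝ) (Ω : Set (ℝ × ℝ)) (p : ℝ × ℝ) : Prop :=
  ∃ V ∈ 𝓝 p, ∃ C : ℝ, ∀ u ∈ Ω, u ∈ V → ∀ v ∈ Ω, v ∈ V → |G u - G v| ≤ C * ‖u - v‖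

lemma Rf_cont : Continuous Rf := by unfold Rf; fun_prop

lemma norm_Rf (u v : ℝ × ℝ) : ‖Rf u - Rf v‖ = ‖u - v‖ := by
  simp only [Prod.norm_def, Rf, Prod.fst_sub, Prod.snd_sub, Real.norm_eq_abs]
  rw [← abs_neg (-u.2 - -v.2)]
  congr 2
  ring

lemma PB_Rf {G : ℝ × ℝ → ℝ} {Ω : Set (ℝ × ℝ)} {M : ℝ} (h : PB G Ω M) :
    PB (G ∘ Rf) (Rf ⁻¹' Ω) M := by
  intro p hp
  obtain ⟨⟨d, hd, hdM⟩, ⟨e, he, heM⟩⟩ := h (Rf p) hp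
  refine ⟨⟨d, hd, hdM⟩, ⟨-e, ?_, by rwa [abs_neg]⟩⟩
  have h1 : HasDerivAt (fun s : ℝ => -s) (-1) p.2 := (hasDerivAt_id p.2).neg
  have h2 := HasDerivAt.comp (h₂ := fun s => G ((Rf p).1, s)) p.2 he h1
  rw [mul_neg_one] at h2
  exact h2

lemma PB_swap {G : ℝ × ℝ → ℝ} {Ω : Set (ℝ × ℝ)} {M : ℝ} (h : PB G Ω M) :
    PB (G ∘ Prod.swap) (Prod.swap ⁻¹' Ω) M := fun p hp => ⟨(h p.swap hp).2, (h p.swap hp).1⟩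

lemma cont_Rf {G : ℝ × ℝ → ℝ} {Ω : Set (ℝ × ℝ)} (h : ContinuousOn G (closure Ω)) :
    ContinuousOn (G ∘ Rf) (closure (Rf ⁻¹' Ω)) := by
  have : closure (Rf ⁻¹' Ω) = Rf ⁻¹' (closure Ω) := by
    rw [← RfH_eq]; exact (RfH.preimage_closure Ω).symm
  rw [this]
  exact h.comp Rf_cont.continuousOn fun p hp => hp

lemma cont_swap {G : ℝ × ℝ → ℝ} {Ω : Set (ℝ × ℝ)} (h : ContinuousOn G (closure Ω)) :
    ContinuousOn (G ∘ Prod.swap) (closure (Prod.swap ⁻¹' Ω)) := by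
  have : closure (Prod.swap ⁻¹' Ω) = Prod.swap ⁻¹' (closure Ω) :=
    ((Homeomorph.prodComm ℝ ℝ).preimage_closure Ω).symm
  rw [this]
  exact h.comp continuous_swap.continuousOn fun p hp => hp

lemma loclip_of_good {Ω : Set (ℝ × ℝ)} {p : ℝ × ℝ} {M : ℝ} {G : ℝ × ℝ → ℝ} (hM : 0 ≤ M)
    (hgood : GoodSide Ω p) (hG : ContinuousOn G (closure Ω)) (hPB : PB G Ω M) : LocLip G Ω p := by
  obtain ⟨L, δ, φ, hL, hδ, hφ, hp, hA, hB⟩ := hgood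
  refine ⟨Metric.ball p.1 (δ/4) ×ˢ Metric.ball p.2 (δ/4),
    prod_mem_nhds (Metric.ball_mem_nhds _ (by positivity)) (Metric.ball_mem_nhds _ (by positivity)),
    M * (2 * L + 5), ?_⟩
  rintro u hu ⟨hu1, hu2⟩ v hv ⟨hv1, hv2⟩
  rw [Metric.mem_ball, Real.dist_eq] at hu1 hu2 hv1 hv2
  rcases le_or_gt (φ v.1) v.2 with h1 | h1
  · exact up_bound hL hδ hM hφ hA hB hG hPB hu hv hu1 hu2 hv1 hv2 h1
  rcases le_or_gt (φ u.1) u.2 with h2 | h2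
  · rw [abs_sub_comm, norm_sub_rev]
    exact up_bound hL hδ hM hφ hA hB hG hPB hv hu hv1 hv2 hu1 hu2 h2
  have hbig : δ / 4 ≤ (L + 1) * δ := by nlinarith
  have hB' := hB.resolve_right fun hB => hB v (by linarith) (by linarith) h1 hv
  have neg : ∀ a b c : ℝ, |a - b| < c → |-a - -b| < c := by
    intro a b c h; rw [← abs_neg]; simpa [sub_eq_add_neg, add_comm] using h
  have neg2 : ∀ a b c : ℝ, |a - -b| < c → |-a - b| < c := by
    intro a b c h; rw [← abs_neg]; simpa [sub_eq_add_neg, add_comm] using h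
  have := up_bound (Ω := Rf ⁻¹' Ω) (p := Rf p) (φ := fun x => -φ x) (G := G ∘ Rf) (u := Rf u) (v := Rf v)
    hL hδ hM
    (by intro x y; rw [← abs_neg]; simpa [sub_eq_add_neg, add_comm] using hφ x y)
    (fun q h3 h4 h5 => hB' (Rf q) h3 (neg2 _ _ _ h4) (by simp [Rf]; linarith))
    (Or.inl fun q h3 h4 h5 => hA (Rf q) h3 (neg2 _ _ _ h4) (by simp [Rf]; linarith))
    (cont_Rf hG) (PB_Rf hPB) (by rwa [mem_preimage, Rf_Rf]) (by rwa [mem_preimage, Rf_Rf])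
    hu1 (neg _ _ _ hu2) hv1 (neg _ _ _ hv2) (by simp [Rf]; linarith)
  rw [norm_Rf] at this
  simpa only [Function.comp, Rf_Rf] using this

lemma loclip_Rf {Ω : Set (ℝ × ℝ)} {p : ℝ × ℝ} {G : ℝ × ℝ → ℝ}
    (h : LocLip (G ∘ Rf) (Rf ⁻¹' Ω) (Rf p)) : LocLip G Ω p := by
  obtain ⟨V, hV, C, hC⟩ := h
  refine ⟨Rf ⁻¹' V, Rf_cont.continuousAt.preimage_mem_nhds hV, C, ?_⟩
  intro u hu huV v hv hvV
  have := hC (Rf u) (by rwa [mem_preimage, Rf_Rf]) huV (Rf v) (by rwa [mem_preimage, Rf_Rf]) hvV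
  rw [norm_Rf] at this
  simpa only [Function.comp, Rf_Rf] using this

lemma loclip_swap {Ω : Set (ℝ × ℝ)} {p : ℝ × ℝ} {G : ℝ × ℝ → ℝ}
    (h : LocLip (G ∘ Prod.swap) (Prod.swap ⁻¹' Ω) p.swap) : LocLip G Ω p := by
  obtain ⟨V, hV, C, hC⟩ := h
  refine ⟨Prod.swap ⁻¹' V, continuous_swap.continuousAt.preimage_mem_nhds hV, C, ?_⟩
  intro u hu huV v hv hvV
  have := hC u.swap (by simpa using hu) huV v.swap (by simpa using hv) hvV
  have e : ‖u.swap - v.swap‖ = ‖u - v‖ := by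
    simp only [Prod.norm_def, Prod.fst_sub, Prod.snd_sub, Prod.fst_swap, Prod.snd_swap]
    exact max_comm _ _
  rw [e] at this
  simpa using this

lemma loclip_all {Ω : Set (ℝ × ℝ)} (hΩ : IsAnalyticJordanDomain Ω) {M : ℝ} {G : ℝ × ℝ → ℝ} (hM : 0 ≤ M)
    (hG : ContinuousOn G (closure Ω)) (hPB : PB G Ω M) {p : ℝ × ℝ} (hp : p ∈ closure Ω) : LocLip G Ω p := by
  by_cases hpΩ : p ∈ Ω
  · obtain ⟨r, hr, hsub⟩ := Metric.isOpen_iff.1 hΩ.1 p hpΩ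
    refine ⟨Metric.ball p r, Metric.ball_mem_nhds _ hr, M * 2, ?_⟩
    intro u hu huV v hv hvV
    rw [Metric.mem_ball, Prod.dist_eq, max_lt_iff, Real.dist_eq, Real.dist_eq] at huV hvV
    simp only [abs_lt] at huV hvV
    have hseg : ∀ a b c x : ℝ, -r < a - c → a - c < r → -r < b - c → b - c < r → x ∈ uIcc a b → |x - c| < r := by
      intro a b c x h1 h2 h3 h4 h5
      rw [uIcc, mem_Icc] at h5
      have : c - r < min a b := lt_min (by linarith) (by linarith)
      have : max a b < c + r := max_lt (by linarith) (by linarith)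
      rw [abs_lt]; constructor <;> linarith [h5.1, h5.2]
    have e1 : |G (u.1, u.2) - G (v.1, u.2)| ≤ M * |u.1 - v.1| := by
      refine hPB.horiz fun x hx => hsub ?_
      rw [Metric.mem_ball, Prod.dist_eq, max_lt_iff, Real.dist_eq, Real.dist_eq]
      exact ⟨hseg _ _ _ _ huV.1.1 huV.1.2 hvV.1.1 hvV.1.2 hx, abs_lt.2 huV.2⟩
    have e2 : |G (v.1, u.2) - G (v.1, v.2)| ≤ M * |u.2 - v.2| := by
      refine (PB_swap hPB).horiz (y := v.1) fun x hx => hsub ?_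
      rw [Metric.mem_ball, Prod.dist_eq, max_lt_iff, Real.dist_eq, Real.dist_eq]
      exact ⟨abs_lt.2 hvV.1, hseg _ _ _ _ huV.2.1 huV.2.2 hvV.2.1 hvV.2.2 hx⟩
    have hd1 : |u.1 - v.1| ≤ ‖u - v‖ := by rw [← Real.norm_eq_abs]; exact norm_fst_le (u - v)
    have hd2 : |u.2 - v.2| ≤ ‖u - v‖ := by rw [← Real.norm_eq_abs]; exact norm_snd_le (u - v)
    have h1 := mul_le_mul_of_nonneg_left hd1 hM
    have h2 := mul_le_mul_of_nonneg_left hd2 hM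
    have := abs_sub_le (G u) (G (v.1, u.2)) (G v)
    linarith
  · have hf : p ∈ frontier Ω := ⟨hp, fun h => hpΩ (interior_subset h)⟩
    rcases goodside_exists hΩ hf with (h | h) | (h | h)
    · exact loclip_of_good hM h hG hPB
    · exact loclip_Rf (loclip_of_good hM h (cont_Rf hG) (PB_Rf hPB))
    · exact loclip_swap (loclip_of_good hM h (cont_swap hG) (PB_swap hPB))
    · exact loclip_swap (loclip_Rf (loclip_of_good hM h (cont_Rf (cont_swap hG)) (PB_Rf (PB_swap hPB))))

lemma lip_global {Ω : Set (ℝ × ℝ)} (hΩ : IsAnalyticJordanDomain Ω) {M : ℝ} {G : ℝ × ℝ → ℝ} (hM : 0 ≤ M)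
    (hG : ContinuousOn G (closure Ω)) (hPB : PB G Ω M) :
    ∃ C, ∀ u ∈ Ω, ∀ v ∈ Ω, |G u - G v| ≤ C * ‖u - v‖ := by
  obtain ⟨B, hB⟩ := bdd_of_ext hΩ.2.1 hG (fun _ _ => rfl)
  have hcomp : IsCompact (closure Ω ×ˢ closure Ω) :=
    hΩ.2.1.isCompact_closure.prod hΩ.2.1.isCompact_closure
  have key : ∃ C, ∀ z ∈ closure Ω ×ˢ closure Ω, z.1 ∈ Ω → z.2 ∈ Ω → |G z.1 - G z.2| ≤ C * ‖z.1 - z.2‖ := by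
    refine hcomp.induction_on (p := fun S => ∃ C, ∀ z ∈ S, z.1 ∈ Ω → z.2 ∈ Ω → |G z.1 - G z.2| ≤ C * ‖z.1 - z.2‖)
      ⟨0, by simp⟩ ?_ ?_ ?_
    · rintro s t hst ⟨C, hC⟩
      exact ⟨C, fun z hz => hC z (hst hz)⟩
    · rintro s t ⟨C, hC⟩ ⟨C', hC'⟩
      refine ⟨max C C', ?_⟩
      rintro z (hz | hz) h1 h2
      · exact (hC z hz h1 h2).trans (mul_le_mul_of_nonneg_right (le_max_left _ _) (norm_nonneg _))
      · exact (hC' z hz h1 h2).trans (mul_le_mul_of_nonneg_right (le_max_right _ _) (norm_nonneg _))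
    · rintro ⟨p, q⟩ ⟨hp, hq⟩
      simp only at hp hq
      by_cases hpq : p = q
      · subst hpq
        obtain ⟨V, hV, C, hC⟩ := loclip_all hΩ hM hG hPB hp
        refine ⟨V ×ˢ V, mem_nhdsWithin_of_mem_nhds (prod_mem_nhds hV hV), C, ?_⟩
        rintro z ⟨hz1, hz2⟩ h1 h2
        exact hC _ h1 hz1 _ h2 hz2
      · set r := ‖p - q‖ with hr
        have hr0 : 0 < r := norm_pos_iff.2 (sub_ne_zero.2 hpq)
        have hcont : Continuous (fun z : (ℝ × ℝ) × (ℝ × ℝ) => ‖z.1 - z.2‖) := by fun_prop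
        have hev : ∀ᶠ z in 𝓝 (p, q), r / 2 < ‖z.1 - z.2‖ :=
          hcont.continuousAt.eventually (lt_mem_nhds (by simp only; linarith))
        refine ⟨_, mem_nhdsWithin_of_mem_nhds hev, 4 * B / r, ?_⟩
        rintro z hz h1 h2
        have hz' : r / 2 < ‖z.1 - z.2‖ := hz
        have e1 := abs_sub (G z.1) (G z.2)
        have e2 := hB _ h1
        have e3 := hB _ h2
        have hB0 : 0 ≤ B := (abs_nonneg _).trans e2
        have e4 : 2 * B ≤ 4 * B / r * ‖z.1 - z.2‖ := by
          rw [div_mul_eq_mul_div, le_div_iff₀ hr0]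
          nlinarith
        linarith
  obtain ⟨C, hC⟩ := key
  exact ⟨C, fun u hu v hv => hC (u, v) ⟨subset_closure hu, subset_closure hv⟩ hu hv⟩

lemma holder_global {Ω : Set (ℝ × ℝ)} (hΩ : IsAnalyticJordanDomain Ω) {M : ℝ} {G : ℝ × ℝ → ℝ} (hM : 0 ≤ M)
    (hG : ContinuousOn G (closure Ω)) (hPB : PB G Ω M) : HolderHalfOn G Ω := by
  obtain ⟨C, hC⟩ := lip_global hΩ hM hG hPB
  obtain ⟨R, hR⟩ := hΩ.2.1.exists_norm_le
  refine ⟨|C| * (2 * R) ^ ((1:ℝ)/2), fun u hu v hv => ?_⟩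
  have h1 := hC u hu v hv
  have h2 : ‖u - v‖ ≤ 2 * R := by
    have := norm_sub_le u v
    linarith [hR u hu, hR v hv]
  have h3 : ‖u - v‖ = ‖u - v‖ ^ ((1:ℝ)/2) * ‖u - v‖ ^ ((1:ℝ)/2) := by
    rw [← Real.rpow_add_of_nonneg (norm_nonneg _) (by norm_num) (by norm_num)]; norm_num
  have h4 : ‖u - v‖ ^ ((1:ℝ)/2) ≤ (2 * R) ^ ((1:ℝ)/2) :=
    Real.rpow_le_rpow (norm_nonneg _) h2 (by norm_num)
  have h5 : 0 ≤ ‖u - v‖ ^ ((1:ℝ)/2) := by positivity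
  calc |G u - G v| ≤ C * ‖u - v‖ := h1
    _ ≤ |C| * ‖u - v‖ := mul_le_mul_of_nonneg_right (le_abs_self C) (norm_nonneg _)
    _ = |C| * (‖u - v‖ ^ ((1:ℝ)/2) * ‖u - v‖ ^ ((1:ℝ)/2)) := by rw [← h3]
    _ ≤ |C| * ((2 * R) ^ ((1:ℝ)/2) * ‖u - v‖ ^ ((1:ℝ)/2)) := by gcongr
    _ = _ := by ring


lemma iter_pdy_pdx {Ω : Set (ℝ × ℝ)} (hΩ : IsOpen Ω) (j : ℕ) : ∀ {u : ℝ × ℝ → ℝ},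
    ContDiffOn ℝ (⊤ : ℕ∞) u Ω → EqOn (pdy^[j] (pdx u)) (pdx (pdy^[j] u)) Ω := by
  induction j with
  | zero => intro u _ p _; rfl
  | succ j ih =>
    intro u hu
    have h1 : EqOn (pdy^[j] (pdy (pdx u))) (pdy^[j] (pdx (pdy u))) Ω := by
      have := iter_congr hΩ (pd_symm hΩ hu) 0 j
      simpa using this
    have h2 := ih (smooth_pdy hΩ hu)
    intro p hp
    simp only [Function.iterate_succ, Function.comp]
    rw [h1 hp, h2 hp]

lemma nice_pdy {u : ℝ × ℝ → ℝ} {Ω : Set (ℝ × ℝ)} (hΩ : IsOpen Ω) (h : Nice u Ω) : Nice (pdy u) Ω :=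
  ⟨smooth_pdy hΩ h.1, fun i j => by simpa using h.2 i (j + 1)⟩

lemma nice_pdx {u : ℝ × ℝ → ℝ} {Ω : Set (ℝ × ℝ)} (hΩ : IsOpen Ω) (h : Nice u Ω) : Nice (pdx u) Ω := by
  refine ⟨smooth_pdx hΩ h.1, fun i j => ?_⟩
  obtain ⟨G, hG, hE⟩ := h.2 (i + 1) j
  refine ⟨G, hG, fun p hp => ?_⟩
  have h1 := iter_congr hΩ (iter_pdy_pdx hΩ j h.1) i 0 hp
  simp only [Function.iterate_zero, id] at h1
  rw [h1, ← hE hp]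
  simp only [Function.iterate_succ, Function.comp]

lemma nice_bdd {u : ℝ × ℝ → ℝ} {Ω : Set (ℝ × ℝ)} (hb : Bornology.IsBounded Ω) (h : Nice u Ω) :
    ∃ M, ∀ p ∈ Ω, |u p| ≤ M := by
  obtain ⟨G, hG, hE⟩ := h.2 0 0
  exact bdd_of_ext hb hG hE

lemma nice_holder {u : ℝ × ℝ → ℝ} {Ω : Set (ℝ × ℝ)} (hΩ : IsAnalyticJordanDomain Ω) (h : Nice u Ω) :
    HolderHalfOn u Ω := by
  obtain ⟨G, hG, hE⟩ := h.2 0 0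
  simp only [Function.iterate_zero, id] at hE
  obtain ⟨M1, h1⟩ := nice_bdd hΩ.2.1 (nice_pdx hΩ.1 h)
  obtain ⟨M2, h2⟩ := nice_bdd hΩ.2.1 (nice_pdy hΩ.1 h)
  have hPB : PB G Ω (max |M1| |M2|) := by
    intro p hp
    have hd := smooth_diff hΩ.1 h.1 hp
    refine ⟨⟨pdx u p, ?_, (h1 p hp).trans ((le_abs_self _).trans (le_max_left _ _))⟩,
      ⟨pdy u p, ?_, (h2 p hp).trans ((le_abs_self _).trans (le_max_right _ _))⟩⟩
    · refine (hasDerivAt_pdx hd).congr_of_eventuallyEq ?_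
      filter_upwards [ev_x hΩ.1 hp] with s hs using (hE hs).symm
    · refine (hasDerivAt_pdy hd).congr_of_eventuallyEq ?_
      filter_upwards [ev_y hΩ.1 hp] with s hs using (hE hs).symm
  obtain ⟨C, hC⟩ := holder_global hΩ (le_max_of_le_left (abs_nonneg _)) hG hPB
  exact ⟨C, fun p hp q hq => by rw [hE hp, hE hq]; exact hC p hp q hq⟩

/-- all quantities in the norm are bounded by `A` -/
def Bd (u : ℝ × ℝ → ℝ) (Ω : Set (ℝ × ℝ)) (A : ℝ) : Prop :=
  (∀ p ∈ Ω, |u p| ≤ A ∧ |pdx u p| ≤ A ∧ |pdy u p| ≤ A ∧ |fxx u p| ≤ A ∧ |fxy u p| ≤ A ∧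
    |fyy u p| ≤ A) ∧
  ∀ p ∈ Ω, ∀ q ∈ Ω, |fxx u p - fxx u q| ≤ A * ‖p - q‖ ^ ((1 : ℝ) / 2) ∧
    |fxy u p - fxy u q| ≤ A * ‖p - q‖ ^ ((1 : ℝ) / 2) ∧
    |fyy u p - fyy u q| ≤ A * ‖p - q‖ ^ ((1 : ℝ) / 2)

lemma C0norm_nonneg (g : ℝ × ℝ → ℝ) (s : Set (ℝ × ℝ)) : 0 ≤ C0norm g s := by
  refine Real.sSup_nonneg ?_
  rintro _ ⟨p, _, rfl⟩
  exact abs_nonneg _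

lemma holderSemi_nonneg (g : ℝ × ℝ → ℝ) (s : Set (ℝ × ℝ)) : 0 ≤ holderSemi g s := by
  refine Real.sSup_nonneg ?_
  rintro _ ⟨u, _, v, _, _, rfl⟩
  positivity

lemma C2halfNorm_nonneg (g : ℝ × ℝ → ℝ) (s : Set (ℝ × ℝ)) : 0 ≤ C2halfNorm g s := by
  unfold C2halfNorm C2norm
  have := C0norm_nonneg g s
  have := le_max_of_le_left (c := C0norm (pdy g) s) (C0norm_nonneg (pdx g) s)
  have := le_max_of_le_left (c := max (C0norm (fxy g) s) (C0norm (fyy g) s)) (C0norm_nonneg (fxx g) s)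
  have := le_max_of_le_left (c := max (holderSemi (fxy g) s) (holderSemi (fyy g) s)) (holderSemi_nonneg (fxx g) s)
  linarith

lemma C0norm_le {g : ℝ × ℝ → ℝ} {s : Set (ℝ × ℝ)} {A : ℝ} (hA : 0 ≤ A) (h : ∀ p ∈ s, |g p| ≤ A) :
    C0norm g s ≤ A := by
  refine Real.sSup_le ?_ hA
  rintro _ ⟨p, hp, rfl⟩
  exact h p hp

lemma le_C0norm {g : ℝ × ℝ → ℝ} {s : Set (ℝ × ℝ)} (h : ∃ M, ∀ p ∈ s, |g p| ≤ M) {p : ℝ × ℝ} (hp : p ∈ s) :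
    |g p| ≤ C0norm g s := by
  obtain ⟨M, hM⟩ := h
  refine le_csSup ⟨M, ?_⟩ ⟨p, hp, rfl⟩
  rintro _ ⟨q, hq, rfl⟩
  exact hM q hq

lemma holderSemi_le {g : ℝ × ℝ → ℝ} {s : Set (ℝ × ℝ)} {A : ℝ} (hA : 0 ≤ A)
    (h : ∀ p ∈ s, ∀ q ∈ s, |g p - g q| ≤ A * ‖p - q‖ ^ ((1 : ℝ) / 2)) : holderSemi g s ≤ A := by
  refine Real.sSup_le ?_ hA
  rintro _ ⟨u, hu, v, hv, huv, rfl⟩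
  have : 0 < ‖u - v‖ ^ ((1 : ℝ) / 2) := Real.rpow_pos_of_pos (norm_pos_iff.2 (sub_ne_zero.2 huv)) _
  rw [div_le_iff₀ this]
  exact h u hu v hv

lemma le_holderSemi {g : ℝ × ℝ → ℝ} {s : Set (ℝ × ℝ)} (h : HolderHalfOn g s) {p q : ℝ × ℝ}
    (hp : p ∈ s) (hq : q ∈ s) : |g p - g q| ≤ holderSemi g s * ‖p - q‖ ^ ((1 : ℝ) / 2) := by
  obtain ⟨M, hM⟩ := h
  rcases eq_or_ne p q with rfl | hne
  · simp
  have pos : ∀ u v : ℝ × ℝ, u ≠ v → 0 < ‖u - v‖ ^ ((1 : ℝ) / 2) := fun u v huv =>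
    Real.rpow_pos_of_pos (norm_pos_iff.2 (sub_ne_zero.2 huv)) _
  rw [← div_le_iff₀ (pos _ _ hne)]
  refine le_csSup ⟨M, ?_⟩ ⟨p, hp, q, hq, hne, rfl⟩
  rintro _ ⟨u, hu, v, hv, huv, rfl⟩
  rw [div_le_iff₀ (pos _ _ huv)]
  exact hM u hu v hv

lemma norm_le_of_Bd {u : ℝ × ℝ → ℝ} {Ω : Set (ℝ × ℝ)} {A : ℝ} (hA : 0 ≤ A) (h : Bd u Ω A) :
    C2halfNorm u Ω ≤ 4 * A := by
  obtain ⟨h1, h2⟩ := h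
  have a1 := C0norm_le hA fun p hp => (h1 p hp).1
  have a2 := C0norm_le hA fun p hp => (h1 p hp).2.1
  have a3 := C0norm_le hA fun p hp => (h1 p hp).2.2.1
  have a4 := C0norm_le hA fun p hp => (h1 p hp).2.2.2.1
  have a5 := C0norm_le hA fun p hp => (h1 p hp).2.2.2.2.1
  have a6 := C0norm_le hA fun p hp => (h1 p hp).2.2.2.2.2
  have b1 := holderSemi_le hA fun p hp q hq => (h2 p hp q hq).1
  have b2 := holderSemi_le hA fun p hp q hq => (h2 p hp q hq).2.1
  have b3 := holderSemi_le hA fun p hp q hq => (h2 p hp q hq).2.2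
  unfold C2halfNorm C2norm
  have c1 := max_le a2 a3
  have c2 := max_le a4 (max_le a5 a6)
  have c3 := max_le b1 (max_le b2 b3)
  linarith

lemma Bd_norm {u : ℝ × ℝ → ℝ} {Ω : Set (ℝ × ℝ)} (hΩ : IsAnalyticJordanDomain Ω) (h : Nice u Ω) :
    Bd u Ω (C2halfNorm u Ω) := by
  have nx := nice_pdx hΩ.1 h
  have ny := nice_pdy hΩ.1 h
  have nxx : Nice (fxx u) Ω := nice_pdx hΩ.1 nx
  have nxy : Nice (fxy u) Ω := nice_pdy hΩ.1 nx
  have nyy : Nice (fyy u) Ω := nice_pdy hΩ.1 ny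
  have z0 := C0norm_nonneg u Ω
  have z1 := le_max_left (C0norm (pdx u) Ω) (C0norm (pdy u) Ω)
  have z2 := le_max_right (C0norm (pdx u) Ω) (C0norm (pdy u) Ω)
  have z1' := C0norm_nonneg (pdx u) Ω
  have z3 := le_max_left (C0norm (fxx u) Ω) (max (C0norm (fxy u) Ω) (C0norm (fyy u) Ω))
  have z3' := C0norm_nonneg (fxx u) Ω
  have z4 := (le_max_left (C0norm (fxy u) Ω) (C0norm (fyy u) Ω)).trans (le_max_right (C0norm (fxx u) Ω) _)
  have z5 := (le_max_right (C0norm (fxy u) Ω) (C0norm (fyy u) Ω)).trans (le_max_right (C0norm (fxx u) Ω) _)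
  have w3 := le_max_left (holderSemi (fxx u) Ω) (max (holderSemi (fxy u) Ω) (holderSemi (fyy u) Ω))
  have w3' := holderSemi_nonneg (fxx u) Ω
  have w4 := (le_max_left (holderSemi (fxy u) Ω) (holderSemi (fyy u) Ω)).trans (le_max_right (holderSemi (fxx u) Ω) _)
  have w5 := (le_max_right (holderSemi (fxy u) Ω) (holderSemi (fyy u) Ω)).trans (le_max_right (holderSemi (fxx u) Ω) _)
  refine ⟨fun p hp => ⟨?_, ?_, ?_, ?_, ?_, ?_⟩, fun p hp q hq => ⟨?_, ?_, ?_⟩⟩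
  · refine (le_C0norm (nice_bdd hΩ.2.1 h) hp).trans ?_
    unfold C2halfNorm C2norm; linarith
  · refine (le_C0norm (nice_bdd hΩ.2.1 nx) hp).trans ?_
    unfold C2halfNorm C2norm; linarith
  · refine (le_C0norm (nice_bdd hΩ.2.1 ny) hp).trans ?_
    unfold C2halfNorm C2norm; linarith
  · refine (le_C0norm (nice_bdd hΩ.2.1 nxx) hp).trans ?_
    unfold C2halfNorm C2norm; linarith
  · refine (le_C0norm (nice_bdd hΩ.2.1 nxy) hp).trans ?_
    unfold C2halfNorm C2norm; linarith
  · refine (le_C0norm (nice_bdd hΩ.2.1 nyy) hp).trans ?_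
    unfold C2halfNorm C2norm; linarith
  · refine (le_holderSemi (nice_holder hΩ nxx) hp hq).trans ?_
    refine mul_le_mul_of_nonneg_right ?_ (by positivity)
    unfold C2halfNorm C2norm; linarith
  · refine (le_holderSemi (nice_holder hΩ nxy) hp hq).trans ?_
    refine mul_le_mul_of_nonneg_right ?_ (by positivity)
    unfold C2halfNorm C2norm; linarith
  · refine (le_holderSemi (nice_holder hΩ nyy) hp hq).trans ?_
    refine mul_le_mul_of_nonneg_right ?_ (by positivity)
    unfold C2halfNorm C2norm; linarith

lemma C2halfNorm_congr {u v : ℝ × ℝ → ℝ} {Ω : Set (ℝ × ℝ)} (hΩ : IsOpen Ω) (h : EqOn u v Ω) :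
    C2halfNorm u Ω = C2halfNorm v Ω := by
  have c0 : ∀ {g k : ℝ × ℝ → ℝ}, EqOn g k Ω → C0norm g Ω = C0norm k Ω := by
    intro g k e
    unfold C0norm
    congr 1
    exact image_congr fun p hp => by rw [e hp]
  have cs : ∀ {g k : ℝ × ℝ → ℝ}, EqOn g k Ω → holderSemi g Ω = holderSemi k Ω := by
    intro g k e
    unfold holderSemi
    congr 1
    ext r
    constructor
    · rintro ⟨p, hp, q, hq, hne, rfl⟩
      exact ⟨p, hp, q, hq, hne, by rw [e hp, e hq]⟩
    · rintro ⟨p, hp, q, hq, hne, rfl⟩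
      exact ⟨p, hp, q, hq, hne, by rw [e hp, e hq]⟩
  have ex := pdx_congr hΩ h
  have ey := pdy_congr hΩ h
  have exx : EqOn (fxx u) (fxx v) Ω := pdx_congr hΩ ex
  have exy : EqOn (fxy u) (fxy v) Ω := pdy_congr hΩ ex
  have eyy : EqOn (fyy u) (fyy v) Ω := pdy_congr hΩ ey
  unfold C2halfNorm C2norm
  rw [c0 h, c0 ex, c0 ey, c0 exx, c0 exy, c0 eyy, cs exx, cs exy, cs eyy]

lemma pdx_mul_const (u : ℝ × ℝ → ℝ) (c : ℝ) : pdx (fun p => u p * c) = fun p => pdx u p * c := by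
  funext p
  unfold pdx
  exact deriv_mul_const_field (v := c)

lemma pdy_mul_const (u : ℝ × ℝ → ℝ) (c : ℝ) : pdy (fun p => u p * c) = fun p => pdy u p * c := by
  funext p
  unfold pdy
  exact deriv_mul_const_field (v := c)

lemma fxx_mul_const (u : ℝ × ℝ → ℝ) (c : ℝ) : fxx (fun p => u p * c) = fun p => fxx u p * c := by
  unfold fxx; rw [pdx_mul_const, pdx_mul_const]
lemma fxy_mul_const (u : ℝ × ℝ → ℝ) (c : ℝ) : fxy (fun p => u p * c) = fun p => fxy u p * c := by
  unfold fxy; rw [pdx_mul_const, pdy_mul_const]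
lemma fyy_mul_const (u : ℝ × ℝ → ℝ) (c : ℝ) : fyy (fun p => u p * c) = fun p => fyy u p * c := by
  unfold fyy; rw [pdy_mul_const, pdy_mul_const]

lemma Bd_mul_const {u : ℝ × ℝ → ℝ} {Ω : Set (ℝ × ℝ)} {A : ℝ} (c : ℝ) (h : Bd u Ω A) :
    Bd (fun p => u p * c) Ω (A * |c|) := by
  unfold Bd
  rw [pdx_mul_const, pdy_mul_const, fxx_mul_const, fxy_mul_const, fyy_mul_const]
  have k1 : ∀ x : ℝ, |x| ≤ A → |x * c| ≤ A * |c| := fun x hx => by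
    rw [abs_mul]; exact mul_le_mul_of_nonneg_right hx (abs_nonneg _)
  have k2 : ∀ x y d : ℝ, |x - y| ≤ A * d → |x * c - y * c| ≤ A * |c| * d := fun x y d hx => by
    rw [← sub_mul, abs_mul]
    calc |x - y| * |c| ≤ A * d * |c| := mul_le_mul_of_nonneg_right hx (abs_nonneg _)
      _ = _ := by ring
  refine ⟨fun p hp => ?_, fun p hp q hq => ?_⟩
  · obtain ⟨a1, a2, a3, a4, a5, a6⟩ := h.1 p hp
    exact ⟨k1 _ a1, k1 _ a2, k1 _ a3, k1 _ a4, k1 _ a5, k1 _ a6⟩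
  · obtain ⟨a1, a2, a3⟩ := h.2 p hp q hq
    exact ⟨k2 _ _ _ a1, k2 _ _ _ a2, k2 _ _ _ a3⟩

lemma pdx_tsum {Ω : Set (ℝ × ℝ)} (hΩ : IsOpen Ω) {u : ℕ → ℝ × ℝ → ℝ} {A : ℕ → ℝ} (hA : Summable A)
    (hu : ∀ m, ContDiffOn ℝ (⊤ : ℕ∞) (u m) Ω) (h0 : ∀ m, ∀ p ∈ Ω, |u m p| ≤ A m)
    (h1 : ∀ m, ∀ p ∈ Ω, |pdx (u m) p| ≤ A m) :
    EqOn (pdx (fun q => ∑' m, u m q)) (fun q => ∑' m, pdx (u m) q) Ω := by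
  intro p hp
  obtain ⟨δ, hδ, hb⟩ := Metric.eventually_nhds_iff_ball.1 (ev_x hΩ hp)
  have := hasDerivAt_tsum_of_isPreconnected (g := fun m s => u m (s, p.2))
    (g' := fun m s => pdx (u m) (s, p.2)) (y₀ := p.1) (y := p.1) hA Metric.isOpen_ball
    (convex_ball p.1 δ).isPreconnected
    (fun m s hs => hasDerivAt_pdx (p := (s, p.2)) (smooth_diff hΩ (hu m) (hb s hs)))
    (fun m s hs => h1 m _ (hb s hs)) (Metric.mem_ball_self hδ)
    (Summable.of_norm_bounded hA fun m => h0 m _ hp) (Metric.mem_ball_self hδ)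
  exact this.deriv

lemma pdy_tsum {Ω : Set (ℝ × ℝ)} (hΩ : IsOpen Ω) {u : ℕ → ℝ × ℝ → ℝ} {A : ℕ → ℝ} (hA : Summable A)
    (hu : ∀ m, ContDiffOn ℝ (⊤ : ℕ∞) (u m) Ω) (h0 : ∀ m, ∀ p ∈ Ω, |u m p| ≤ A m)
    (h1 : ∀ m, ∀ p ∈ Ω, |pdy (u m) p| ≤ A m) :
    EqOn (pdy (fun q => ∑' m, u m q)) (fun q => ∑' m, pdy (u m) q) Ω := by
  intro p hp
  obtain ⟨δ, hδ, hb⟩ := Metric.eventually_nhds_iff_ball.1 (ev_y hΩ hp)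
  have := hasDerivAt_tsum_of_isPreconnected (g := fun m s => u m (p.1, s))
    (g' := fun m s => pdy (u m) (p.1, s)) (y₀ := p.2) (y := p.2) hA Metric.isOpen_ball
    (convex_ball p.2 δ).isPreconnected
    (fun m s hs => hasDerivAt_pdy (p := (p.1, s)) (smooth_diff hΩ (hu m) (hb s hs)))
    (fun m s hs => h1 m _ (hb s hs)) (Metric.mem_ball_self hδ)
    (Summable.of_norm_bounded hA fun m => h0 m _ hp) (Metric.mem_ball_self hδ)
  exact this.deriv

/-- derivatives of the sum of a series -/
lemma tsum_derivs {Ω : Set (ℝ × ℝ)} (hΩ : IsOpen Ω) {u : ℕ → ℝ × ℝ → ℝ} {A : ℕ → ℝ} (hA : Summable A)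
    (hu : ∀ m, ContDiffOn ℝ (⊤ : ℕ∞) (u m) Ω) (hB : ∀ m, Bd (u m) Ω (A m)) :
    EqOn (pdx (fun q => ∑' m, u m q)) (fun q => ∑' m, pdx (u m) q) Ω ∧
    EqOn (pdy (fun q => ∑' m, u m q)) (fun q => ∑' m, pdy (u m) q) Ω ∧
    EqOn (fxx (fun q => ∑' m, u m q)) (fun q => ∑' m, fxx (u m) q) Ω ∧
    EqOn (fxy (fun q => ∑' m, u m q)) (fun q => ∑' m, fxy (u m) q) Ω ∧
    EqOn (fyy (fun q => ∑' m, u m q)) (fun q => ∑' m, fyy (u m) q) Ω := by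
  have ex := pdx_tsum hΩ hA hu (fun m p hp => ((hB m).1 p hp).1) (fun m p hp => ((hB m).1 p hp).2.1)
  have ey := pdy_tsum hΩ hA hu (fun m p hp => ((hB m).1 p hp).1) (fun m p hp => ((hB m).1 p hp).2.2.1)
  refine ⟨ex, ey, ?_, ?_, ?_⟩
  · exact (pdx_congr hΩ ex).trans (pdx_tsum hΩ hA (fun m => smooth_pdx hΩ (hu m))
      (fun m p hp => ((hB m).1 p hp).2.1) (fun m p hp => ((hB m).1 p hp).2.2.2.1))
  · exact (pdy_congr hΩ ex).trans (pdy_tsum hΩ hA (fun m => smooth_pdx hΩ (hu m))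
      (fun m p hp => ((hB m).1 p hp).2.1) (fun m p hp => ((hB m).1 p hp).2.2.2.2.1))
  · exact (pdy_congr hΩ ey).trans (pdy_tsum hΩ hA (fun m => smooth_pdy hΩ (hu m))
      (fun m p hp => ((hB m).1 p hp).2.2.1) (fun m p hp => ((hB m).1 p hp).2.2.2.2.2))

lemma Bd_tsum {Ω : Set (ℝ × ℝ)} (hΩ : IsOpen Ω) {u : ℕ → ℝ × ℝ → ℝ} {A : ℕ → ℝ} (hA : Summable A)
    (hu : ∀ m, ContDiffOn ℝ (⊤ : ℕ∞) (u m) Ω) (hB : ∀ m, Bd (u m) Ω (A m)) :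
    Bd (fun q => ∑' m, u m q) Ω (∑' m, A m) := by
  obtain ⟨e1, e2, e3, e4, e5⟩ := tsum_derivs hΩ hA hu hB
  have k1 : ∀ c : ℕ → ℝ, (∀ m, |c m| ≤ A m) → |∑' m, c m| ≤ ∑' m, A m := fun c hc =>
    tsum_of_norm_bounded (f := c) hA.hasSum hc
  have k2 : ∀ c d : ℕ → ℝ, (∀ m, |c m| ≤ A m) → (∀ m, |d m| ≤ A m) → ∀ e : ℝ,
      (∀ m, |c m - d m| ≤ A m * e) → |∑' m, c m - ∑' m, d m| ≤ (∑' m, A m) * e := by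
    intro c d hc hd e h
    have s1 : Summable c := Summable.of_norm_bounded hA hc
    have s2 : Summable d := Summable.of_norm_bounded hA hd
    rw [← s1.tsum_sub s2]
    exact tsum_of_norm_bounded (f := fun m => c m - d m) (hA.hasSum.mul_right e) h
  refine ⟨fun p hp => ⟨?_, ?_, ?_, ?_, ?_, ?_⟩, fun p hp q hq => ⟨?_, ?_, ?_⟩⟩
  · exact k1 _ fun m => ((hB m).1 p hp).1
  · rw [e1 hp]; exact k1 _ fun m => ((hB m).1 p hp).2.1
  · rw [e2 hp]; exact k1 _ fun m => ((hB m).1 p hp).2.2.1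
  · rw [e3 hp]; exact k1 _ fun m => ((hB m).1 p hp).2.2.2.1
  · rw [e4 hp]; exact k1 _ fun m => ((hB m).1 p hp).2.2.2.2.1
  · rw [e5 hp]; exact k1 _ fun m => ((hB m).1 p hp).2.2.2.2.2
  · rw [e3 hp, e3 hq]
    exact k2 _ _ (fun m => ((hB m).1 p hp).2.2.2.1) (fun m => ((hB m).1 q hq).2.2.2.1) _
      fun m => ((hB m).2 p hp q hq).1
  · rw [e4 hp, e4 hq]
    exact k2 _ _ (fun m => ((hB m).1 p hp).2.2.2.2.1) (fun m => ((hB m).1 q hq).2.2.2.2.1) _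
      fun m => ((hB m).2 p hp q hq).2.1
  · rw [e5 hp, e5 hq]
    exact k2 _ _ (fun m => ((hB m).1 p hp).2.2.2.2.2) (fun m => ((hB m).1 q hq).2.2.2.2.2) _
      fun m => ((hB m).2 p hp q hq).2.2

lemma tail_tendsto {Ω : Set (ℝ × ℝ)} (hΩ : IsOpen Ω) {u : ℕ → ℝ × ℝ → ℝ} {A : ℕ → ℝ} (hA : Summable A)
    (hA0 : ∀ m, 0 ≤ A m)
    (hu : ∀ m, ContDiffOn ℝ (⊤ : ℕ∞) (u m) Ω) (hB : ∀ m, Bd (u m) Ω (A m)) :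
    Tendsto (fun n : ℕ => C2halfNorm (fun p => (∑' m, u m p) - ∑ m ∈ Finset.range n, u m p) Ω)
      atTop (𝓝 0) := by
  have h1 : Tendsto (fun n : ℕ => 4 * ∑' m, A (m + n)) atTop (𝓝 0) := by
    simpa using (tendsto_sum_nat_add A).const_mul 4
  refine squeeze_zero (fun n => C2halfNorm_nonneg _ _) (fun n => ?_) h1
  have e : EqOn (fun p => (∑' m, u m p) - ∑ m ∈ Finset.range n, u m p) (fun p => ∑' m, u (m + n) p) Ω := by
    intro p hp
    have s : Summable (fun m => u m p) := Summable.of_norm_bounded hA fun m => ((hB m).1 p hp).1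
    have := s.sum_add_tsum_nat_add n
    simp only
    linarith
  rw [C2halfNorm_congr hΩ e]
  exact norm_le_of_Bd (tsum_nonneg fun m => hA0 _)
    (Bd_tsum hΩ (u := fun m => u (m + n)) ((summable_nat_add_iff n).2 hA) (fun m => hu _) (fun m => hB _))

def Cone (Ω : Set (ℝ × ℝ)) (p : ℝ × ℝ) (s r0 : ℝ) : Prop :=
  s ≠ 0 ∧ 0 < r0 ∧ ∀ r x y : ℝ, 0 < r → r < r0 → |x| ≤ 1 → 1 ≤ y → y ≤ 3 →
    (p.1 + r * x, p.2 + r * (s * y)) ∈ Ω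

lemma cone_of_good {Ω : Set (ℝ × ℝ)} {p : ℝ × ℝ} (h : GoodSide Ω p) :
    ∃ s r0, Cone Ω p s r0 := by
  obtain ⟨L, δ, φ, hL, hδ, hφ, hp, hA, -⟩ := h
  refine ⟨L + 1, δ / 3, by positivity, by positivity, fun r x y hr hr0 hx hy hy3 => hA _ ?_ ?_ ?_⟩
  · simp only [add_sub_cancel_left, abs_mul, abs_of_pos hr]
    nlinarith [abs_nonneg x]
  · have : 0 < r * ((L + 1) * y) := by positivity
    simp only [add_sub_cancel_left, abs_of_pos this]
    have h1 : r * y < δ := by nlinarith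
    nlinarith
  · have h1 := (abs_le.1 (hφ (p.1 + r * x) p.1)).2
    simp only [add_sub_cancel_left, abs_mul, abs_of_pos hr, hp] at h1 ⊢
    have h2 : L * (r * |x|) ≤ L * r := by
      refine mul_le_mul_of_nonneg_left ?_ hL
      nlinarith [abs_nonneg x]
    have h3 : r * ((L + 1) * 1) ≤ r * ((L + 1) * y) := by gcongr
    nlinarith

lemma cone_of_good_Rf {Ω : Set (ℝ × ℝ)} {p : ℝ × ℝ} (h : GoodSide (Rf ⁻¹' Ω) (Rf p)) :
    ∃ s r0, Cone Ω p s r0 := by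
  obtain ⟨s, r0, hs, hr0, h⟩ := cone_of_good h
  refine ⟨-s, r0, neg_ne_zero.2 hs, hr0, fun r x y hr hr0 hx hy hy3 => ?_⟩
  have := h r x y hr hr0 hx hy hy3
  simp only [Rf, mem_preimage] at this
  convert this using 2
  ring

lemma cone_exists {Ω : Set (ℝ × ℝ)} (hΩ : IsAnalyticJordanDomain Ω) {p : ℝ × ℝ} (hp : p ∈ frontier Ω) :
    (∃ s r0, Cone Ω p s r0) ∨ (∃ s r0, Cone (Prod.swap ⁻¹' Ω) p.swap s r0) := by
  rcases goodside_exists hΩ hp with (h | h) | (h | h)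
  · exact Or.inl (cone_of_good h)
  · exact Or.inl (cone_of_good_Rf h)
  · exact Or.inr (cone_of_good h)
  · exact Or.inr (cone_of_good_Rf h)

/-- one-dimensional mean value inequality -/
lemma mv1 {g g' : ℝ → ℝ} {a b M : ℝ} (hd : ∀ s ∈ uIcc a b, HasDerivAt g (g' s) s ∧ |g' s| ≤ M) :
    |g a - g b| ≤ M * |a - b| := by
  have key : ∀ a b : ℝ, a ≤ b → (∀ s ∈ Icc a b, HasDerivAt g (g' s) s ∧ |g' s| ≤ M) →
      |g a - g b| ≤ M * (b - a) := by
    intro a b hab hd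
    exact seg_bound hab (fun x hx => (hd x hx).1.continuousAt.continuousWithinAt)
      fun x hx => ⟨_, hd x (Ioo_subset_Icc_self hx)⟩
  rcases le_total a b with hab | hab
  · rw [uIcc_of_le hab] at hd
    rw [abs_sub_comm a b, abs_of_nonneg (sub_nonneg.2 hab)]
    exact key a b hab hd
  · rw [uIcc_of_ge hab] at hd
    rw [abs_of_nonneg (sub_nonneg.2 hab), abs_sub_comm]
    exact key b a hab hd

lemma mv2 {g g' g'' : ℝ → ℝ} {a d M : ℝ} (hd0 : 0 ≤ d)
    (h1 : ∀ s ∈ Icc (a - d) (a + d), HasDerivAt g (g' s) s)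
    (h2 : ∀ s ∈ Icc (a - d) (a + d), HasDerivAt g' (g'' s) s ∧ |g'' s| ≤ M) :
    |g (a - d) - 2 * g a + g (a + d)| ≤ M * d * d := by
  have key := mv1 (g := fun s => g s - g (s + d)) (g' := fun s => g' s - g' (s + d)) (a := a - d) (b := a)
    (M := M * d) (by
      intro s hs
      rw [uIcc_of_le (by linarith)] at hs
      refine ⟨?_, ?_⟩
      · refine (h1 s ⟨hs.1, by linarith [hs.2]⟩).sub ?_
        have := (h1 (s + d) ⟨by linarith [hs.1], by linarith [hs.2]⟩).comp_add_const s d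
        exact this
      · have := mv1 (g := g') (g' := g'') (a := s) (b := s + d) (M := M) (by
          intro x hx
          rw [uIcc_of_le (by linarith)] at hx
          exact h2 x ⟨by linarith [hs.1, hx.1], by linarith [hs.2, hx.2]⟩)
        rwa [sub_add_cancel_left, abs_neg, abs_of_nonneg hd0] at this)
  rw [sub_add_cancel, sub_sub_cancel_left, abs_neg, abs_of_nonneg hd0] at key
  convert key using 2
  ring

lemma lim_zero {k : ℕ} (hk : k ≠ 0) {D : ℝ → ℝ} {C r0 l : ℝ} (hr0 : 0 < r0)
    (hD : ∀ r, 0 < r → r < r0 → |D r| ≤ C) (hl : Tendsto (fun r => r ^ k * D r) (𝓝[>] 0) (𝓝 l)) :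
    l = 0 := by
  refine tendsto_nhds_unique hl ?_
  have h0 : Tendsto (fun r : ℝ => r ^ k * C) (𝓝[>] 0) (𝓝 0) := by
    have : Continuous (fun r : ℝ => r ^ k * C) := by fun_prop
    have := this.tendsto 0
    simp only [ne_eq, hk, not_false_eq_true, zero_pow, zero_mul] at this
    exact this.mono_left nhdsWithin_le_nhds
  refine squeeze_zero_norm' ?_ h0
  filter_upwards [Ioo_mem_nhdsGT hr0] with r hr
  rw [Real.norm_eq_abs, abs_mul, abs_of_pos (pow_pos hr.1 k)]
  exact mul_le_mul_of_nonneg_left (hD r hr.1 hr.2) (pow_pos hr.1 k).le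

/-- homogeneous blow-up of order `k` along a cone -/
def Blow (h : ℝ × ℝ → ℝ) (p : ℝ × ℝ) (s c : ℝ) (k : ℕ) : Prop :=
  ∀ x y : ℝ, |x| ≤ 1 → 1 ≤ y → y ≤ 3 →
    Tendsto (fun r => r ^ k * h (p.1 + r * x, p.2 + r * (s * y))) (𝓝[>] 0)
      (𝓝 (c * (1 / Real.sqrt (x ^ 2 + (s * y) ^ 2) ^ k)))

lemma blow_unbounded {Ω : Set (ℝ × ℝ)} (hΩ : IsOpen Ω) {h : ℝ × ℝ → ℝ} (hh : ContDiffOn ℝ (⊤ : ℕ∞) h Ω)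
    {p : ℝ × ℝ} {s r0 c : ℝ} {k : ℕ} (hk : k ≠ 0) (hc : 0 < c) (hC : Cone Ω p s r0) (hB : Blow h p s c k) :
    (¬∃ M, ∀ p ∈ Ω, |h p| ≤ M) ∧ (¬∃ M, ∀ p ∈ Ω, |pdx h p| ≤ M) ∧ (¬∃ M, ∀ p ∈ Ω, |pdy h p| ≤ M) ∧
    (¬∃ M, ∀ p ∈ Ω, |fxx h p| ≤ M) ∧ (¬∃ M, ∀ p ∈ Ω, |fxy h p| ≤ M) ∧
    (¬∃ M, ∀ p ∈ Ω, |fyy h p| ≤ M) := by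
  obtain ⟨hs, hr0, hC⟩ := hC
  set n : ℝ → ℝ → ℝ := fun x y => 1 / Real.sqrt (x ^ 2 + (s * y) ^ 2) ^ k with hn
  have hs2 : 0 < s ^ 2 := by positivity
  have ns : ∀ y : ℝ, 0 < y → n 0 y = (1 / y ^ k) * n 0 1 := by
    intro y hy
    simp only [hn, mul_one]
    have : Real.sqrt (0 ^ 2 + (s * y) ^ 2) = y * Real.sqrt (0 ^ 2 + s ^ 2) := by
      rw [show (0:ℝ) ^ 2 + (s * y) ^ 2 = y ^ 2 * (0 ^ 2 + s ^ 2) by ring,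
        Real.sqrt_mul (by positivity), Real.sqrt_sq hy.le]
    rw [this, mul_pow, one_div_mul_one_div]
  have n01 : 0 < n 0 1 := by
    simp only [hn]
    have : 0 < Real.sqrt (0 ^ 2 + (s * 1) ^ 2) := Real.sqrt_pos.2 (by positivity)
    positivity
  have nlt : n 1 1 < n 0 1 := by
    simp only [hn]
    have h0 : 0 < Real.sqrt (0 ^ 2 + (s * 1) ^ 2) := Real.sqrt_pos.2 (by positivity)
    refine one_div_lt_one_div_of_lt (by positivity) ?_
    refine pow_lt_pow_left₀ ?_ h0.le hk
    exact Real.sqrt_lt_sqrt (by positivity) (by linarith)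
  have nneg : n (-1) 1 = n 1 1 := by simp [hn]
  have two : (1 : ℝ) / 2 ^ k ≤ 1 / 2 := by
    refine one_div_le_one_div_of_le (by norm_num) ?_
    calc (2:ℝ) = 2 ^ 1 := by norm_num
      _ ≤ 2 ^ k := pow_le_pow_right₀ (by norm_num) (Nat.one_le_iff_ne_zero.2 hk)
  have n12 : 1 / 2 ^ k * n 1 1 ≤ n 1 2 := by
    simp only [hn]
    rw [one_div_mul_one_div, ← mul_pow]
    have h0 : 0 < Real.sqrt (1 ^ 2 + (s * 2) ^ 2) := Real.sqrt_pos.2 (by positivity)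
    refine one_div_le_one_div_of_le (by positivity) ?_
    refine pow_le_pow_left₀ h0.le ?_ k
    have : 2 * Real.sqrt (1 ^ 2 + (s * 1) ^ 2) = Real.sqrt (2 ^ 2 * (1 ^ 2 + (s * 1) ^ 2)) := by
      rw [Real.sqrt_mul (by positivity), Real.sqrt_sq (by norm_num)]
    rw [this]
    exact Real.sqrt_le_sqrt (by nlinarith)
  have three : (0 : ℝ) < 1 / 3 ^ k := by positivity
  have ab1 : |(1:ℝ)| ≤ 1 := by simp
  have ab0 : |(0:ℝ)| ≤ 1 := by simp
  have abm : |(-1:ℝ)| ≤ 1 := by simp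
  have hd : ∀ q ∈ Ω, DifferentiableAt ℝ h q := fun q hq => smooth_diff hΩ hh hq
  have hdx : ∀ q ∈ Ω, DifferentiableAt ℝ (pdx h) q := fun q hq => smooth_diff hΩ (smooth_pdx hΩ hh) hq
  have hdy : ∀ q ∈ Ω, DifferentiableAt ℝ (pdy h) q := fun q hq => smooth_diff hΩ (smooth_pdy hΩ hh) hq
  -- horizontal segments
  have hx : ∀ r x y : ℝ, 0 < r → r < r0 → 1 ≤ y → y ≤ 3 → x ∈ Icc (p.1 - r) (p.1 + r) →
      (x, p.2 + r * (s * y)) ∈ Ω := by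
    intro r x y hr hrr hy hy3 hx
    have := hC r ((x - p.1) / r) y hr hrr (by
      rw [abs_div, abs_of_pos hr, div_le_one hr, abs_le]
      constructor <;> linarith [hx.1, hx.2]) hy hy3
    rwa [mul_div_cancel₀ _ hr.ne', add_sub_cancel] at this
  have hy : ∀ r x y y1 y2 : ℝ, 0 < r → r < r0 → |x| ≤ 1 → 1 ≤ y1 → y1 ≤ y2 → y2 ≤ 3 →
      y ∈ uIcc (p.2 + r * (s * y1)) (p.2 + r * (s * y2)) → (p.1 + r * x, y) ∈ Ω := by
    intro r x y y1 y2 hr hrr hx h1 h12 h2 hyy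
    have hrs : r * s ≠ 0 := mul_ne_zero hr.ne' hs
    have e : y = p.2 + r * (s * ((y - p.2) / (r * s))) := by field_simp; ring
    have hb : (y - p.2) / (r * s) ∈ Icc y1 y2 := by
      rcases lt_or_gt_of_ne hs with hs' | hs'
      · rw [uIcc_of_ge (by nlinarith [mul_pos hr (neg_pos.2 hs')])] at hyy
        have hn : r * s < 0 := mul_neg_of_pos_of_neg hr hs'
        refine ⟨(le_div_iff_of_neg hn).2 (by linarith [hyy.2]), (div_le_iff_of_neg hn).2 (by linarith [hyy.1])⟩
      · rw [uIcc_of_le (by nlinarith [mul_pos hr hs'])] at hyy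
        have hn : 0 < r * s := mul_pos hr hs'
        refine ⟨(le_div_iff₀ hn).2 (by linarith [hyy.1]), (div_le_iff₀ hn).2 (by linarith [hyy.2])⟩
    rw [e]
    exact hC r x _ hr hrr hx (h1.trans hb.1) (hb.2.trans h2)
  refine ⟨?_, ?_, ?_, ?_, ?_, ?_⟩
  · rintro ⟨M, hM⟩
    have := lim_zero hk hr0 (fun r hr hr' => hM _ (hC r 0 1 hr hr' ab0 le_rfl (by norm_num)))
      (hB 0 1 ab0 le_rfl (by norm_num))
    have h2 : 0 < c * n 0 1 := mul_pos hc n01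
    exact h2.ne' this
  · rintro ⟨M, hM⟩
    have := lim_zero (C := M * r0) hk hr0 (D := fun r => h (p.1 + r * 1, p.2 + r * (s * 1)) - h (p.1 + r * 0, p.2 + r * (s * 1)))
      (fun r hr hr' => ?_)
      (((hB 1 1 ab1 le_rfl (by norm_num)).sub (hB 0 1 ab0 le_rfl (by norm_num))).congr fun r => by ring)
    · have h2 : 0 < c * (n 0 1 - n 1 1) := mul_pos hc (by linarith)
      simp only [hn] at h2
      linarith
    · have hM0 : 0 ≤ M := (abs_nonneg _).trans (hM _ (hC r 0 1 hr hr' ab0 le_rfl (by norm_num)))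
      have := mv1 (g := fun x => h (x, p.2 + r * (s * 1))) (g' := fun x => pdx h (x, p.2 + r * (s * 1)))
        (a := p.1 + r * 1) (b := p.1 + r * 0) (M := M) (by
          intro x hxx
          rw [uIcc_of_ge (by linarith)] at hxx
          have hm := hx r x 1 hr hr' le_rfl (by norm_num) ⟨by linarith [hxx.1], by linarith [hxx.2]⟩
          exact ⟨hasDerivAt_pdx (hd _ hm), hM _ hm⟩)
      refine this.trans ?_
      refine mul_le_mul_of_nonneg_left ?_ hM0
      rw [mul_one, mul_zero, add_sub_add_left_eq_sub, sub_zero, abs_of_pos hr]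
      exact hr'.le
  · rintro ⟨M, hM⟩
    have := lim_zero (C := M * (r0 * |s|)) hk hr0 (D := fun r => h (p.1 + r * 0, p.2 + r * (s * 1)) - h (p.1 + r * 0, p.2 + r * (s * 2)))
      (fun r hr hr' => ?_)
      (((hB 0 1 ab0 le_rfl (by norm_num)).sub (hB 0 2 ab0 (by norm_num) (by norm_num))).congr fun r => by ring)
    · have h2 : 0 < c * (n 0 1 - n 0 2) := mul_pos hc (by rw [ns 2 (by norm_num)]; nlinarith)
      simp only [hn] at h2
      linarith
    · have hM0 : 0 ≤ M := (abs_nonneg _).trans (hM _ (hC r 0 1 hr hr' ab0 le_rfl (by norm_num)))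
      have := mv1 (g := fun y => h (p.1 + r * 0, y)) (g' := fun y => pdy h (p.1 + r * 0, y))
        (a := p.2 + r * (s * 1)) (b := p.2 + r * (s * 2)) (M := M) (by
          intro y hyy
          have hm := hy r 0 y 1 2 hr hr' ab0 le_rfl (by norm_num) (by norm_num) hyy
          exact ⟨hasDerivAt_pdy (hd _ hm), hM _ hm⟩)
      refine this.trans ?_
      refine mul_le_mul_of_nonneg_left ?_ hM0
      rw [show p.2 + r * (s * 1) - (p.2 + r * (s * 2)) = -(r * s) by ring, abs_neg, abs_mul, abs_of_pos hr]
      gcongr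
  · rintro ⟨M, hM⟩
    have := lim_zero (C := M * r0 * r0) hk hr0 (D := fun r => h (p.1 + r * (-1), p.2 + r * (s * 1)) - 2 * h (p.1 + r * 0, p.2 + r * (s * 1)) + h (p.1 + r * 1, p.2 + r * (s * 1)))
      (fun r hr hr' => ?_)
      ((((hB (-1) 1 abm le_rfl (by norm_num)).sub ((hB 0 1 ab0 le_rfl (by norm_num)).const_mul 2)).add
        (hB 1 1 ab1 le_rfl (by norm_num))).congr fun r => by ring)
    · have h2 : 0 < c * (n 0 1 - n 1 1) := mul_pos hc (by linarith)
      have h3 : n (-1) 1 = n 1 1 := nneg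
      simp only [hn] at h2 h3
      rw [h3] at this
      linarith
    · have hM0 : 0 ≤ M := (abs_nonneg _).trans (hM _ (hC r 0 1 hr hr' ab0 le_rfl (by norm_num)))
      have := mv2 (g := fun x => h (x, p.2 + r * (s * 1))) (g' := fun x => pdx h (x, p.2 + r * (s * 1)))
        (g'' := fun x => fxx h (x, p.2 + r * (s * 1)))
        (a := p.1) (d := r) (M := M) hr.le (fun x hxx => hasDerivAt_pdx (hd _ (hx r x 1 hr hr' le_rfl (by norm_num) hxx)))
        (fun x hxx => ⟨hasDerivAt_pdx (hdx _ (hx r x 1 hr hr' le_rfl (by norm_num) hxx)),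
          hM _ (hx r x 1 hr hr' le_rfl (by norm_num) hxx)⟩)
      simp only [mul_neg, mul_one, mul_zero, add_zero, ← sub_eq_add_neg] at this ⊢
      refine this.trans ?_
      gcongr
  · rintro ⟨M, hM⟩
    have := lim_zero (C := M * (r0 * |s|) * r0) hk hr0 (D := fun r => (h (p.1 + r * 1, p.2 + r * (s * 1)) - h (p.1 + r * 1, p.2 + r * (s * 2))) - (h (p.1 + r * 0, p.2 + r * (s * 1)) - h (p.1 + r * 0, p.2 + r * (s * 2))))
      (fun r hr hr' => ?_)
      ((((hB 1 1 ab1 le_rfl (by norm_num)).sub (hB 1 2 ab1 (by norm_num) (by norm_num))).sub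
        ((hB 0 1 ab0 le_rfl (by norm_num)).sub (hB 0 2 ab0 (by norm_num) (by norm_num)))).congr fun r => by ring)
    · have h2 : 0 < c * ((n 0 1 - n 0 2) - (n 1 1 - n 1 2)) := mul_pos hc (by
        rw [ns 2 (by norm_num)]; nlinarith)
      simp only [hn] at h2
      linarith
    · have hM0 : 0 ≤ M := (abs_nonneg _).trans (hM _ (hC r 0 1 hr hr' ab0 le_rfl (by norm_num)))
      have := mv1 (g := fun x => h (x, p.2 + r * (s * 1)) - h (x, p.2 + r * (s * 2)))
        (g' := fun x => pdx h (x, p.2 + r * (s * 1)) - pdx h (x, p.2 + r * (s * 2)))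
        (a := p.1 + r * 1) (b := p.1 + r * 0) (M := M * (r * |s|)) (by
          intro x hxx
          rw [uIcc_of_ge (by linarith)] at hxx
          have hxx' : x ∈ Icc (p.1 - r) (p.1 + r) := ⟨by linarith [hxx.1], by linarith [hxx.2]⟩
          have hm1 := hx r x 1 hr hr' le_rfl (by norm_num) hxx'
          have hm2 := hx r x 2 hr hr' (by norm_num) (by norm_num) hxx'
          refine ⟨(hasDerivAt_pdx (hd _ hm1)).sub (hasDerivAt_pdx (hd _ hm2)), ?_⟩
          have e : x = p.1 + r * ((x - p.1) / r) := by field_simp; ring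
          have ha : |(x - p.1) / r| ≤ 1 := by
            rw [abs_div, abs_of_pos hr, div_le_one hr, abs_le]
            constructor <;> linarith [hxx'.1, hxx'.2]
          have := mv1 (g := fun y => pdx h (x, y)) (g' := fun y => fxy h (x, y))
            (a := p.2 + r * (s * 1)) (b := p.2 + r * (s * 2)) (M := M) (by
              intro y hyy
              have hm := hy r _ y 1 2 hr hr' ha le_rfl (by norm_num) (by norm_num) hyy
              rw [← e] at hm
              exact ⟨hasDerivAt_pdy (hdx _ hm), hM _ hm⟩)
          rwa [show p.2 + r * (s * 1) - (p.2 + r * (s * 2)) = -(r * s) by ring, abs_neg, abs_mul, abs_of_pos hr] at this)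
      refine this.trans ?_
      rw [mul_one, mul_zero, add_sub_add_left_eq_sub, sub_zero, abs_of_pos hr]
      gcongr
  · rintro ⟨M, hM⟩
    have := lim_zero (C := M * (r0 * |s|) * (r0 * |s|)) hk hr0 (D := fun r => h (p.1 + r * 0, p.2 + r * (s * 1)) - 2 * h (p.1 + r * 0, p.2 + r * (s * 2)) + h (p.1 + r * 0, p.2 + r * (s * 3)))
      (fun r hr hr' => ?_)
      ((((hB 0 1 ab0 le_rfl (by norm_num)).sub ((hB 0 2 ab0 (by norm_num) (by norm_num)).const_mul 2)).add
        (hB 0 3 ab0 (by norm_num) le_rfl)).congr fun r => by ring)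
    · have h2 : 0 < c * (n 0 1 - 2 * n 0 2 + n 0 3) := mul_pos hc (by
        rw [ns 2 (by norm_num), ns 3 (by norm_num)]
        nlinarith [mul_pos three n01])
      simp only [hn] at h2
      linarith
    · have hM0 : 0 ≤ M := (abs_nonneg _).trans (hM _ (hC r 0 1 hr hr' ab0 le_rfl (by norm_num)))
      have hmem : ∀ y ∈ Icc (p.2 + r * (s * 2) - r * |s|) (p.2 + r * (s * 2) + r * |s|), (p.1 + r * 0, y) ∈ Ω := by
        intro y hyy
        refine hy r 0 y 1 3 hr hr' ab0 le_rfl (by norm_num) le_rfl ?_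
        rcases lt_or_gt_of_ne hs with hs' | hs'
        · rw [abs_of_neg hs'] at hyy
          rw [uIcc_of_ge (by nlinarith [mul_pos hr (neg_pos.2 hs')])]
          constructor <;> linarith [hyy.1, hyy.2]
        · rw [abs_of_pos hs'] at hyy
          rw [uIcc_of_le (by nlinarith [mul_pos hr hs'])]
          constructor <;> linarith [hyy.1, hyy.2]
      have := mv2 (g := fun y => h (p.1 + r * 0, y)) (g' := fun y => pdy h (p.1 + r * 0, y))
        (g'' := fun y => fyy h (p.1 + r * 0, y))
        (a := p.2 + r * (s * 2)) (d := r * |s|) (M := M) (by positivity)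
        (fun y hyy => hasDerivAt_pdy (hd _ (hmem y hyy)))
        (fun y hyy => ⟨hasDerivAt_pdy (hdy _ (hmem y hyy)), hM _ (hmem y hyy)⟩)
      have e2 : ∀ A : ℝ → ℝ, A (p.2 + r * (s * 2) - r * |s|) + A (p.2 + r * (s * 2) + r * |s|) =
          A (p.2 + r * (s * 1)) + A (p.2 + r * (s * 3)) := by
        intro A
        rcases lt_or_gt_of_ne hs with hs' | hs'
        · rw [abs_of_neg hs', add_comm]
          congr 2 <;> ring
        · rw [abs_of_pos hs']
          congr 2 <;> ring
      have e3 := e2 (fun y => h (p.1 + r * 0, y))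
      beta_reduce at this e3
      calc _ = _ := by congr 1; linarith
        _ ≤ _ := this
        _ ≤ _ := by gcongr

lemma cr_diff {u w : ℝ × ℝ → ℝ} {z : ℂ} (hu : DifferentiableAt ℝ u (z.re, z.im))
    (hw : DifferentiableAt ℝ w (z.re, z.im)) (h1 : pdy u (z.re, z.im) = pdx w (z.re, z.im))
    (h2 : pdy w (z.re, z.im) = -pdx u (z.re, z.im)) :
    DifferentiableAt ℂ (fun z : ℂ => (u (z.re, z.im) : ℂ) - Complex.I * (w (z.re, z.im) : ℂ)) z := by
  rw [pdy_eq hu, pdx_eq hw] at h1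
  rw [pdy_eq hw, pdx_eq hu] at h2
  have hP : HasFDerivAt (fun z : ℂ => (z.re, z.im)) (Complex.reCLM.prod Complex.imCLM) z :=
    (Complex.reCLM.prod Complex.imCLM).hasFDerivAt
  have hu' := Complex.ofRealCLM.hasFDerivAt.comp z (HasFDerivAt.comp (f := fun z : ℂ => (z.re, z.im)) z hu.hasFDerivAt hP)
  have hw' := (Complex.ofRealCLM.hasFDerivAt.comp z (HasFDerivAt.comp (f := fun z : ℂ => (z.re, z.im)) z hw.hasFDerivAt hP)).const_mul Complex.I
  have h := hu'.sub hw'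
  rw [differentiableAt_complex_iff_differentiableAt_real]
  have h' : HasFDerivAt (fun z : ℂ => (u (z.re, z.im) : ℂ) - Complex.I * (w (z.re, z.im) : ℂ)) _ z := h
  refine ⟨h'.differentiableAt, ?_⟩
  rw [h'.fderiv]
  simp [h1, h2]
  ring_nf
  simp [Complex.I_sq]

lemma blow_exists {U Ω : Set (ℝ × ℝ)} (hΩ : IsOpen Ω) (hU : IsOpen U) {g : ℝ × ℝ → ℝ}
    (hg : AnalyticOnNhd ℝ g U) (hsub : closure Ω ⊆ U) (harm : ∀ p ∈ Ω, fxx g p + fyy g p = 0)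
    (hne : ∀ p ∈ Ω, ¬(fxx g p = 0 ∧ fxy g p = 0)) {p0 : ℝ × ℝ} (hp : p0 ∈ closure Ω)
    (h0 : fxx g p0 = 0 ∧ fxy g p0 = 0) :
    ∃ k : ℕ, k ≠ 0 ∧ ∃ c : ℝ, 0 < c ∧ ∀ a b : ℝ, 0 < a ^ 2 + b ^ 2 →
      Tendsto (fun r => r ^ k * (1 / Real.sqrt (fxx g (p0.1 + r * a, p0.2 + r * b) ^ 2
        + fxy g (p0.1 + r * a, p0.2 + r * b) ^ 2))) (𝓝[>] 0)
        (𝓝 (c * (1 / Real.sqrt (a ^ 2 + b ^ 2) ^ k))) := by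
  obtain ⟨δ, hδ, hball⟩ := Metric.isOpen_iff.1 hU p0 (hsub hp)
  set B := Metric.ball p0 δ with hBdef
  have hBo : IsOpen B := Metric.isOpen_ball
  have hgB : AnalyticOnNhd ℝ g B := hg.mono hball
  have hsm : ContDiffOn ℝ (⊤ : ℕ∞) g B := hgB.contDiffOn_of_completeSpace
  have axx : AnalyticOnNhd ℝ (fxx g) B := analytic_pdx hBo (analytic_pdx hBo hgB)
  have axy : AnalyticOnNhd ℝ (fxy g) B := analytic_pdy hBo (analytic_pdx hBo hgB)
  have ayy : AnalyticOnNhd ℝ (fyy g) B := analytic_pdy hBo (analytic_pdy hBo hgB)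
  obtain ⟨q0, hq0B, hq0Ω⟩ := mem_closure_iff.1 hp B hBo (Metric.mem_ball_self hδ)
  have lap : EqOn (fun p => fxx g p + fyy g p) 0 B := by
    refine (axx.add ayy).eqOn_zero_of_preconnected_of_eventuallyEq_zero
      (convex_ball p0 δ).isPreconnected hq0B ?_
    filter_upwards [hΩ.mem_nhds hq0Ω] with p hp using harm p hp
  have eyy : EqOn (fyy g) (fun p => fxx g p * (-1)) B := fun p hp => by
    have := lap hp
    simp only [Pi.zero_apply] at this
    linarith
  -- Cauchy-Riemann
  have c1 : EqOn (pdy (fxx g)) (pdx (fxy g)) B := pd_symm hBo (smooth_pdx hBo hsm)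
  have c2 : EqOn (pdy (fxy g)) (fun p => -pdx (fxx g) p) B := by
    intro p hp
    have s1 : EqOn (fxy g) (pdx (pdy g)) B := pd_symm hBo hsm
    rw [pdy_congr hBo s1 hp, pd_symm hBo (smooth_pdy hBo hsm) hp]
    have := pdx_congr hBo eyy hp
    rw [pdx_mul_const] at this
    change pdx (fyy g) p = _
    rw [this]; ring
  set φ : ℂ → ℂ := fun z => (fxx g (z.re, z.im) : ℂ) - Complex.I * (fxy g (z.re, z.im) : ℂ) with hφ
  set z0 : ℂ := ⟨p0.1, p0.2⟩ with hz0
  have hcP : Continuous (fun z : ℂ => (z.re, z.im)) := by fun_prop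
  set V : Set ℂ := (fun z : ℂ => (z.re, z.im)) ⁻¹' B with hV
  have hVo : IsOpen V := hBo.preimage hcP
  have hz0V : z0 ∈ V := by
    simp only [hV, hz0, mem_preimage]; exact Metric.mem_ball_self hδ
  have hφd : DifferentiableOn ℂ φ V := fun z hz =>
    (cr_diff (axx _ hz).differentiableAt (axy _ hz).differentiableAt (c1 hz) (c2 hz)).differentiableWithinAt
  have hφa : AnalyticAt ℂ φ z0 := hφd.analyticAt (hVo.mem_nhds hz0V)
  have hnorm : ∀ z : ℂ, ‖φ z‖ = Real.sqrt (fxx g (z.re, z.im) ^ 2 + fxy g (z.re, z.im) ^ 2) := by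
    intro z
    rw [Complex.norm_def, Complex.normSq_apply]
    congr 1
    simp [hφ]
    ring
  have hnz : ¬∀ᶠ z in 𝓝 z0, φ z = 0 := by
    intro h
    have hcQ : Continuous (fun p : ℝ × ℝ => (⟨p.1, p.2⟩ : ℂ)) :=
      Complex.equivRealProdCLM.symm.continuous.congr fun p => by
        rfl
    have h2 : ∀ᶠ p in 𝓝 p0, φ ⟨p.1, p.2⟩ = 0 := hcQ.continuousAt.eventually h
    obtain ⟨W, hW, hWo, hpW⟩ := eventually_nhds_iff.1 h2
    obtain ⟨q, hqW, hqΩ⟩ := mem_closure_iff.1 hp W hWo hpW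
    have h3 := hnorm ⟨q.1, q.2⟩
    rw [hW q hqW, norm_zero] at h3
    have h4 := (Real.sqrt_eq_zero (by positivity)).1 h3.symm
    refine hne q hqΩ ⟨?_, ?_⟩
    · have : fxx g q ^ 2 = 0 := by
        change fxx g q ^ 2 + fxy g q ^ 2 = 0 at h4
        nlinarith [sq_nonneg (fxx g q), sq_nonneg (fxy g q)]
      exact pow_eq_zero_iff (by norm_num) |>.1 this
    · have : fxy g q ^ 2 = 0 := by
        change fxx g q ^ 2 + fxy g q ^ 2 = 0 at h4
        nlinarith [sq_nonneg (fxx g q), sq_nonneg (fxy g q)]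
      exact pow_eq_zero_iff (by norm_num) |>.1 this
  obtain ⟨k, ψ, hψa, hψ0, hψ⟩ := hφa.exists_eventuallyEq_pow_smul_nonzero_iff.2 hnz
  refine ⟨k, ?_, 1 / ‖ψ z0‖, by positivity, ?_⟩
  · rintro rfl
    have h1 := hψ.self_of_nhds
    simp only [pow_zero, one_smul] at h1
    have h2 := hnorm z0
    simp only [hz0] at h2
    rw [h0.1, h0.2] at h2
    simp at h2
    exact hψ0 (h1 ▸ h2)
  · intro a b hab
    set e : ℂ := ⟨a, b⟩ with he
    have hen : ‖e‖ = Real.sqrt (a ^ 2 + b ^ 2) := by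
      rw [Complex.norm_def, Complex.normSq_apply]; congr 1; simp [he]; ring
    have hepos : 0 < ‖e‖ := by rw [hen]; exact Real.sqrt_pos.2 hab
    have hline : Continuous (fun r : ℝ => z0 + (r : ℂ) * e) := by fun_prop
    have hl0 : Tendsto (fun r : ℝ => z0 + (r : ℂ) * e) (𝓝[>] 0) (𝓝 z0) := by
      have := hline.tendsto 0
      simp only [Complex.ofReal_zero, zero_mul, add_zero] at this
      exact this.mono_left nhdsWithin_le_nhds
    have hψt : Tendsto (fun r : ℝ => 1 / ‖ψ (z0 + (r : ℂ) * e)‖ * (1 / ‖e‖ ^ k)) (𝓝[>] 0)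
        (𝓝 (1 / ‖ψ z0‖ * (1 / ‖e‖ ^ k))) := by
      refine Tendsto.mul_const _ ?_
      simp only [one_div]
      exact ((hψa.continuousAt.tendsto.comp hl0).norm).inv₀ (norm_ne_zero_iff.2 hψ0)
    rw [← hen]
    refine hψt.congr' ?_
    filter_upwards [hl0.eventually hψ, self_mem_nhdsWithin] with r hr hrpos
    have hrpos : 0 < r := hrpos
    have h1 := hnorm (z0 + (r : ℂ) * e)
    have e1 : ((z0 + (r : ℂ) * e).re, (z0 + (r : ℂ) * e).im) = (p0.1 + r * a, p0.2 + r * b) := by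
      simp [hz0, he]
    rw [e1] at h1
    rw [← h1, hr]
    simp only [add_sub_cancel_left, smul_eq_mul, norm_mul, norm_pow, Complex.norm_real, Real.norm_eq_abs, abs_of_pos hrpos]
    have : r ^ k ≠ 0 := by positivity
    rw [mul_pow]
    field_simp

lemma norm_junk {Ω : Set (ℝ × ℝ)} (hb : Bornology.IsBounded Ω) (hn : Ω.Nonempty) {h : ℝ × ℝ → ℝ}
    (H : (¬∃ M, ∀ p ∈ Ω, |h p| ≤ M) ∧ (¬∃ M, ∀ p ∈ Ω, |pdx h p| ≤ M) ∧ (¬∃ M, ∀ p ∈ Ω, |pdy h p| ≤ M) ∧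
    (¬∃ M, ∀ p ∈ Ω, |fxx h p| ≤ M) ∧ (¬∃ M, ∀ p ∈ Ω, |fxy h p| ≤ M) ∧
    (¬∃ M, ∀ p ∈ Ω, |fyy h p| ≤ M)) : C2halfNorm h Ω = 0 := by
  have k1 : ∀ u : ℝ × ℝ → ℝ, (¬∃ M, ∀ p ∈ Ω, |u p| ≤ M) → C0norm u Ω = 0 := by
    intro u hu
    refine Real.sSup_of_not_bddAbove ?_
    rintro ⟨M, hM⟩
    exact hu ⟨M, fun p hp => hM ⟨p, hp, rfl⟩⟩
  have k2 : ∀ u : ℝ × ℝ → ℝ, (¬∃ M, ∀ p ∈ Ω, |u p| ≤ M) → holderSemi u Ω = 0 := by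
    intro u hu
    refine Real.sSup_of_not_bddAbove ?_
    rintro ⟨M, hM⟩
    obtain ⟨p1, hp1⟩ := hn
    obtain ⟨R, hR⟩ := hb.exists_norm_le
    refine hu ⟨|u p1| + |M| * (2 * R) ^ ((1:ℝ)/2), fun p hp => ?_⟩
    rcases eq_or_ne p p1 with rfl | hne
    · have : 0 ≤ R := (norm_nonneg _).trans (hR p hp)
      have : 0 ≤ |M| * (2 * R) ^ ((1:ℝ)/2) := by positivity
      linarith
    · have h1 := hM ⟨p, hp, p1, hp1, hne, rfl⟩
      have hpos : 0 < ‖p - p1‖ ^ ((1 : ℝ) / 2) := Real.rpow_pos_of_pos (norm_pos_iff.2 (sub_ne_zero.2 hne)) _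
      rw [div_le_iff₀ hpos] at h1
      have h2 : ‖p - p1‖ ≤ 2 * R := by
        have := norm_sub_le p p1
        linarith [hR p hp, hR p1 hp1]
      have h3 : ‖p - p1‖ ^ ((1 : ℝ) / 2) ≤ (2 * R) ^ ((1 : ℝ) / 2) :=
        Real.rpow_le_rpow (norm_nonneg _) h2 (by norm_num)
      have h4 : M * ‖p - p1‖ ^ ((1 : ℝ) / 2) ≤ |M| * (2 * R) ^ ((1 : ℝ) / 2) :=
        mul_le_mul (le_abs_self _) h3 hpos.le (abs_nonneg _)
      have h5 : |u p| ≤ |u p1| + |u p - u p1| := by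
        have := abs_add_le (u p1) (u p - u p1)
        rwa [add_sub_cancel] at this
      linarith
  obtain ⟨h1, h2, h3, h4, h5, h6⟩ := H
  unfold C2halfNorm C2norm
  rw [k1 _ h1, k1 _ h2, k1 _ h3, k1 _ h4, k1 _ h5, k1 _ h6, k2 _ h4, k2 _ h5, k2 _ h6]
  simp

lemma degenerate_norm {U Ω : Set (ℝ × ℝ)} (hΩ : IsAnalyticJordanDomain Ω) (hU : IsOpen U) {g : ℝ × ℝ → ℝ}
    (hg : AnalyticOnNhd ℝ g U) (hsub : closure Ω ⊆ U) (harm : ∀ p ∈ Ω, fxx g p + fyy g p = 0)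
    (hne : ∀ p ∈ Ω, ¬(fxx g p = 0 ∧ fxy g p = 0)) {p0 : ℝ × ℝ} (hp : p0 ∈ closure Ω)
    (h0 : fxx g p0 = 0 ∧ fxy g p0 = 0) :
    C2halfNorm (fun p => 1 / Real.sqrt (fxx g p ^ 2 + fxy g p ^ 2)) Ω = 0 := by
  obtain ⟨k, hk, c, hc, hlim⟩ := blow_exists hΩ.1 hU hg hsub harm hne hp h0
  have hfr : p0 ∈ frontier Ω := by
    rw [hΩ.1.frontier_eq]
    exact ⟨hp, fun h => hne p0 h h0⟩
  set H : ℝ × ℝ → ℝ := fun p => 1 / Real.sqrt (fxx g p ^ 2 + fxy g p ^ 2) with hH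
  have hpos : ∀ p ∈ Ω, 0 < fxx g p ^ 2 + fxy g p ^ 2 := by
    intro p hp
    by_contra hcon
    refine hne p hp ⟨?_, ?_⟩
    · have : fxx g p ^ 2 = 0 := by nlinarith [sq_nonneg (fxx g p), sq_nonneg (fxy g p)]
      exact pow_eq_zero_iff (by norm_num) |>.1 this
    · have : fxy g p ^ 2 = 0 := by nlinarith [sq_nonneg (fxx g p), sq_nonneg (fxy g p)]
      exact pow_eq_zero_iff (by norm_num) |>.1 this
  have hsm : ContDiffOn ℝ (⊤ : ℕ∞) g Ω :=
    (hg.contDiffOn_of_completeSpace (n := (⊤ : ℕ∞))).mono (subset_closure.trans hsub)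
  have hHs : ContDiffOn ℝ (⊤ : ℕ∞) H Ω := by
    have sxx : ContDiffOn ℝ (⊤ : ℕ∞) (fxx g) Ω := smooth_pdx hΩ.1 (smooth_pdx hΩ.1 hsm)
    have sxy : ContDiffOn ℝ (⊤ : ℕ∞) (fxy g) Ω := smooth_pdy hΩ.1 (smooth_pdx hΩ.1 hsm)
    refine ContDiffOn.div contDiffOn_const (((sxx.pow 2).add (sxy.pow 2)).sqrt ?_) ?_
    · intro p hp; exact (hpos p hp).ne'
    · intro p hp; exact (Real.sqrt_pos.2 (hpos p hp)).ne'
  refine norm_junk hΩ.2.1 hΩ.2.2.1.nonempty ?_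
  rcases cone_exists hΩ hfr with ⟨s, r0, hC⟩ | ⟨s, r0, hC⟩
  · refine blow_unbounded hΩ.1 hHs hk hc hC ?_
    intro x y hx hy hy3
    have hs := hC.1
    exact hlim x (s * y) (by positivity)
  · have hopen : IsOpen (Prod.swap ⁻¹' Ω) := hΩ.1.preimage continuous_swap
    have hsw : ContDiffOn ℝ (⊤ : ℕ∞) (fun p : ℝ × ℝ => H p.swap) (Prod.swap ⁻¹' Ω) :=
      hHs.comp (f := Prod.swap) (contDiff_snd.prodMk contDiff_fst).contDiffOn (fun p hp => hp)
    obtain ⟨b1, b2, b3, b4, b5, b6⟩ := blow_unbounded hopen hsw hk hc hC (by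
      intro x y hx hy hy3
      have hs := hC.1
      have := hlim (s * y) x (by positivity)
      rw [add_comm (x ^ 2)]
      exact this)
    have tr : ∀ u v : ℝ × ℝ → ℝ, (∀ q ∈ Ω, v q.swap = u q) → (¬∃ M, ∀ p ∈ Prod.swap ⁻¹' Ω, |v p| ≤ M) →
        ¬∃ M, ∀ p ∈ Ω, |u p| ≤ M := by
      rintro u v huv hv ⟨M, hM⟩
      refine hv ⟨M, fun p hp => ?_⟩
      have := huv p.swap hp
      rw [Prod.swap_swap] at this
      rw [this]
      exact hM _ hp
    refine ⟨tr _ _ (fun q hq => rfl) b1, tr _ _ (fun q hq => rfl) b3, tr _ _ (fun q hq => rfl) b2,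
      tr _ _ (fun q hq => rfl) b6, tr _ _ (fun q hq => ?_) b5, tr _ _ (fun q hq => rfl) b4⟩
    exact (pd_symm hΩ.1 hHs hq).symm

lemma lower_bound {Ω : Set (ℝ × ℝ)} (hΩ : IsAnalyticJordanDomain Ω)
    {f : ℕ → ℝ × ℝ → ℝ}
    (hharm : ∀ p ∈ Ω, fxx (f 0) p + fyy (f 0) p = 0)
    (hana : AnalyticOnClosed (f 0) (closure Ω))
    (hhess : ∀ p ∈ closure Ω, ¬(fxx (f 0) p = 0 ∧ fxy (f 0) p = 0 ∧ fyy (f 0) p = 0))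
    (hseq : IsPoissonSeq Ω f)
    (CΩ : ℝ)
    (hbound : C2halfNorm (f 1) Ω ≤ CΩ *
        C2halfNorm (fun p => 1 / Real.sqrt
          (-(fxx (f 0) p * fyy (f 0) p - (fxy (f 0) p) ^ 2))) Ω *
        (C2halfNorm (f 0) Ω * C2halfNorm (f 0) Ω)) :
    ∃ c > 0, ∀ p ∈ Ω, c ≤ Real.sqrt ((fxy (f 0) p) ^ 2 - fxx (f 0) p * fyy (f 0) p) := by
  obtain ⟨U, g, hU, hsub, hg, he⟩ := hana
  have heΩ : EqOn (f 0) g Ω := he.mono subset_closure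
  have exx : EqOn (fxx (f 0)) (fxx g) Ω := pdx_congr hΩ.1 (pdx_congr hΩ.1 heΩ)
  have exy : EqOn (fxy (f 0)) (fxy g) Ω := pdy_congr hΩ.1 (pdx_congr hΩ.1 heΩ)
  have eyy : EqOn (fyy (f 0)) (fyy g) Ω := pdy_congr hΩ.1 (pdy_congr hΩ.1 heΩ)
  have harm : ∀ p ∈ Ω, fxx g p + fyy g p = 0 := fun p hp => by
    rw [← exx hp, ← eyy hp]; exact hharm p hp
  have hne : ∀ p ∈ Ω, ¬(fxx g p = 0 ∧ fxy g p = 0) := by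
    rintro p hp ⟨h1, h2⟩
    refine hhess p (subset_closure hp) ⟨(exx hp).trans h1, (exy hp).trans h2, (eyy hp).trans ?_⟩
    have := harm p hp
    rw [h1] at this; linarith
  have hpos : ∀ p ∈ Ω, 0 < fxx g p ^ 2 + fxy g p ^ 2 := by
    intro p hp
    by_contra hcon
    refine hne p hp ⟨?_, ?_⟩
    · have : fxx g p ^ 2 = 0 := by nlinarith [sq_nonneg (fxx g p), sq_nonneg (fxy g p)]
      exact pow_eq_zero_iff (by norm_num) |>.1 this
    · have : fxy g p ^ 2 = 0 := by nlinarith [sq_nonneg (fxx g p), sq_nonneg (fxy g p)]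
      exact pow_eq_zero_iff (by norm_num) |>.1 this
  have hQ : ∀ p ∈ Ω, (fxy (f 0) p) ^ 2 - fxx (f 0) p * fyy (f 0) p = fxx g p ^ 2 + fxy g p ^ 2 := by
    intro p hp
    rw [exx hp, exy hp, eyy hp, show fyy g p = -fxx g p by linarith [harm p hp]]
    ring
  have hcl : ∀ p ∈ closure Ω, 0 < fxx g p ^ 2 + fxy g p ^ 2 := by
    intro p0 hp0
    by_contra hcon
    have z1 : fxx g p0 = 0 := by
      have : fxx g p0 ^ 2 = 0 := by nlinarith [sq_nonneg (fxx g p0), sq_nonneg (fxy g p0)]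
      exact pow_eq_zero_iff (by norm_num) |>.1 this
    have z2 : fxy g p0 = 0 := by
      have : fxy g p0 ^ 2 = 0 := by nlinarith [sq_nonneg (fxx g p0), sq_nonneg (fxy g p0)]
      exact pow_eq_zero_iff (by norm_num) |>.1 this
    have hz := degenerate_norm hΩ hU hg hsub harm hne hp0 ⟨z1, z2⟩
    have e : EqOn (fun p => 1 / Real.sqrt (-(fxx (f 0) p * fyy (f 0) p - (fxy (f 0) p) ^ 2)))
        (fun p => 1 / Real.sqrt (fxx g p ^ 2 + fxy g p ^ 2)) Ω := by
      intro p hp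
      simp only
      rw [neg_sub, hQ p hp]
    rw [C2halfNorm_congr hΩ.1 e, hz, mul_zero, zero_mul] at hbound
    have hn1 : C2halfNorm (f 1) Ω = 0 := le_antisymm hbound (C2halfNorm_nonneg _ _)
    obtain ⟨hs1, -, hP⟩ := hseq 1 le_rfl
    have hBd := Bd_norm hΩ (nice_of_closed hs1)
    rw [hn1] at hBd
    obtain ⟨q, hq⟩ := hΩ.2.2.1.nonempty
    obtain ⟨-, -, -, a1, -, a2⟩ := hBd.1 q hq
    have b1 := abs_nonpos_iff.1 a1
    have b2 := abs_nonpos_iff.1 a2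
    have hPq := hP q hq
    rw [b1, b2, poissonRHS] at hPq
    simp at hPq
    have hq0 := hpos q hq
    rw [← pow_two, hQ q hq] at hPq
    have : 0 < Real.sqrt (fxx g q ^ 2 + fxy g q ^ 2) := Real.sqrt_pos.2 hq0
    exact (div_pos hq0 this).ne hPq
  have hcont : ContinuousOn (fun p => fxx g p ^ 2 + fxy g p ^ 2) (closure Ω) := by
    have c1 : ContinuousOn (fxx g) (closure Ω) := (analytic_pdx hU (analytic_pdx hU hg)).continuousOn.mono hsub
    have c2 : ContinuousOn (fxy g) (closure Ω) := (analytic_pdy hU (analytic_pdx hU hg)).continuousOn.mono hsub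
    exact (c1.pow 2).add (c2.pow 2)
  obtain ⟨p1, hp1, hmin⟩ := hΩ.2.1.isCompact_closure.exists_isMinOn hΩ.2.2.1.nonempty.closure hcont
  refine ⟨Real.sqrt (fxx g p1 ^ 2 + fxy g p1 ^ 2), Real.sqrt_pos.2 (hcl p1 hp1), fun p hp => ?_⟩
  rw [hQ p hp]
  exact Real.sqrt_le_sqrt (hmin (subset_closure hp))

lemma rec_coeff (X Y Z : ℕ → ℝ) (q : ℝ) (hq : 0 < q) (hq2 : q ^ 2 = Z 0 ^ 2 - X 0 * Y 0)
    (hL0 : X 0 + Y 0 = 0)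
    (hL : ∀ m : ℕ, 1 ≤ m → X m + Y m =
      ((m : ℝ) * ∑ r ∈ Finset.range m, ((m - 1).choose r : ℝ) *
        (Z r * Z (m - r - 1) - X r * Y (m - r - 1))
        - (1 / ((m : ℝ) + 1)) * ∑ r ∈ Finset.Icc 2 (m - 1), ((m + 1).choose r : ℝ) *
          (X r + Y r) * (X (m - r + 1) + Y (m - r + 1)))
        / ((2 : ℝ) ^ (1 - (if m = 1 then 1 else 0) : ℕ) * q))
    (l : ℕ → ℝ) (hl : ∀ m, l m = (X m + Y m) / (m.factorial : ℝ)) :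
    l 0 = 0 ∧ l 1 = q ∧ ∀ n : ℕ, ∑ r ∈ Finset.range (n + 3), l r * l (n + 2 - r) =
      ∑ r ∈ Finset.range (n + 1), (Z r / (r.factorial : ℝ) * (Z (n - r) / ((n - r).factorial : ℝ)) -
        X r / (r.factorial : ℝ) * (Y (n - r) / ((n - r).factorial : ℝ))) := by
  have l0 : l 0 = 0 := by rw [hl, hL0, zero_div]
  have l1 : l 1 = q := by
    rw [hl, hL 1 le_rfl]
    simp
    rw [← pow_two, ← hq2, pow_two, mul_div_assoc, div_self hq.ne', mul_one]
  refine ⟨l0, l1, fun n => ?_⟩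
  cases n with
  | zero =>
    simp [Finset.sum_range_succ, l0, l1]
    rw [← pow_two, hq2, pow_two]
  | succ n =>
    have key := hL (n + 2) (by omega)
    simp only [show n + 2 ≠ 1 by omega, if_false, Nat.sub_zero, pow_one, show n + 2 - 1 = n + 1 by omega] at key
    rw [eq_div_iff (by positivity)] at key
    -- normalize the first sum
    have s1 : ((n + 2 : ℕ) : ℝ) * ∑ r ∈ Finset.range (n + 2), ((n + 1).choose r : ℝ) *
        (Z r * Z (n + 2 - r - 1) - X r * Y (n + 2 - r - 1)) =
        ((n + 2).factorial : ℝ) * ∑ r ∈ Finset.range (n + 2),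
        (Z r / (r.factorial : ℝ) * (Z (n + 1 - r) / ((n + 1 - r).factorial : ℝ)) -
        X r / (r.factorial : ℝ) * (Y (n + 1 - r) / ((n + 1 - r).factorial : ℝ))) := by
      rw [Nat.factorial_succ, Nat.cast_mul, mul_assoc]
      congr 1
      rw [Finset.mul_sum]
      refine Finset.sum_congr rfl fun r hr => ?_
      have hr' : r ≤ n + 1 := by simp at hr; omega
      rw [Nat.cast_choose ℝ hr', show n + 2 - r - 1 = n + 1 - r by omega]
      have : (r.factorial : ℝ) ≠ 0 := by positivity
      have : ((n + 1 - r).factorial : ℝ) ≠ 0 := by positivity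
      field_simp
    have s2 : (1 / (((n + 2 : ℕ) : ℝ) + 1)) * ∑ r ∈ Finset.Icc 2 (n + 1), ((n + 2 + 1).choose r : ℝ) *
          (X r + Y r) * (X (n + 2 - r + 1) + Y (n + 2 - r + 1)) =
        ((n + 2).factorial : ℝ) * ∑ r ∈ Finset.range n, l (r + 2) * l (n + 1 - r) := by
      have e1 : Finset.Icc 2 (n + 1) = Finset.Ico 2 (n + 2) := by ext; simp; omega
      rw [e1, Finset.sum_Ico_eq_sum_range, show n + 2 - 2 = n by omega, Finset.mul_sum, Finset.mul_sum]
      refine Finset.sum_congr rfl fun r hr => ?_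
      have hr' : r < n := by simpa using hr
      rw [hl, hl, Nat.cast_choose ℝ (by omega : 2 + r ≤ n + 2 + 1), show n + 2 - (2 + r) + 1 = n + 1 - r by omega,
        show n + 2 + 1 - (2 + r) = n + 1 - r by omega, add_comm 2 r, Nat.factorial_succ (n + 2)]
      have : ((r + 2).factorial : ℝ) ≠ 0 := by positivity
      have : ((n + 1 - r).factorial : ℝ) ≠ 0 := by positivity
      push_cast
      field_simp
    rw [s1, s2, ← mul_sub] at key
    have hf : ((n + 2).factorial : ℝ) ≠ 0 := by positivity
    have key2 : l (n + 2) * (2 * q) = ∑ r ∈ Finset.range (n + 2),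
        (Z r / (r.factorial : ℝ) * (Z (n + 1 - r) / ((n + 1 - r).factorial : ℝ)) -
        X r / (r.factorial : ℝ) * (Y (n + 1 - r) / ((n + 1 - r).factorial : ℝ))) -
        ∑ r ∈ Finset.range n, l (r + 2) * l (n + 1 - r) := by
      rw [hl, div_mul_eq_mul_div, key, mul_comm, mul_div_assoc, div_self hf, mul_one]
    have e3 : ∑ r ∈ Finset.range (n + 1 + 3), l r * l (n + 1 + 2 - r) =
        ∑ r ∈ Finset.range n, l (r + 2) * l (n + 1 - r) + 2 * (l 1 * l (n + 2)) := by
      rw [Finset.sum_range_succ, Finset.sum_range_succ, Finset.sum_range_succ', Finset.sum_range_succ']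
      simp only [l0, Nat.sub_self, mul_zero, add_zero, zero_mul, zero_add]
      rw [show n + 1 + 2 - (n + 2) = 1 by omega, show n + 1 + 2 - 1 = n + 2 by omega]
      have : ∀ r ∈ Finset.range n, l (r + 1 + 1) * l (n + 1 + 2 - (r + 1 + 1)) = l (r + 2) * l (n + 1 - r) := by
        intro r hr
        rw [show n + 1 + 2 - (r + 1 + 1) = n + 1 - r by omega]
      rw [Finset.sum_congr rfl this]
      ring
    rw [e3, l1]
    linarith

lemma series_solution (X Y Z : ℕ → ℝ) (q c K ρ t : ℝ) (hq : 0 < q) (hcq : c ≤ q)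
    (hq2 : q ^ 2 = Z 0 ^ 2 - X 0 * Y 0)
    (hL0 : X 0 + Y 0 = 0)
    (hL : ∀ m : ℕ, 1 ≤ m → X m + Y m =
      ((m : ℝ) * ∑ r ∈ Finset.range m, ((m - 1).choose r : ℝ) *
        (Z r * Z (m - r - 1) - X r * Y (m - r - 1))
        - (1 / ((m : ℝ) + 1)) * ∑ r ∈ Finset.Icc 2 (m - 1), ((m + 1).choose r : ℝ) *
          (X r + Y r) * (X (m - r + 1) + Y (m - r + 1)))
        / ((2 : ℝ) ^ (1 - (if m = 1 then 1 else 0) : ℕ) * q))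
    (hK : 0 < K) (hρ : 0 < ρ) (hX : ∀ m, |X m / (m.factorial : ℝ)| ≤ K * ρ ^ m)
    (hY : ∀ m, |Y m / (m.factorial : ℝ)| ≤ K * ρ ^ m)
    (hZ : ∀ m, |Z m / (m.factorial : ℝ)| ≤ K * ρ ^ m)
    (ht1 : ρ * |t| ≤ 1 / 2) (ht2 : 4 * K * ρ ^ 2 * |t| < c) :
    (∑' m, X m * (t ^ m / (m.factorial : ℝ))) + (∑' m, Y m * (t ^ m / (m.factorial : ℝ))) =
      t * Real.sqrt ((∑' m, Z m * (t ^ m / (m.factorial : ℝ))) ^ 2 -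
        (∑' m, X m * (t ^ m / (m.factorial : ℝ))) * (∑' m, Y m * (t ^ m / (m.factorial : ℝ)))) := by
  set l : ℕ → ℝ := fun m => (X m + Y m) / (m.factorial : ℝ) with hl
  obtain ⟨l0, l1, hrec⟩ := rec_coeff X Y Z q hq hq2 hL0 hL l (fun m => rfl)
  have hgeo : Summable (fun m : ℕ => K * (1 / 2 : ℝ) ^ m) := (summable_geometric_two).mul_left K
  have nb : ∀ W : ℕ → ℝ, (∀ m, |W m / (m.factorial : ℝ)| ≤ K * ρ ^ m) →
      ∀ m, ‖W m * (t ^ m / (m.factorial : ℝ))‖ ≤ K * (1 / 2 : ℝ) ^ m := by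
    intro W hW m
    rw [mul_div_left_comm, Real.norm_eq_abs, abs_mul, abs_pow]
    calc |t| ^ m * |W m / (m.factorial : ℝ)| ≤ |t| ^ m * (K * ρ ^ m) := by gcongr; exact hW m
      _ = K * (ρ * |t|) ^ m := by rw [mul_pow]; ring
      _ ≤ _ := by gcongr
  have sX : Summable (fun m => ‖X m * (t ^ m / (m.factorial : ℝ))‖) :=
    Summable.of_nonneg_of_le (fun m => norm_nonneg _) (nb X hX) hgeo
  have sY : Summable (fun m => ‖Y m * (t ^ m / (m.factorial : ℝ))‖) :=
    Summable.of_nonneg_of_le (fun m => norm_nonneg _) (nb Y hY) hgeo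
  have sZ : Summable (fun m => ‖Z m * (t ^ m / (m.factorial : ℝ))‖) :=
    Summable.of_nonneg_of_le (fun m => norm_nonneg _) (nb Z hZ) hgeo
  have hsum : (∑' m, X m * (t ^ m / (m.factorial : ℝ))) + (∑' m, Y m * (t ^ m / (m.factorial : ℝ))) =
      ∑' m, l m * t ^ m := by
    rw [← sX.of_norm.tsum_add sY.of_norm]
    refine tsum_congr fun m => ?_
    simp only [hl]; ring
  have sl : Summable (fun m => l m * t ^ m) :=
    (sX.of_norm.add sY.of_norm).congr fun m => by simp only [hl]; ring
  have sln : Summable (fun m => ‖l m * t ^ m‖) := sl.norm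
  -- Cauchy products
  have pl : (∑' m, l m * t ^ m) * (∑' m, l m * t ^ m) =
      ∑' n, (∑ r ∈ Finset.range (n + 1), l r * l (n - r)) * t ^ n := by
    rw [tsum_mul_tsum_eq_tsum_sum_range_of_summable_norm sln sln]
    refine tsum_congr fun n => ?_
    rw [Finset.sum_mul]
    refine Finset.sum_congr rfl fun r hr => ?_
    have hr' : r ≤ n := by simp at hr; omega
    rw [show t ^ n = t ^ r * t ^ (n - r) by rw [← pow_add]; congr 1; omega]
    ring
  have spl : Summable (fun n => (∑ r ∈ Finset.range (n + 1), l r * l (n - r)) * t ^ n) := by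
    refine (summable_norm_sum_mul_range_of_summable_norm sln sln).of_norm.congr fun n => ?_
    rw [Finset.sum_mul]
    refine Finset.sum_congr rfl fun r hr => ?_
    have hr' : r ≤ n := by simp at hr; omega
    rw [show t ^ n = t ^ r * t ^ (n - r) by rw [← pow_add]; congr 1; omega]
    ring
  have pT : (∑' m, Z m * (t ^ m / (m.factorial : ℝ))) ^ 2 -
        (∑' m, X m * (t ^ m / (m.factorial : ℝ))) * (∑' m, Y m * (t ^ m / (m.factorial : ℝ))) =
      ∑' n, (∑ r ∈ Finset.range (n + 1), (Z r / (r.factorial : ℝ) * (Z (n - r) / ((n - r).factorial : ℝ)) -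
        X r / (r.factorial : ℝ) * (Y (n - r) / ((n - r).factorial : ℝ)))) * t ^ n := by
    rw [pow_two, tsum_mul_tsum_eq_tsum_sum_range_of_summable_norm sZ sZ,
      tsum_mul_tsum_eq_tsum_sum_range_of_summable_norm sX sY,
      ← (summable_norm_sum_mul_range_of_summable_norm sZ sZ).of_norm.tsum_sub
        (summable_norm_sum_mul_range_of_summable_norm sX sY).of_norm]
    refine tsum_congr fun n => ?_
    rw [← Finset.sum_sub_distrib, Finset.sum_mul]
    refine Finset.sum_congr rfl fun r hr => ?_
    have hr' : r ≤ n := by simp at hr; omega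
    rw [show t ^ n = t ^ r * t ^ (n - r) by rw [← pow_add]; congr 1; omega]
    ring
  have hsq : (∑' m, l m * t ^ m) ^ 2 = t ^ 2 * ((∑' m, Z m * (t ^ m / (m.factorial : ℝ))) ^ 2 -
        (∑' m, X m * (t ^ m / (m.factorial : ℝ))) * (∑' m, Y m * (t ^ m / (m.factorial : ℝ)))) := by
    rw [pT, pow_two, pl, ← spl.sum_add_tsum_nat_add 2, ← tsum_mul_left]
    simp only [Finset.sum_range_succ, Finset.sum_range_zero, l0, Nat.sub_self, zero_mul, mul_zero, add_zero, zero_add]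
    refine tsum_congr fun n => ?_
    have := hrec n
    simp only [Finset.sum_range_succ, l0, Nat.sub_self, zero_mul, mul_zero, add_zero, zero_add] at this
    rw [this, pow_add]; ring
  rcases eq_or_ne t 0 with rfl | ht
  · rw [hsum, zero_mul, tsum_eq_single 0]
    · simp [l0]
    · intro m hm; simp [hm]
  -- factor out t
  have s2 : Summable (fun n => l (n + 2) * t ^ n) := by
    have := ((summable_nat_add_iff 2).2 sl).mul_right ((t ^ 2)⁻¹)
    refine this.congr fun n => ?_
    rw [pow_add]
    have : t ^ 2 ≠ 0 := pow_ne_zero _ ht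
    field_simp
  set E := ∑' n, l (n + 2) * t ^ n with hE
  have hdec : ∑' m, l m * t ^ m = t * (q + t * E) := by
    rw [← sl.sum_add_tsum_nat_add 2, hE]
    simp only [Finset.sum_range_succ, Finset.sum_range_zero, l0, l1]
    rw [← tsum_mul_left, mul_add, ← tsum_mul_left]
    simp only [zero_add, zero_mul, pow_one]
    congr 1
    · ring
    · exact tsum_congr fun n => by rw [pow_add]; ring
  have hEb : |E| ≤ 4 * K * ρ ^ 2 := by
    have hg2 : HasSum (fun n : ℕ => 2 * K * ρ ^ 2 * (1 / 2 : ℝ) ^ n) (2 * K * ρ ^ 2 * 2) :=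
      hasSum_geometric_two.mul_left _
    have := tsum_of_norm_bounded (f := fun n => l (n + 2) * t ^ n) hg2 (fun n => by
      rw [Real.norm_eq_abs, abs_mul, abs_pow]
      have h1 : |l (n + 2)| ≤ 2 * (K * ρ ^ (n + 2)) := by
        simp only [hl, add_div]
        refine (abs_add_le _ _).trans ?_
        linarith [hX (n + 2), hY (n + 2)]
      calc |l (n + 2)| * |t| ^ n ≤ 2 * (K * ρ ^ (n + 2)) * |t| ^ n := by gcongr
        _ = 2 * K * ρ ^ 2 * (ρ * |t|) ^ n := by rw [mul_pow, pow_add]; ring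
        _ ≤ _ := by gcongr)
    rw [Real.norm_eq_abs] at this
    linarith
  have hD : 0 < q + t * E := by
    have h1 : |t * E| ≤ 4 * K * ρ ^ 2 * |t| := by
      rw [abs_mul, mul_comm]
      exact mul_le_mul_of_nonneg_right hEb (abs_nonneg _)
    have := neg_abs_le (t * E)
    linarith
  rw [hdec, mul_pow] at hsq
  have hsq' := mul_left_cancel₀ (pow_ne_zero 2 ht) hsq
  rw [hsum, hdec, ← hsq', Real.sqrt_sq hD.le]

/-- Majorization of the solutions of the recursive Poisson system by the
majorant sequence, and convergence of the resulting series in the `C^{2+1/2}` norm to a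
solution of the isotropic CRPC equation for all small `t`. -/
theorem stmt_9 (Ω : Set (ℝ × ℝ)) (hΩ : IsAnalyticJordanDomain Ω)
    (f : ℕ → ℝ × ℝ → ℝ)
    (hharm : ∀ p ∈ Ω, fxx (f 0) p + fyy (f 0) p = 0)
    (hana : AnalyticOnClosed (f 0) (closure Ω))
    (hhess : ∀ p ∈ closure Ω, ¬(fxx (f 0) p = 0 ∧ fxy (f 0) p = 0 ∧ fyy (f 0) p = 0))
    (hseq : IsPoissonSeq Ω f)
    (CΩ : ℝ) (hCΩ : 0 < CΩ)
    (hbound : ∀ m : ℕ, 1 ≤ m →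
      C2halfNorm (f m) Ω ≤ CΩ *
        C2halfNorm (fun p => 1 / Real.sqrt
          (-(fxx (f 0) p * fyy (f 0) p - (fxy (f 0) p) ^ 2))) Ω *
        ((m : ℝ) * ∑ r ∈ Finset.range m, ((m - 1).choose r : ℝ) *
            (C2halfNorm (f r) Ω * C2halfNorm (f (m - r - 1)) Ω)
          + 1 / ((m : ℝ) + 1) * ∑ r ∈ Finset.Icc 2 (m - 1), ((m + 1).choose r : ℝ) *
            (C2halfNorm (f r) Ω * C2halfNorm (f (m - r + 1)) Ω)))
    (a : ℕ → ℝ)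
    (ha0 : a 0 = C2halfNorm (f 0) Ω)
    (ha : ∀ m : ℕ, 1 ≤ m → a m =
      (CΩ * C2halfNorm (fun p => 1 / Real.sqrt
          (-(fxx (f 0) p * fyy (f 0) p - (fxy (f 0) p) ^ 2))) Ω) *
        ((m : ℝ) * ∑ r ∈ Finset.range m, ((m - 1).choose r : ℝ) * a r * a (m - r - 1)
          + 1 / ((m : ℝ) + 1) * ∑ r ∈ Finset.Icc 2 (m - 1), ((m + 1).choose r : ℝ) *
              a r * a (m - r + 1))) :
    (∀ m : ℕ, C2halfNorm (f m) Ω ≤ a m) ∧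
    ∃ ε > (0 : ℝ), ∀ t : ℝ, |t| < ε →
      (∀ p ∈ closure Ω, Summable (fun m : ℕ => f m p * t ^ m / (m.factorial : ℝ))) ∧
      Tendsto (fun n : ℕ => C2halfNorm
          (fun p => (∑' m : ℕ, f m p * t ^ m / (m.factorial : ℝ))
            - ∑ m ∈ Finset.range n, f m p * t ^ m / (m.factorial : ℝ)) Ω)
        atTop (𝓝 0) ∧
      ∀ p ∈ Ω, IsotropicCRPCAt t
        (fun q => ∑' m : ℕ, f m q * t ^ m / (m.factorial : ℝ)) p := by
  have hN : 0 ≤ CΩ * C2halfNorm (fun p => 1 / Real.sqrt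
          (-(fxx (f 0) p * fyy (f 0) p - (fxy (f 0) p) ^ 2))) Ω :=
    mul_nonneg hCΩ.le (C2halfNorm_nonneg _ _)
  have hle : ∀ m : ℕ, C2halfNorm (f m) Ω ≤ a m := by
    intro m
    induction m using Nat.strong_induction_on with
    | _ m ih =>
      rcases Nat.eq_zero_or_pos m with rfl | hm
      · exact ha0.ge
      · rw [ha m hm]
        refine (hbound m hm).trans (mul_le_mul_of_nonneg_left ?_ hN)
        have key : ∀ i j : ℕ, i < m → j < m → ∀ c : ℕ, (c : ℝ) *
            (C2halfNorm (f i) Ω * C2halfNorm (f j) Ω) ≤ (c : ℝ) * a i * a j := by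
          intro i j hi hj c
          rw [mul_assoc]
          exact mul_le_mul_of_nonneg_left (mul_le_mul (ih i hi) (ih j hj) (C2halfNorm_nonneg _ _)
            ((C2halfNorm_nonneg _ _).trans (ih i hi))) (Nat.cast_nonneg c)
        refine add_le_add (mul_le_mul_of_nonneg_left (Finset.sum_le_sum fun r hr => ?_)
          (Nat.cast_nonneg m)) (mul_le_mul_of_nonneg_left (Finset.sum_le_sum fun r hr => ?_)
          (by positivity))
        · rw [Finset.mem_range] at hr
          exact key _ _ hr (by omega) _
        · rw [Finset.mem_Icc] at hr
          exact key _ _ (by omega) (by omega) _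
  refine ⟨hle, ?_⟩
  have ha_nn : ∀ m, 0 ≤ a m := fun m => (C2halfNorm_nonneg _ _).trans (hle m)
  obtain ⟨K, ρ, hK, hρ, hgeom⟩ := a_geom _ hN a ha_nn ha
  obtain ⟨c, hc, hcl⟩ := lower_bound hΩ hharm hana hhess hseq CΩ (by simpa using hbound 1 le_rfl)
  have hnice : ∀ m, Nice (f m) Ω := by
    intro m
    rcases Nat.eq_zero_or_pos m with rfl | hm
    · exact nice_of_analytic hΩ.1 hana
    · exact nice_of_closed (hseq m hm).1
  have hbd : ∀ m, Bd (f m) Ω (C2halfNorm (f m) Ω) := fun m => Bd_norm hΩ (hnice m)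
  refine ⟨min (1 / (2 * ρ)) (c / (4 * K * ρ ^ 2)), by positivity, fun t ht => ?_⟩
  have ht1 : ρ * |t| ≤ 1 / 2 := by
    have h := (ht.trans_le (min_le_left _ _)).le
    rw [le_div_iff₀ (by positivity)] at h
    linarith
  have ht2 : 4 * K * ρ ^ 2 * |t| < c := by
    have h := ht.trans_le (min_le_right _ _)
    rw [lt_div_iff₀ (by positivity)] at h
    linarith
  simp only [mul_div_assoc]
  have hfac : ∀ m : ℕ, (0 : ℝ) < (m.factorial : ℝ) := fun m => by positivity
  have hdiv : ∀ m : ℕ, ∀ x : ℝ, |x| ≤ C2halfNorm (f m) Ω → |x / (m.factorial : ℝ)| ≤ K * ρ ^ m := by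
    intro m x hx
    rw [abs_div, abs_of_pos (hfac m)]
    exact (div_le_div_of_nonneg_right (hx.trans (hle m)) (hfac m).le).trans (hgeom m)
  have hAle : ∀ m : ℕ, C2halfNorm (f m) Ω * |t ^ m / (m.factorial : ℝ)| ≤ K * (1 / 2) ^ m := by
    intro m
    have h1 := hdiv m (C2halfNorm (f m) Ω) (abs_of_nonneg (C2halfNorm_nonneg _ _)).le
    have h0 : C2halfNorm (f m) Ω * |t ^ m / (m.factorial : ℝ)|
        = |C2halfNorm (f m) Ω / (m.factorial : ℝ)| * |t| ^ m := by
      rw [abs_div, abs_div, abs_of_nonneg (C2halfNorm_nonneg (f m) Ω), abs_pow]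
      ring
    rw [h0]
    calc _ ≤ K * ρ ^ m * |t| ^ m := mul_le_mul_of_nonneg_right h1 (by positivity)
      _ = K * (ρ * |t|) ^ m := by rw [mul_pow, mul_assoc]
      _ ≤ _ := mul_le_mul_of_nonneg_left (pow_le_pow_left₀ (by positivity) ht1 m) hK.le
  have hA0 : ∀ m : ℕ, 0 ≤ C2halfNorm (f m) Ω * |t ^ m / (m.factorial : ℝ)| := fun m =>
    mul_nonneg (C2halfNorm_nonneg _ _) (abs_nonneg _)
  have hA : Summable (fun m : ℕ => C2halfNorm (f m) Ω * |t ^ m / (m.factorial : ℝ)|) :=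
    Summable.of_nonneg_of_le hA0 hAle
      ((summable_geometric_of_lt_one (by norm_num) (by norm_num)).mul_left K)
  have hu : ∀ m : ℕ, ContDiffOn ℝ (⊤ : ℕ∞) (fun p => f m p * (t ^ m / (m.factorial : ℝ))) Ω :=
    fun m => (hnice m).1.mul contDiffOn_const
  have hB : ∀ m : ℕ, Bd (fun p => f m p * (t ^ m / (m.factorial : ℝ))) Ω
      (C2halfNorm (f m) Ω * |t ^ m / (m.factorial : ℝ)|) := fun m => Bd_mul_const _ (hbd m)
  refine ⟨fun p hp => ?_, tail_tendsto (u := fun m p => f m p * (t ^ m / (m.factorial : ℝ)))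
    hΩ.1 hA hA0 hu hB, fun p hp => ?_⟩
  · by_cases hpΩ : p ∈ Ω
    · exact Summable.of_norm_bounded hA fun m => ((hB m).1 p hpΩ).1
    · have hfr : p ∈ frontier Ω := by
        rw [hΩ.1.frontier_eq]
        exact ⟨hp, hpΩ⟩
      refine summable_of_ne_finset_zero (s := {0}) fun m hm => ?_
      rw [Finset.mem_singleton] at hm
      rw [(hseq m (Nat.pos_of_ne_zero hm)).2.1 p hfr, zero_mul]
  · obtain ⟨-, -, e3, e4, e5⟩ := tsum_derivs
      (u := fun m p => f m p * (t ^ m / (m.factorial : ℝ))) hΩ.1 hA hu hB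
    unfold IsotropicCRPCAt
    rw [e3 hp, e4 hp, e5 hp]
    simp only [fxx_mul_const, fxy_mul_const, fyy_mul_const]
    have hq := hc.trans_le (hcl p hp)
    exact series_solution (fun m => fxx (f m) p) (fun m => fyy (f m) p) (fun m => fxy (f m) p)
      (Real.sqrt ((fxy (f 0) p) ^ 2 - fxx (f 0) p * fyy (f 0) p)) c K ρ t hq (hcl p hp)
      (Real.sq_sqrt (Real.sqrt_pos.1 hq).le) (hharm p hp) (fun m hm => (hseq m hm).2.2 p hp)
      hK hρ
      (fun m => hdiv m _ ((hbd m).1 p hp).2.2.2.1)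
      (fun m => hdiv m _ ((hbd m).1 p hp).2.2.2.2.2)
      (fun m => hdiv m _ ((hbd m).1 p hp).2.2.2.2.1) ht1 ht2

end
end
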